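/- Fix a real number T > 0 and integers n, k ≥ 1 and α = (α_1,…,α_k) ∈ ℕ_{>0}^k. For 1 ≤ i ≤ n let a_i : ℂ^k × [0,T] → ℂ be a finite sum a_i(w,x) = Σ_β c_{i,β}(x) w^β over monomials w^β, where each coefficient c_{i,β} is an admissible function of x, and suppose that for each fixed x the polynomial w ↦ a_i(w,x) is α-homogeneous. Set A(w) := (a_1(w,·),…,a_n(w,·)), and define the universal center set 𝒰_A := {w ∈ ℂ^k : I_{i_1,…,i_m}(A(w)) = 0 for every m ≥ 1 and all indices i_1,…,i_m ∈ {1,…,n}} and the center set 𝒞_A := {w ∈ ℂ^k : the equation E(A(w)) determines a center}. Assume 𝒰_A = {0}. Then there exist N ≥ 1, finitely many moments m_1,…,m_N (i.e., functions of the form w ↦ m^{n_1,…,n_j}_{i_1,…,i_{j+1}}(A(w)) for suitable multi-indices) and holomorphic polynomials p_1,…,p_N on ℂ^N such that 𝒞_A = {w ∈ ℂ^k : p_j(m_1(w),…,m_N(w)) = 0 for all 1 ≤ j ≤ N}. -/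

import Mathlib

open MeasureTheory Set Filter Topology

noncomputable section

/-- Iterated integral over the simplex `0 ≤ s₁ ≤ … ≤ s_m ≤ x`; the head of the
list is attached to the outermost (largest) variable. -/
def simplexInt : List (ℝ → ℂ) → ℝ → ℂ
  | [] => fun _ => 1
  | f :: fs => fun x => ∫ s in (0:ℝ)..x, f s * simplexInt fs s

/-- The basic iterated integral `I_{i₁,…,i_m}(a)`. -/
def iterInt (T : ℝ) {n : ℕ} (a : Fin n → ℝ → ℂ) (l : List (Fin n)) : ℂ :=
  simplexInt ((l.map a).reverse) T

/-- `ã(x) = ∫_0^x a(s) ds`. -/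
def primitive (a : ℝ → ℂ) (x : ℝ) : ℂ := ∫ s in (0:ℝ)..x, a s

/-- The moment `m^{n₁,…,n_j}_{i₁,…,i_{j+1}}(a)`, encoded by the list
`ps = [(i₁,n₁),…,(i_j,n_j)]` of index/exponent pairs and the final index `i`. -/
def moment (T : ℝ) {n : ℕ} (a : Fin n → ℝ → ℂ) (ps : List (Fin n × ℕ)) (i : Fin n) : ℂ :=
  ∫ s in (0:ℝ)..T, (ps.map fun q => primitive (a q.1) s ^ q.2).prod * a i s

/-- A function is admissible if on `[0,T]` it is a polynomial in `x`
or a finite linear combination of the exponentials `e^{2πijx/T}`, `j ∈ ℤ`. -/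
def Admissible (T : ℝ) (f : ℝ → ℂ) : Prop :=
  (∃ p : Polynomial ℂ, ∀ x ∈ Icc (0:ℝ) T, f x = p.eval (x : ℂ)) ∨
  (∃ (s : Finset ℤ) (c : ℤ → ℂ), ∀ x ∈ Icc (0:ℝ) T,
    f x = ∑ j ∈ s, c j * Complex.exp (2 * (Real.pi : ℂ) * Complex.I * (j : ℂ) * (x : ℂ) / (T : ℂ)))

/-- The equation `dv/dx = Σ_{i=1}^n a_i(x) v^{i+1}` determines a center. -/
def DeterminesCenter (T : ℝ) {n : ℕ} (a : Fin n → ℝ → ℂ) : Prop :=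
  ∃ ε > (0:ℝ), ∀ v : ℝ → ℂ,
    (∀ x ∈ Icc (0:ℝ) T, v x = v 0 + ∫ s in (0:ℝ)..x, ∑ i, a i s * v s ^ ((i : ℕ) + 2)) →
    ‖v 0‖ < ε → v T = v 0

def hMat {P : Type*} (M : Multiset P) (v : P → ℂ) (e : ℕ) : Matrix (Fin e) (Fin e) ℂ :=
  Matrix.of fun j k => (M.map fun x => v x ^ ((j:ℕ) + (k:ℕ))).sum

def bVec {P : Type*} (M : Multiset P) (v ψ : P → ℂ) (e : ℕ) : Fin e → ℂ :=
  (hMat M v e).adjugate.mulVec fun k => (M.map fun x => ψ x * v x ^ (k:ℕ)).sum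

lemma ms_poly {P : Type*} (M : Multiset P) (v w : P → ℂ) (e : ℕ)
    (h : ∀ k < e, (M.map fun x => w x * v x ^ k).sum = 0) (L : Polynomial ℂ)
    (hL : L.natDegree < e) : (M.map fun x => w x * L.eval (v x)).sum = 0 := by
  have : ∀ x, w x * L.eval (v x) = ∑ k ∈ Finset.range e, L.coeff k * (w x * v x ^ k) := by
    intro x
    rw [Polynomial.eval_eq_sum_range' hL, Finset.mul_sum]
    exact Finset.sum_congr rfl fun k _ => by ring
  simp only [this]
  rw [Multiset.sum_map_sum]
  refine Finset.sum_eq_zero fun k hk => ?_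
  rw [Multiset.sum_map_mul_left, h k (Finset.mem_range.1 hk), mul_zero]

lemma ms_class {P : Type*} (M : Multiset P) (v w : P → ℂ) (e : ℕ)
    (h : ∀ k < e, (M.map fun x => w x * v x ^ k).sum = 0)
    (hc : (M.map v).toFinset.card ≤ e) (ν : ℂ) :
    ((M.filter fun x => v x = ν).map w).sum = 0 := by
  by_cases hν : ν ∈ (M.map v).toFinset
  · have h1 := Lagrange.degree_basis (v := (id : ℂ → ℂ)) (s := (M.map v).toFinset)
      (Set.injOn_id _) hν
    have hpos : 0 < (M.map v).toFinset.card := Finset.card_pos.2 ⟨ν, hν⟩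
    have h2 := ms_poly M v w e h (Lagrange.basis (M.map v).toFinset id ν) (by
      have := Polynomial.natDegree_eq_of_degree_eq_some h1
      omega)
    rw [← h2]
    have h3 : (M.map fun x => w x * (Lagrange.basis (M.map v).toFinset id ν).eval (v x)) =
        M.map fun x => if v x = ν then w x else 0 := by
      refine Multiset.map_congr rfl fun x hx => ?_
      have hx' : v x ∈ (M.map v).toFinset := by simp; exact ⟨x, hx, rfl⟩
      split_ifs with h4
      · have := Lagrange.eval_basis_self (v := (id : ℂ → ℂ)) (Set.injOn_id _) hν
        simp only [id] at this
        rw [h4, this, mul_one]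
      · have := Lagrange.eval_basis_of_ne (v := (id : ℂ → ℂ)) (Ne.symm h4) hx'
        simp only [id] at this
        rw [this, mul_zero]
    rw [h3]
    clear h3 h2 h1 hpos hν hc h
    induction M using Multiset.induction_on with
    | empty => simp
    | cons x M ih =>
      by_cases hx : v x = ν <;> simp [hx, ih]
  · rw [Multiset.filter_eq_nil.2]
    · simp
    · intro x hx h0
      exact hν (by simp; exact ⟨x, hx, h0⟩)

lemma hMat_mulVec {P : Type*} (M : Multiset P) (v : P → ℂ) (e : ℕ) (b : Fin e → ℂ) (k : Fin e) :
    (hMat M v e).mulVec b k = (M.map fun x => (∑ j, b j * v x ^ (j:ℕ)) * v x ^ (k:ℕ)).sum := by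
  simp only [Matrix.mulVec, dotProduct, hMat, Matrix.of_apply, ← Multiset.sum_map_mul_right,
    Finset.sum_mul]
  rw [Multiset.sum_map_sum]
  refine Finset.sum_congr rfl fun j _ => ?_
  congr 1
  exact Multiset.map_congr rfl fun x _ => by ring

lemma bVec_class {P : Type*} (M : Multiset P) (v ψ : P → ℂ) (e : ℕ)
    (hc : (M.map v).toFinset.card ≤ e) (ν : ℂ) :
    ((M.filter fun x => v x = ν).card : ℂ) * (∑ j, bVec M v ψ e j * ν ^ (j:ℕ)) =
      (hMat M v e).det * ((M.filter fun x => v x = ν).map ψ).sum := by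
  have h := ms_class M v (fun x => (∑ j, bVec M v ψ e j * v x ^ (j:ℕ)) - (hMat M v e).det * ψ x) e
    (by
      intro k hk
      have h1 := hMat_mulVec M v e (bVec M v ψ e) ⟨k, hk⟩
      rw [bVec, Matrix.mulVec_mulVec, Matrix.mul_adjugate, Matrix.smul_mulVec,
        Matrix.one_mulVec, Pi.smul_apply, smul_eq_mul, ← Multiset.sum_map_mul_left] at h1
      simp only [sub_mul]
      rw [Multiset.sum_map_sub, sub_eq_zero]
      simp only [bVec] at h1 ⊢
      rw [← h1]
      congr 1
      exact Multiset.map_congr rfl fun x _ => by ring) hc ν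
  rw [Multiset.sum_map_sub, sub_eq_zero, Multiset.sum_map_mul_left] at h
  rw [← h]
  have : ((M.filter fun x => v x = ν).map fun x => ∑ j, bVec M v ψ e j * v x ^ (j:ℕ)) =
      (M.filter fun x => v x = ν).map fun _ => ∑ j, bVec M v ψ e j * ν ^ (j:ℕ) :=
    Multiset.map_congr rfl fun x hx => by rw [(Multiset.mem_filter.1 hx).2]
  rw [this]
  simp

lemma hMat_det_ne {P : Type*} (M : Multiset P) (v : P → ℂ) (e : ℕ)
    (hc : (M.map v).toFinset.card = e) : (hMat M v e).det ≠ 0 := by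
  intro h0
  obtain ⟨b, hb0, hb⟩ := Matrix.exists_mulVec_eq_zero_iff.2 h0
  apply hb0
  set q : Polynomial ℂ := ∑ j : Fin e, Polynomial.monomial (j:ℕ) (b j) with hq
  have hqe : ∀ t, q.eval t = ∑ j, b j * t ^ (j:ℕ) := fun t => by
    simp [hq, Polynomial.eval_finsetSum]
  have hroots : ∀ ν ∈ (M.map v).toFinset, q.eval ν = 0 := by
    intro ν hν
    have h := ms_class M v (fun x => q.eval (v x)) e (by
      intro k hk
      have h1 := hMat_mulVec M v e b ⟨k, hk⟩
      rw [hb] at h1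
      simp only [hqe]
      exact h1.symm) hc.le ν
    have : ((M.filter fun x => v x = ν).map fun x => q.eval (v x)) =
        (M.filter fun x => v x = ν).map fun _ => q.eval ν :=
      Multiset.map_congr rfl fun x hx => by rw [(Multiset.mem_filter.1 hx).2]
    rw [this] at h
    simp at h
    rcases h with h | h
    · obtain ⟨x, hx, hxν⟩ : ∃ a ∈ M, v a = ν := by simpa using hν
      exact absurd hxν (h x hx)
    · exact h
  have hq0 : q = 0 := by
    refine Polynomial.eq_zero_of_degree_lt_of_eval_finset_eq_zero (M.map v).toFinset ?_ hroots
    rw [hc]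
    refine lt_of_le_of_lt (Polynomial.degree_sum_le _ _) ?_
    rw [Finset.sup_lt_iff (by exact WithBot.bot_lt_coe _)]
    intro j _
    exact lt_of_le_of_lt (Polynomial.degree_monomial_le _ _) (by exact_mod_cast j.2)
  ext j
  have := congrArg (fun p => p.coeff (j:ℕ)) hq0
  simpa [hq, Polynomial.finsetSum_coeff, Polynomial.coeff_monomial, Fin.val_inj] using this

lemma card_of_hMat_det_ne {P : Type*} (M : Multiset P) (v : P → ℂ) (e : ℕ)
    (hd : (hMat M v e).det ≠ 0) : e ≤ (M.map v).toFinset.card := by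
  by_contra hlt
  push Not at hlt
  set V := (M.map v).toFinset
  set r : Polynomial ℂ := ∏ ν ∈ V, (Polynomial.X - Polynomial.C ν) with hr
  have hm : r.Monic := Polynomial.monic_prod_of_monic _ _ fun ν _ => Polynomial.monic_X_sub_C ν
  have hdeg : r.natDegree = V.card := by
    rw [hr, Polynomial.natDegree_prod_of_monic _ _ fun ν _ => Polynomial.monic_X_sub_C ν]; simp
  refine hd (Matrix.exists_mulVec_eq_zero_iff.1 ⟨fun j => r.coeff j, ?_, ?_⟩)
  · intro h
    have := congrFun h ⟨V.card, hlt⟩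
    simp only [Pi.zero_apply] at this
    rw [← hdeg] at this
    have h1 : r.coeff r.natDegree = 1 := hm
    rw [h1] at this; exact one_ne_zero this
  · ext k
    rw [hMat_mulVec]
    rw [Multiset.map_congr rfl (g := fun _ => (0:ℂ))]
    · simp
    · intro x hx
      have h1 := Polynomial.eval_eq_sum_range' (p := r) (n := e) (by rw [hdeg]; exact hlt) (v x)
      rw [Fin.sum_univ_eq_sum_range (fun j => r.coeff j * v x ^ j) e, ← h1]
      have hxV : v x ∈ V := by simp [V]; exact ⟨x, hx, rfl⟩
      rw [hr, Polynomial.eval_prod, Finset.prod_eq_zero hxV (by simp), zero_mul]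

lemma fz_iter {S : Set ℂ} (hS : IsOpen S) {c : ℂ} (hc : c ∈ S) (m : ℕ) :
    ∀ {h : ℂ → ℂ}, DifferentiableOn ℂ h S →
      DifferentiableOn ℂ ((Function.swap dslope c)^[m] h) S := by
  induction m with
  | zero => intro h hh; simpa using hh
  | succ m ih =>
    intro h hh
    rw [Function.iterate_succ]
    exact ih ((Complex.differentiableOn_dslope (hS.mem_nhds hc)).2 hh)

lemma fz_aux {S K : Set ℂ} (hS : IsOpen S) (hKS : K ⊆ S) (N : ℕ) :
    ∀ (h : ℂ → ℂ), DifferentiableOn ℂ h S → (∀ z ∈ K, ¬ ∀ᶠ y in 𝓝 z, h y = 0) →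
    (∃ hf : {z ∈ K | h z = 0}.Finite, hf.toFinset.card = N) →
    ∃ P : Polynomial ℂ, P.Monic ∧ (∀ r ∈ P.roots, r ∈ K) ∧ ∃ e : ℂ → ℂ,
      DifferentiableOn ℂ e S ∧ (∀ z ∈ K, e z ≠ 0) ∧ ∀ z, h z = P.eval z * e z := by
  induction N with
  | zero =>
    intro h hh _ ⟨hf, hc⟩
    refine ⟨1, Polynomial.monic_one, by simp, h, hh, ?_, by simp⟩
    intro z hz h0
    have := Finset.card_eq_zero.1 hc
    have hm : z ∈ hf.toFinset := by simp [hz, h0]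
    rw [this] at hm; simp at hm
  | succ N ih =>
    intro h hh hne ⟨hf, hc⟩
    obtain ⟨c, hcm⟩ : hf.toFinset.Nonempty := by rw [← Finset.card_pos, hc]; omega
    have hcK : c ∈ K ∧ h c = 0 := by simpa using hcm
    obtain ⟨p, hp⟩ := (hh.analyticAt (hS.mem_nhds (hKS hcK.1)))
    have hp0 : p ≠ 0 := by
      intro h0; exact hne c hcK.1 (hp.locally_zero_iff.2 h0)
    set g := (Function.swap dslope c)^[p.order] h with hg
    have hfac : ∀ z, h z = (z - c) ^ p.order * g z := fun z => by
      simpa using hp.eq_pow_order_mul_iterate_dslope z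
    have hgc : g c ≠ 0 := hp.iterate_dslope_fslope_ne_zero hp0
    have hgd : DifferentiableOn ℂ g S := fz_iter hS (hKS hcK.1) _ hh
    have hset : {z ∈ K | g z = 0} = {z ∈ K | h z = 0} \ {c} := by
      ext z
      simp only [mem_ofPred_eq, Set.mem_sdiff, mem_singleton_iff]
      constructor
      · rintro ⟨h1, h2⟩
        refine ⟨⟨h1, by rw [hfac, h2, mul_zero]⟩, ?_⟩
        rintro rfl; exact hgc h2
      · rintro ⟨⟨h1, h2⟩, h3⟩
        refine ⟨h1, ?_⟩
        rw [hfac] at h2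
        exact (mul_eq_zero.1 h2).resolve_left (pow_ne_zero _ (sub_ne_zero.2 h3))
    have hgf : {z ∈ K | g z = 0}.Finite := by rw [hset]; exact hf.sdiff
    obtain ⟨P, hPm, hPr, e, he, hne', hPe⟩ := ih g hgd (by
      intro z hz h0
      exact hne z hz (h0.mono fun y hy => by rw [hfac, hy, mul_zero])) ⟨hgf, by
        have : hgf.toFinset = hf.toFinset.erase c := by
          ext z
          have := congrArg (z ∈ ·) hset
          simp only [mem_ofPred_eq, Set.mem_sdiff, mem_singleton_iff, eq_iff_iff] at this
          simp [this]; tauto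
        rw [this, Finset.card_erase_of_mem hcm, hc]; rfl⟩
    refine ⟨(Polynomial.X - Polynomial.C c) ^ p.order * P,
      ((Polynomial.monic_X_sub_C c).pow _).mul hPm, ?_, e, he, hne', ?_⟩
    · intro r hr
      rw [Polynomial.roots_mul (((Polynomial.monic_X_sub_C c).pow _).mul hPm).ne_zero,
        Polynomial.roots_pow, Polynomial.roots_X_sub_C] at hr
      rcases Multiset.mem_add.1 hr with h1 | h1
      · have := Multiset.mem_of_mem_nsmul h1
        simp at this; rw [this]; exact hcK.1
      · exact hPr r h1
    · intro z; rw [hfac, hPe]; simp; ring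

/-- factorization of analytic functions on compact sets -/
lemma fz {K : Set ℂ} (hK : IsCompact K) {h : ℂ → ℂ} (hh : AnalyticOnNhd ℂ h K)
    (hne : ∀ z ∈ K, ¬ ∀ᶠ y in 𝓝 z, h y = 0) :
    ∃ P : Polynomial ℂ, P.Monic ∧ (∀ r ∈ P.roots, r ∈ K) ∧ ∃ e : ℂ → ℂ,
      AnalyticOnNhd ℂ e K ∧ (∀ z ∈ K, e z ≠ 0) ∧ ∀ z, h z = P.eval z * e z := by
  have hS : IsOpen {z | AnalyticAt ℂ h z} := isOpen_analyticAt ℂ h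
  have hfin : {z ∈ K | h z = 0}.Finite := by
    have key : ∀ z ∈ K, {y | y ≠ z → h y ≠ 0} ∈ 𝓝 z := by
      intro z hz
      rcases (hh z hz).eventually_eq_zero_or_eventually_ne_zero with h1 | h1
      · exact absurd h1 (hne z hz)
      · exact eventually_nhdsWithin_iff.1 h1
    obtain ⟨t, _, ht⟩ := hK.elim_nhds_subcover _ key
    refine t.finite_toSet.subset ?_
    rintro y ⟨hy, h0⟩
    obtain ⟨z, hz, hyz⟩ := Set.mem_iUnion₂.1 (ht hy)
    by_contra hc
    exact hyz (fun h => hc (by rw [h]; exact hz)) h0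
  obtain ⟨P, h1, h2, e, h3, h4, h5⟩ := fz_aux (K := K) hS (fun z hz => hh z hz) _ h
    (fun z hz => (hz : AnalyticAt ℂ h z).differentiableAt.differentiableWithinAt) hne ⟨hfin, rfl⟩
  exact ⟨P, h1, h2, e, fun z hz => h3.analyticAt (hS.mem_nhds (hh z hz)), h4, h5⟩

/-- abstract contour functional -/
structure IsCtr (X K : Set ℂ) (Λ : (ℂ → ℂ) → ℂ) : Prop where
  op : IsOpen X
  sub : X ⊆ K
  cpt : IsCompact K
  zero : ∀ h, AnalyticOnNhd ℂ h K → Λ h = 0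
  one : ∀ c ∈ X, Λ (fun z => (z - c)⁻¹) = 1
  congr : ∀ h g, (∀ z ∈ K \ X, h z = g z) → Λ h = Λ g
  add : ∀ h g, ContinuousOn h (K \ X) → ContinuousOn g (K \ X) →
    Λ (fun z => h z + g z) = Λ h + Λ g
  smul : ∀ (c : ℂ) h, Λ (fun z => c * h z) = c * Λ h
  bound : ∃ C, ∀ h M, 0 ≤ M → (∀ z ∈ K \ X, ‖h z‖ ≤ M) → ‖Λ h‖ ≤ C * M

lemma IsCtr.cauchy {X K : Set ℂ} {Λ} (hΛ : IsCtr X K Λ) {G : ℂ → ℂ}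
    (hG : AnalyticOnNhd ℂ G K) {c : ℂ} (hc : c ∈ X) :
    Λ (fun z => G z * (z - c)⁻¹) = G c := by
  have hS : IsOpen {z | AnalyticAt ℂ G z} := isOpen_analyticAt ℂ G
  have hGd : DifferentiableOn ℂ G {z | AnalyticAt ℂ G z} := fun z hz =>
    (hz : AnalyticAt ℂ G z).differentiableAt.differentiableWithinAt
  have hd := (Complex.differentiableOn_dslope (hS.mem_nhds (hG c (hΛ.sub hc)))).2 hGd
  have hA : AnalyticOnNhd ℂ (dslope G c) K := fun z hz =>
    hd.analyticAt (hS.mem_nhds (hG z hz))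
  have hne : ∀ z ∈ K \ X, z - c ≠ 0 := fun z hz h =>
    hz.2 (by rw [sub_eq_zero.1 h]; exact hc)
  rw [hΛ.congr _ (fun z => dslope G c z + G c * (z - c)⁻¹), hΛ.add, hΛ.zero _ hA, hΛ.smul,
    hΛ.one c hc]
  · ring
  · exact hA.continuousOn.mono sdiff_subset
  · exact continuousOn_const.mul ((continuousOn_id.sub continuousOn_const).inv₀ hne)
  · intro z hz
    have h1 := hne z hz
    rw [dslope_of_ne _ (fun h => h1 (by rw [h, sub_self])), slope_def_field]
    field_simp
    ring

/-- the parametric contour integral is holomorphic in the parameter -/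
lemma IsCtr.differentiableOn {X K : Set ℂ} {Λ} (hΛ : IsCtr X K Λ) {g U : ℂ → ℂ} {ρ : ℝ}
    (hg : ContinuousOn g (K \ X)) (hU : ContinuousOn U (K \ X))
    (hρ : 0 < ρ) (hUρ : ∀ z ∈ K \ X, ρ ≤ ‖U z‖) :
    DifferentiableOn ℂ (fun s => Λ (fun z => g z * (U z - s)⁻¹)) (Metric.ball 0 ρ) := by
  obtain ⟨C, hC⟩ := hΛ.bound
  have hcpt : IsCompact (K \ X) := hΛ.cpt.diff hΛ.op
  obtain ⟨Mg, hMg⟩ := hcpt.exists_bound_of_continuousOn hg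
  have hU0 : ∀ z ∈ K \ X, U z ≠ 0 := fun z hz h => by
    have := hUρ z hz; rw [h, norm_zero] at this; linarith
  have hUs : ∀ z ∈ K \ X, ∀ s ∈ Metric.ball (0:ℂ) ρ, U z - s ≠ 0 := fun z hz s hs h => by
    have := hUρ z hz; rw [sub_eq_zero.1 h] at this; simp at hs; linarith
  have key : TendstoLocallyUniformlyOn
      (fun (m : ℕ) s => ∑ j ∈ Finset.range m, s ^ j * Λ (fun z => g z * (U z)⁻¹ ^ (j + 1)))
      (fun s => Λ (fun z => g z * (U z - s)⁻¹)) atTop (Metric.ball 0 ρ) := by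
    rw [tendstoLocallyUniformlyOn_iff_forall_isCompact Metric.isOpen_ball]
    intro K' hKρ hK
    obtain ⟨r, hr0, hrρ, hKr⟩ : ∃ r, 0 ≤ r ∧ r < ρ ∧ ∀ s ∈ K', ‖s‖ ≤ r := by
      rcases K'.eq_empty_or_nonempty with rfl | hne
      · exact ⟨0, le_rfl, hρ, by simp⟩
      · obtain ⟨s, hs, hmax⟩ := hK.exists_isMaxOn hne continuous_norm.continuousOn
        exact ⟨‖s‖, norm_nonneg _, by simpa using hKρ hs, fun t ht => hmax ht⟩
    have hrem : ∀ (m : ℕ), ∀ s ∈ K', Λ (fun z => g z * (U z - s)⁻¹) =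
        ∑ j ∈ Finset.range m, s ^ j * Λ (fun z => g z * (U z)⁻¹ ^ (j + 1)) +
        Λ (fun z => g z * ((s * (U z)⁻¹) ^ m * (U z - s)⁻¹)) := by
      intro m s hs
      induction m with
      | zero => simp
      | succ m ih =>
        rw [ih, Finset.sum_range_succ, ← hΛ.smul, add_assoc, ← hΛ.add]
        · congr 1
          apply hΛ.congr
          intro z hz
          have h1 := hU0 z hz
          have h2 := hUs z hz s (hKρ hs)
          simp only [mul_pow, inv_pow]
          field_simp
          ring
        · exact continuousOn_const.mul (hg.mul ((hU.inv₀ hU0).pow _))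
        · exact hg.mul (((continuousOn_const.mul (hU.inv₀ hU0)).pow _).mul
            ((hU.sub continuousOn_const).inv₀ (fun z hz => hUs z hz s (hKρ hs))))
    rw [Metric.tendstoUniformlyOn_iff]
    intro ε hε
    have hlim : Tendsto (fun m : ℕ => |C| * (|Mg| * ((r / ρ) ^ m * (ρ - r)⁻¹))) atTop (𝓝 0) := by
      have := (tendsto_pow_atTop_nhds_zero_of_lt_one (div_nonneg hr0 hρ.le)
        ((div_lt_one hρ).2 hrρ))
      simpa using ((this.mul_const (ρ - r)⁻¹).const_mul |Mg|).const_mul |C|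
    filter_upwards [hlim.eventually_lt_const hε] with m hm s hs
    rw [dist_eq_norm, hrem m s hs, add_sub_cancel_left]
    refine lt_of_le_of_lt ?_ hm
    have hp : 0 ≤ |Mg| * ((r / ρ) ^ m * (ρ - r)⁻¹) := by
      have : 0 < ρ - r := by linarith
      positivity
    refine (hC _ _ hp ?_).trans (mul_le_mul_of_nonneg_right (le_abs_self C) hp)
    intro z hz
    rw [norm_mul, norm_mul, norm_pow, norm_mul, norm_inv, norm_inv]
    have h1 := hUρ z hz
    have h2 := hKr s hs
    have h3 : ρ - r ≤ ‖U z - s‖ := by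
      have := norm_sub_norm_le (U z) s; linarith
    have h4 : 0 < ρ - r := by linarith
    gcongr
    · exact (hMg z hz).trans (le_abs_self _)
    · rw [← div_eq_mul_inv]
      gcongr
  refine key.differentiableOn (Eventually.of_forall fun m => ?_) Metric.isOpen_ball
  exact Differentiable.differentiableOn (by fun_prop)

/-- Fibre system -/
structure FibS (X K : Set ℂ) (U : ℂ → ℂ) (ρ : ℝ) (fib : ℂ → Multiset ℂ) : Prop where
  op : IsOpen X
  sub : X ⊆ K
  cpt : IsCompact K
  an : AnalyticOnNhd ℂ U K
  bd : ∀ z ∈ K \ X, ρ ≤ ‖U z‖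
  mem : ∀ s ∈ Metric.ball (0:ℂ) ρ, ∀ z, z ∈ fib s ↔ z ∈ X ∧ U z = s
  simp : ∀ s ∈ Metric.ball (0:ℂ) ρ, ∀ z ∈ fib s, deriv U z ≠ 0 → (fib s).count z = 1
  diff : ∀ G : ℂ → ℂ, AnalyticOnNhd ℂ G K →
    DifferentiableOn ℂ (fun s => ((fib s).map G).sum) (Metric.ball 0 ρ)

lemma IsCtr.sum_ms {X K : Set ℂ} {Λ} (hΛ : IsCtr X K Λ) {G : ℂ → ℂ}
    (hG : AnalyticOnNhd ℂ G K) (M : Multiset ℂ) (hM : ∀ c ∈ M, c ∈ X) :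
    ContinuousOn (fun z => (M.map fun c => G z * (z - c)⁻¹).sum) (K \ X) ∧
    Λ (fun z => (M.map fun c => G z * (z - c)⁻¹).sum) = (M.map G).sum := by
  induction M using Multiset.induction_on with
  | empty => simpa using ⟨continuousOn_const, hΛ.zero (fun _ => 0) (fun _ _ => analyticAt_const)⟩
  | cons c M ih =>
    obtain ⟨h1, h2⟩ := ih (fun d hd => hM d (Multiset.mem_cons_of_mem hd))
    have hc := hM c (Multiset.mem_cons_self c M)
    have hco : ContinuousOn (fun z => G z * (z - c)⁻¹) (K \ X) :=
      (hG.continuousOn.mono sdiff_subset).mul ((continuousOn_id.sub continuousOn_const).inv₀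
        (fun z hz h => hz.2 (by rw [show z = c from sub_eq_zero.1 h]; exact hc)))
    simp only [Multiset.map_cons, Multiset.sum_cons]
    exact ⟨hco.add h1, by rw [hΛ.add _ _ hco h1, h2, hΛ.cauchy hG hc]⟩

lemma logderiv_prod (P : Polynomial ℂ) (z : ℂ) (hz : P.eval z ≠ 0) :
    P.derivative.eval z = P.eval z * (P.roots.map fun c => (z - c)⁻¹).sum := by
  have hs : P.Splits := IsAlgClosed.splits P
  have := hs.eval_derivative_div_eval_of_ne_zero (x := z) hz
  rw [div_eq_iff hz] at this
  rw [this, mul_comm]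
  simp [one_div]

lemma IsCtr.fibS {X K : Set ℂ} {Λ} (hΛ : IsCtr X K Λ) {U : ℂ → ℂ} {ρ : ℝ} (hρ : 0 < ρ)
    (hU : AnalyticOnNhd ℂ U K) (hbd : ∀ z ∈ K \ X, ρ ≤ ‖U z‖)
    (hnc : ∀ z ∈ X, ∀ s, ¬ ∀ᶠ y in 𝓝 z, U y = s) :
    ∃ fib, FibS X K U ρ fib := by
  have hUs : ∀ z ∈ K \ X, ∀ s ∈ Metric.ball (0:ℂ) ρ, U z - s ≠ 0 := fun z hz s hs h => by
    have := hbd z hz; rw [sub_eq_zero.1 h] at this; simp at hs; linarith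
  have hex : ∀ s, ∃ P : Polynomial ℂ, s ∈ Metric.ball (0:ℂ) ρ →
      P.Monic ∧ (∀ r ∈ P.roots, r ∈ K) ∧ ∃ e : ℂ → ℂ,
      AnalyticOnNhd ℂ e K ∧ (∀ z ∈ K, e z ≠ 0) ∧
        ∀ z, U z - s = P.eval z * e z := by
    intro s
    by_cases hs : s ∈ Metric.ball (0:ℂ) ρ
    · obtain ⟨P, h⟩ := fz hΛ.cpt (h := fun z => U z - s) (hU.sub fun _ _ => analyticAt_const) (by
        intro z hz h0
        by_cases hzX : z ∈ X
        · exact hnc z hzX s (h0.mono fun y hy => sub_eq_zero.1 hy)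
        · exact hUs z ⟨hz, hzX⟩ s hs h0.self_of_nhds)
      exact ⟨P, fun _ => h⟩
    · exact ⟨0, fun h => absurd h hs⟩
  choose P hP using hex
  have hmem : ∀ s ∈ Metric.ball (0:ℂ) ρ, ∀ z, z ∈ (P s).roots ↔ z ∈ X ∧ U z = s := by
    intro s hs z
    obtain ⟨h1, h2, e, h3, h4, h5⟩ := hP s hs
    rw [Polynomial.mem_roots h1.ne_zero, Polynomial.IsRoot]
    constructor
    · intro h
      have hc : z ∈ K := h2 z ((Polynomial.mem_roots h1.ne_zero).2 h)
      have h6 : U z - s = 0 := by rw [h5, h, zero_mul]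
      refine ⟨?_, sub_eq_zero.1 h6⟩
      by_contra hX
      exact hUs z ⟨hc, hX⟩ s hs h6
    · rintro ⟨hX, h⟩
      have h6 := h5 z
      rw [h, sub_self, eq_comm, mul_eq_zero] at h6
      exact h6.resolve_right (h4 z (hΛ.sub hX))
  have hder : ∀ s ∈ Metric.ball (0:ℂ) ρ, ∀ e : ℂ → ℂ, AnalyticOnNhd ℂ e K →
      (∀ z, U z - s = (P s).eval z * e z) → ∀ z ∈ K,
      deriv U z = (P s).derivative.eval z * e z + (P s).eval z * deriv e z := by
    intro s hs e h3 h5 z hz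
    have : U = fun z => (P s).eval z * e z + s := by ext y; rw [← h5]; ring
    conv_lhs => rw [this]
    exact ((((P s).hasDerivAt z).mul (h3 z hz).differentiableAt.hasDerivAt).add_const s).deriv
  refine ⟨fun s => (P s).roots, hΛ.op, hΛ.sub, hΛ.cpt, hU, hbd, hmem, ?_, ?_⟩
  · intro s hs z hz hd
    obtain ⟨h1, h2, e, h3, h4, h5⟩ := hP s hs
    have hr := (Polynomial.mem_roots h1.ne_zero).1 hz
    rw [hder s hs e h3 h5 z (h2 z hz), (show (P s).eval z = 0 from hr), zero_mul, add_zero] at hd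
    have : (P s).derivative.eval z ≠ 0 := left_ne_zero_of_mul hd
    rw [Polynomial.count_roots]
    have hle := (Polynomial.one_lt_rootMultiplicity_iff_isRoot h1.ne_zero (t := z))
    have hpos := (Polynomial.rootMultiplicity_pos h1.ne_zero).2 hr
    by_contra hcon
    exact this (hle.1 (by omega)).2
  · intro G hG
    have hU' : ContinuousOn (fun z => G z * deriv U z) (K \ X) :=
      (hG.continuousOn.mul hU.deriv.continuousOn).mono sdiff_subset
    refine (hΛ.differentiableOn hU' (hU.continuousOn.mono sdiff_subset) hρ hbd).congr ?_
    intro s hs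
    obtain ⟨h1, h2, e, h3, h4, h5⟩ := hP s hs
    obtain ⟨k1, k2⟩ := hΛ.sum_ms hG (P s).roots (fun c hc => ((hmem s hs c).1 hc).1)
    have hE : AnalyticOnNhd ℂ (fun z => G z * (deriv e z * (e z)⁻¹)) K :=
      hG.mul (h3.deriv.mul (h3.inv h4))
    rw [← k2, hΛ.congr (fun z => G z * deriv U z * (U z - s)⁻¹)
      (fun z => ((P s).roots.map fun c => G z * (z - c)⁻¹).sum + G z * (deriv e z * (e z)⁻¹)),
      hΛ.add _ _ k1 (hE.continuousOn.mono sdiff_subset), hΛ.zero _ hE, add_zero]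
    intro z hz
    have h6 := hUs z hz s hs
    rw [h5] at h6
    have h7 := left_ne_zero_of_mul h6
    have h8 := right_ne_zero_of_mul h6
    rw [hder s hs e h3 h5 z hz.1, h5, logderiv_prod _ z h7, Multiset.sum_map_mul_left]
    field_simp

lemma isCtr_ball {R : ℝ} (hR : 0 < R) : IsCtr (Metric.ball 0 R) (Metric.closedBall 0 R)
    (fun h => (2 * Real.pi * Complex.I)⁻¹ * ∮ z in C(0, R), h z) where
  op := Metric.isOpen_ball
  sub := Metric.ball_subset_closedBall
  cpt := isCompact_closedBall 0 R
  zero h hh := by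
    rw [DiffContOnCl.circleIntegral_eq_zero hR.le, mul_zero]
    refine DifferentiableOn.diffContOnCl ?_
    rw [closure_ball _ hR.ne']
    exact hh.differentiableOn
  one c hc := by
    rw [circleIntegral.integral_sub_inv_of_mem_ball hc, inv_mul_cancel₀ Complex.two_pi_I_ne_zero]
  congr h g hg := by
    rw [circleIntegral.integral_congr hR.le (g := g)]
    intro z hz
    exact hg z (by simp at hz; simp [hz])
  add h g hh hg := by
    have hs : Metric.sphere (0:ℂ) R ⊆ Metric.closedBall 0 R \ Metric.ball 0 R := by
      intro z hz; simp at hz; simp [hz]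
    rw [circleIntegral.integral_add ((hh.mono hs).circleIntegrable hR.le)
      ((hg.mono hs).circleIntegrable hR.le), mul_add]
  smul c h := by
    have := circleIntegral.integral_smul c h 0 R
    simp only [smul_eq_mul] at this
    rw [this]; ring
  bound := by
    refine ⟨‖(2 * Real.pi * Complex.I : ℂ)⁻¹‖ * (2 * Real.pi * R), fun h M _ hM => ?_⟩
    rw [norm_mul, mul_assoc ‖_‖]
    gcongr
    refine circleIntegral.norm_integral_le_of_norm_le_const hR.le ?_
    intro z hz
    exact hM z (by simp at hz; simp [hz])

lemma isCtr_ann {r R : ℝ} (hr : 0 < r) (hR : r < R) :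
    IsCtr (Metric.ball 0 R \ Metric.closedBall 0 r) (Metric.closedBall 0 R \ Metric.ball 0 r)
    (fun h => (2 * Real.pi * Complex.I)⁻¹ * ((∮ z in C(0, R), h z) - ∮ z in C(0, r), h z)) where
  op := Metric.isOpen_ball.sdiff Metric.isClosed_closedBall
  sub := by
    intro z hz; simp at hz ⊢; exact ⟨hz.1.le, hz.2.le⟩
  cpt := (isCompact_closedBall 0 R).diff Metric.isOpen_ball
  zero h hh := by
    rw [Complex.circleIntegral_eq_of_differentiable_on_annulus_off_countable hr hR.le
      countable_empty hh.continuousOn, sub_self, mul_zero]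
    intro z hz
    refine (hh z ?_).differentiableAt
    simp at hz ⊢; exact ⟨hz.1.le, hz.2.le⟩
  one c hc := by
    rw [circleIntegral.integral_sub_inv_of_mem_ball hc.1, DiffContOnCl.circleIntegral_eq_zero hr.le,
      sub_zero, inv_mul_cancel₀ Complex.two_pi_I_ne_zero]
    refine DifferentiableOn.diffContOnCl ?_
    rw [closure_ball _ hr.ne']
    intro z hz
    refine (DifferentiableAt.inv (by fun_prop) ?_).differentiableWithinAt
    intro h
    exact hc.2 (by rw [← show z = c from sub_eq_zero.1 h]; exact hz)
  congr h g hg := by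
    rw [circleIntegral.integral_congr (hr.le.trans hR.le) (g := g),
      circleIntegral.integral_congr hr.le (g := g)]
    · intro z hz
      exact hg z (by simp at hz; simp [hz, hR.le])
    · intro z hz
      exact hg z (by simp at hz; simp [hz, hR.le])
  add h g hh hg := by
    have hs : ∀ t, t = r ∨ t = R → Metric.sphere (0:ℂ) t ⊆
        (Metric.closedBall 0 R \ Metric.ball 0 r) \ (Metric.ball 0 R \ Metric.closedBall 0 r) := by
      rintro t (rfl | rfl) z hz <;> simp at hz <;> simp [hz, hR.le]
    have h1 := hs R (Or.inr rfl)
    have h2 := hs r (Or.inl rfl)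
    have hR0 := hr.le.trans hR.le
    rw [circleIntegral.integral_add ((hh.mono h1).circleIntegrable hR0)
      ((hg.mono h1).circleIntegrable hR0), circleIntegral.integral_add
      ((hh.mono h2).circleIntegrable hr.le) ((hg.mono h2).circleIntegrable hr.le)]
    ring
  smul c h := by
    have := circleIntegral.integral_smul c h 0 R
    have h2 := circleIntegral.integral_smul c h 0 r
    simp only [smul_eq_mul] at this h2
    rw [this, h2]; ring
  bound := by
    refine ⟨‖(2 * Real.pi * Complex.I : ℂ)⁻¹‖ * (2 * Real.pi * R + 2 * Real.pi * r),
      fun h M _ hM => ?_⟩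
    rw [norm_mul, mul_assoc ‖_‖, add_mul]
    gcongr
    refine (norm_sub_le _ _).trans (add_le_add ?_ ?_)
    · refine circleIntegral.norm_integral_le_of_norm_le_const (hr.le.trans hR.le) ?_
      intro z hz
      exact hM z (by simp at hz; simp [hz, hR.le])
    · refine circleIntegral.norm_integral_le_of_norm_le_const hr.le ?_
      intro z hz
      exact hM z (by simp at hz; simp [hz, hR.le])

section cfs
variable {ι : Type} [Fintype ι] [DecidableEq ι] {X K : ι → Set ℂ} {U : ι → ℂ → ℂ}
  {fib : ι → ℂ → Multiset ℂ} {ρ : ℝ}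

def cf (fib : ι → ℂ → Multiset ℂ) (s : ℂ) : Multiset (ι × ℂ) :=
  ∑ k, (fib k s).map (Prod.mk k)

lemma mem_cf (hF : ∀ k, FibS (X k) (K k) (U k) ρ (fib k)) {s : ℂ} (hs : s ∈ Metric.ball (0:ℂ) ρ)
    (π : ι × ℂ) : π ∈ cf fib s ↔ π.2 ∈ X π.1 ∧ U π.1 π.2 = s := by
  rw [← (hF π.1).mem s hs, cf, Multiset.mem_sum]
  constructor
  · rintro ⟨k, _, h⟩
    obtain ⟨z, hz, rfl⟩ := Multiset.mem_map.1 h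
    exact hz
  · intro h
    exact ⟨π.1, Finset.mem_univ _, Multiset.mem_map.2 ⟨π.2, h, rfl⟩⟩

lemma sum_cf (G : ι × ℂ → ℂ) (s : ℂ) :
    ((cf fib s).map G).sum = ∑ k, ((fib k s).map fun z => G (k, z)).sum := by
  rw [cf, ← Multiset.coe_mapAddMonoidHom, map_sum, Multiset.sum_sum]
  simp [Multiset.map_map, Function.comp_def]

lemma count_cf (π : ι × ℂ) (s : ℂ) : (cf fib s).count π = (fib π.1 s).count π.2 := by
  rw [cf, Multiset.count_sum', Finset.sum_eq_single π.1]
  · exact Multiset.count_map_eq_count' _ _ (Prod.mk_right_injective π.1) π.2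
  · intro k _ hk
    rw [Multiset.count_eq_zero]
    intro h
    obtain ⟨z, _, h⟩ := Multiset.mem_map.1 h
    exact hk (by rw [← h])
  · simp

lemma diff_cf (hF : ∀ k, FibS (X k) (K k) (U k) ρ (fib k)) (G : ι × ℂ → ℂ)
    (hG : ∀ k, AnalyticOnNhd ℂ (fun z => G (k, z)) (K k)) :
    DifferentiableOn ℂ (fun s => ((cf fib s).map G).sum) (Metric.ball 0 ρ) := by
  simp only [sum_cf]
  exact DifferentiableOn.fun_sum fun k _ => (hF k).diff _ (hG k)

lemma card_cf (hF : ∀ k, FibS (X k) (K k) (U k) ρ (fib k)) {s t : ℂ}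
    (hs : s ∈ Metric.ball (0:ℂ) ρ) (ht : t ∈ Metric.ball (0:ℂ) ρ) :
    Multiset.card (cf fib s) = Multiset.card (cf fib t) := by
  have h := (diff_cf hF (fun _ => 1) (fun k _ _ => analyticAt_const)).continuousOn
  have h2 : ContinuousOn (fun s => Multiset.card (cf fib s)) (Metric.ball (0:ℂ) ρ) := by
    simp only [Multiset.map_const', Multiset.sum_replicate, nsmul_eq_mul, mul_one] at h
    exact (Nat.isClosedEmbedding_coe_real.isInducing.continuousOn_iff).2 (by
      have := Complex.continuous_re.comp_continuousOn h
      simpa [Function.comp_def] using this)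
  exact (convex_ball (0:ℂ) ρ).isPreconnected.constant h2 hs ht

lemma diff_hMat (hF : ∀ k, FibS (X k) (K k) (U k) ρ (fib k)) (v : ι × ℂ → ℂ)
    (hv : ∀ k, AnalyticOnNhd ℂ (fun z => v (k, z)) (K k)) (e : ℕ) (i j : Fin e) :
    DifferentiableOn ℂ (fun s => hMat (cf fib s) v e i j) (Metric.ball 0 ρ) :=
  diff_cf hF _ fun k => (hv k).pow _

lemma diff_det {e : ℕ} {S : Set ℂ} (A : ℂ → Matrix (Fin e) (Fin e) ℂ)
    (hA : ∀ i j, DifferentiableOn ℂ (fun s => A s i j) S) :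
    DifferentiableOn ℂ (fun s => (A s).det) S := by
  simp only [Matrix.det_apply]
  exact DifferentiableOn.fun_sum fun σ _ =>
    (DifferentiableOn.fun_finsetProd fun i _ => hA _ _).const_smul _

lemma diff_bVec (hF : ∀ k, FibS (X k) (K k) (U k) ρ (fib k)) (v ψ : ι × ℂ → ℂ)
    (hv : ∀ k, AnalyticOnNhd ℂ (fun z => v (k, z)) (K k))
    (hψ : ∀ k, AnalyticOnNhd ℂ (fun z => ψ (k, z)) (K k)) (e : ℕ) (j : Fin e) :
    DifferentiableOn ℂ (fun s => bVec (cf fib s) v ψ e j) (Metric.ball 0 ρ) := by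
  simp only [bVec, Matrix.mulVec, dotProduct]
  refine DifferentiableOn.fun_sum fun k _ => DifferentiableOn.mul ?_ ?_
  · simp only [Matrix.adjugate_apply]
    refine diff_det _ fun i l => ?_
    by_cases h : i = k
    · subst h; simp only [Matrix.updateRow_self]; exact differentiableOn_const _
    · simp only [Matrix.updateRow_ne h]; exact diff_hMat hF v hv e i l
  · exact diff_cf hF _ fun k => (hψ k).mul ((hv k).pow _)

lemma sep_lin {n : ℕ} (S : Finset (Fin n → ℂ)) (h0 : ∀ d ∈ S, d ≠ 0) :
    ∃ μ : Fin n → ℂ, ∀ d ∈ S, ∑ i, μ i * d i ≠ 0 := by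
  obtain ⟨φ, hφ⟩ := Module.exists_dual_forall_apply_ne_zero (K := ℂ) (M := Fin n → ℂ)
    (fun d : S => (d : Fin n → ℂ)) (fun d => h0 d d.2)
  refine ⟨fun i => φ (Pi.single i 1), fun d hd => ?_⟩
  have := hφ ⟨d, hd⟩
  have h2 : φ d = ∑ i, φ (Pi.single i 1) * d i := by
    conv_lhs => rw [← LinearMap.sum_single_apply (fun _ => ℂ) d]
    rw [map_sum]
    refine Finset.sum_congr rfl fun i _ => ?_
    have : (Pi.single i (d i) : Fin n → ℂ) = d i • Pi.single i (1:ℂ) := by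
      rw [← Pi.single_smul]; simp
    simp [this, mul_comm]
  rw [← h2]; exact this

lemma exists_sep {n : ℕ} (hF : ∀ k, FibS (X k) (K k) (U k) ρ (fib k)) (hρ : 0 < ρ)
    (F : ι → Fin n → ℂ → ℂ) :
    ∃ (e : ℕ) (μ : Fin n → ℂ),
      (∀ s ∈ Metric.ball (0:ℂ) ρ,
        ((cf fib s).map fun π i => F π.1 i π.2).toFinset.card ≤ e) ∧
      ∃ s ∈ Metric.ball (0:ℂ) ρ,
        (hMat (cf fib s) (fun π => ∑ i, μ i * F π.1 i π.2) e).det ≠ 0 := by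
  set f : ι × ℂ → Fin n → ℂ := fun π i => F π.1 i π.2 with hf
  set N : Set ℕ := {m | ∃ s ∈ Metric.ball (0:ℂ) ρ, ((cf fib s).map f).toFinset.card = m} with hN
  have hb : BddAbove N := by
    refine ⟨Multiset.card (cf fib 0), ?_⟩
    rintro m ⟨s, hs, rfl⟩
    rw [card_cf hF (t := s) (by simpa using hρ) hs]
    exact (Multiset.toFinset_card_le _).trans (by simp)
  have hne : N.Nonempty := ⟨_, 0, by simpa using hρ, rfl⟩
  obtain ⟨s, hs, hse⟩ := Nat.sSup_mem hne hb
  set V := ((cf fib s).map f).toFinset with hV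
  obtain ⟨μ, hμ⟩ := sep_lin ((V ×ˢ V).filter (fun p => p.1 ≠ p.2) |>.image fun p => p.1 - p.2) (by
    intro d hd
    simp only [Finset.mem_image, Finset.mem_filter] at hd
    obtain ⟨p, ⟨_, hp⟩, rfl⟩ := hd
    exact sub_ne_zero.2 hp)
  refine ⟨sSup N, μ, fun t ht => le_csSup hb ⟨t, ht, rfl⟩, s, hs, hMat_det_ne _ _ _ ?_⟩
  have h1 : ((cf fib s).map fun π => ∑ i, μ i * F π.1 i π.2).toFinset =
      V.image fun y => ∑ i, μ i * y i := by
    ext ν; simp [hV, hf]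
  rw [h1, Finset.card_image_of_injOn, hse]
  intro y hy z hz hyz
  by_contra hne
  refine hμ (y - z) ?_ ?_
  · simp only [Finset.mem_image, Finset.mem_filter]
    exact ⟨(y, z), ⟨Finset.mem_product.2 ⟨hy, hz⟩, hne⟩, rfl⟩
  · simp only [Pi.sub_apply, mul_sub, Finset.sum_sub_distrib]
    exact sub_eq_zero.2 hyz
end cfs

lemma loc_inv {U : ℂ → ℂ} {z0 : ℂ} (h : AnalyticAt ℂ U z0) (hd : deriv U z0 ≠ 0) :
    ∃ β : ℂ → ℂ, β (U z0) = z0 ∧ AnalyticAt ℂ β (U z0) ∧ (∀ᶠ s in 𝓝 (U z0), U (β s) = s) ∧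
      ∀ᶠ z in 𝓝 z0, β (U z) = z := by
  refine ⟨h.hasStrictDerivAt.localInverse _ _ _ hd, ?_, h.analyticAt_localInverse hd, ?_, ?_⟩
  · exact HasStrictFDerivAt.localInverse_apply_image _
  · exact HasStrictFDerivAt.eventually_right_inverse _
  · exact HasStrictFDerivAt.eventually_left_inverse _

lemma fs_pigeon {A B D : Type*} [DecidableEq B] [DecidableEq D] (S : Finset A) (p : A → B) (q : A → D)
    (h : ∀ a ∈ S, ∀ b ∈ S, p a = p b → q a = q b) (hc : (S.image p).card ≤ (S.image q).card) :
    ∀ a ∈ S, ∀ b ∈ S, q a = q b → p a = p b := by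
  classical
  set R := S.image fun a => (p a, q a) with hR
  have h1 : R.image Prod.fst = S.image p := by rw [hR, Finset.image_image]; rfl
  have h2 : R.image Prod.snd = S.image q := by rw [hR, Finset.image_image]; rfl
  have h3 : (R.image Prod.fst).card = R.card := by
    rw [Finset.card_image_iff]
    intro x hx y hy hxy
    simp only [hR, Finset.coe_image, Set.mem_image, Finset.mem_coe] at hx hy
    obtain ⟨a, ha, rfl⟩ := hx
    obtain ⟨b, hb, rfl⟩ := hy
    exact Prod.ext hxy (h a ha b hb hxy)
  have h4 : (R.image Prod.snd).card = R.card :=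
    le_antisymm Finset.card_image_le (by rw [← h3, h1, h2]; exact hc)
  rw [Finset.card_image_iff] at h4
  intro a ha b hb hab
  have := h4 (Finset.mem_coe.2 (Finset.mem_image_of_mem (fun a => (p a, q a)) ha))
    (Finset.mem_coe.2 (Finset.mem_image_of_mem (fun a => (p a, q a)) hb)) hab
  exact congrArg Prod.fst this

section cfs
variable {ι : Type} [Fintype ι] [DecidableEq ι] {X K : ι → Set ℂ} {U : ι → ℂ → ℂ}
  {fib : ι → ℂ → Multiset ℂ} {ρ : ℝ}

lemma loc_struct {n : ℕ} (hF : ∀ k, FibS (X k) (K k) (U k) ρ (fib k))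
    (F : ι → Fin n → ℂ → ℂ) (hFa : ∀ k i, AnalyticOnNhd ℂ (F k i) (K k)) (μ : Fin n → ℂ) (e : ℕ)
    (he : ∀ s ∈ Metric.ball (0:ℂ) ρ,
        ((cf fib s).map fun π i => F π.1 i π.2).toFinset.card ≤ e)
    (k : ι) (ξ : ℂ → ℂ) (x0 : ℂ) (hξ : AnalyticAt ℂ ξ x0) (hX : ξ x0 ∈ X k)
    (hs0 : U k (ξ x0) ∈ Metric.ball (0:ℂ) ρ)
    (hdet : (hMat (cf fib (U k (ξ x0))) (fun π => ∑ i, μ i * F π.1 i π.2) e).det ≠ 0)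
    (hder : ∀ π ∈ cf fib (U k (ξ x0)), deriv (U π.1) π.2 ≠ 0) :
    ∃ (C : Finset (ι × ℂ)) (B : ι × ℂ → ℂ → ℂ), (k, ξ x0) ∈ C ∧
      (∀ᶠ x in 𝓝 x0, (cf fib (U k (ξ x))).filter (fun π => ∑ i, μ i * F π.1 i π.2 = ∑ i, μ i * F k i (ξ x))
        = C.val.map fun π => (π.1, B π x)) ∧
      ∀ π ∈ C, (∀ᶠ x in 𝓝 x0, B π x ∈ X π.1) ∧ (∀ᶠ x in 𝓝 x0, DifferentiableAt ℂ (B π) x) ∧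
        (∀ᶠ x in 𝓝 x0, U π.1 (B π x) = U k (ξ x)) ∧
        ∀ᶠ x in 𝓝 x0, ∀ i, F π.1 i (B π x) = F k i (ξ x) := by
  set s0 := U k (ξ x0) with hs0d
  set v : ι × ℂ → ℂ := fun π => ∑ i, μ i * F π.1 i π.2 with hv
  set S := (cf fib s0).toFinset with hS
  have hmem : ∀ π ∈ S, π.2 ∈ X π.1 ∧ U π.1 π.2 = s0 := fun π hπ =>
    (mem_cf hF hs0 π).1 (by simpa [hS] using hπ)
  have hder' : ∀ π ∈ S, deriv (U π.1) π.2 ≠ 0 := fun π hπ => hder π (by simpa [hS] using hπ)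
  have hnd : (cf fib s0).Nodup := by
    rw [Multiset.nodup_iff_count_le_one]
    intro π
    by_cases hπ : π ∈ cf fib s0
    · rw [count_cf, (hF π.1).simp s0 hs0 π.2 (((hF π.1).mem s0 hs0 π.2).2 ((mem_cf hF hs0 π).1 hπ)) (hder π hπ)]
    · rw [Multiset.count_eq_zero_of_notMem hπ]; simp
  have hSv : S.val = cf fib s0 := by simp [hS, hnd.dedup]
  have hβ : ∀ π : ι × ℂ, ∃ β : ℂ → ℂ, π ∈ S → β s0 = π.2 ∧ AnalyticAt ℂ β s0 ∧
      (∀ᶠ s in 𝓝 s0, U π.1 (β s) = s) ∧ ∀ᶠ z in 𝓝 π.2, β (U π.1 z) = z := by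
    intro π
    by_cases hπ : π ∈ S
    · have := loc_inv ((hF π.1).an π.2 ((hF π.1).sub (hmem π hπ).1)) (hder' π hπ)
      rw [(hmem π hπ).2] at this
      obtain ⟨β, h⟩ := this
      exact ⟨β, fun _ => h⟩
    · exact ⟨id, fun h => absurd h hπ⟩
  choose β hβ using hβ
  -- continuity facts
  have hcβ : ∀ π ∈ S, Tendsto (β π) (𝓝 s0) (𝓝 π.2) := fun π hπ => by
    have := (hβ π hπ).2.1.continuousAt.tendsto
    rwa [(hβ π hπ).1] at this
  have hcF : ∀ π ∈ S, ∀ i, AnalyticAt ℂ (F π.1 i) π.2 := fun π hπ i =>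
    hFa π.1 i π.2 ((hF π.1).sub (hmem π hπ).1)
  have hcv : ∀ π ∈ S, Tendsto (fun s => v (π.1, β π s)) (𝓝 s0) (𝓝 (v π)) := by
    intro π hπ
    simp only [hv]
    exact tendsto_finsetSum _ fun i _ => ((hcF π hπ i).continuousAt.tendsto.comp (hcβ π hπ)).const_mul _
  have e1 : ∀ᶠ s in 𝓝 s0, ∀ π ∈ S, β π s ∈ X π.1 ∧ U π.1 (β π s) = s := by
    rw [Finset.eventually_all]
    intro π hπ
    exact ((hcβ π hπ).eventually ((hF π.1).op.mem_nhds (hmem π hπ).1)).and (hβ π hπ).2.2.1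
  have e2 : ∀ᶠ s in 𝓝 s0, ∀ π ∈ S, ∀ π' ∈ S, v π ≠ v π' → v (π.1, β π s) ≠ v (π'.1, β π' s) := by
    rw [Finset.eventually_all]; intro π hπ
    rw [Finset.eventually_all]; intro π' hπ'
    by_cases h : v π = v π'
    · simp [h]
    · filter_upwards [((hcv π hπ).sub (hcv π' hπ')).eventually_ne (sub_ne_zero.2 h)] with s hs _ using sub_ne_zero.1 hs
  have e3 : ∀ᶠ s in 𝓝 s0, ∀ π ∈ S, ∀ π' ∈ S, π ≠ π' → (π.1, β π s) ≠ (π'.1, β π' s) := by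
    rw [Finset.eventually_all]; intro π hπ
    rw [Finset.eventually_all]; intro π' hπ'
    by_cases h : π.2 = π'.2
    · refine Eventually.of_forall fun s hne heq => hne (Prod.ext ?_ h)
      exact (Prod.mk.inj heq).1
    · filter_upwards [((hcβ π hπ).sub (hcβ π' hπ')).eventually_ne (sub_ne_zero.2 h)] with s hs _ heq
      exact sub_ne_zero.1 hs (Prod.mk.inj heq).2
  have e4 : ∀ᶠ s in 𝓝 s0, s ∈ Metric.ball (0:ℂ) ρ := Metric.isOpen_ball.mem_nhds hs0
  have hVe : e ≤ (S.image v).card := by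
    have := card_of_hMat_det_ne _ _ _ hdet
    convert this using 2
    ext ν; simp [hS]
  have key : ∀ᶠ s in 𝓝 s0, cf fib s = S.val.map (fun π => (π.1, β π s)) ∧
      ∀ π ∈ S, ∀ π' ∈ S, v π = v π' → (fun i => F π.1 i (β π s)) = fun i => F π'.1 i (β π' s) := by
    filter_upwards [e1, e2, e3, e4] with s h1 h2 h3 h4
    have hc : cf fib s = S.val.map (fun π => (π.1, β π s)) := by
      symm
      refine Multiset.eq_of_le_of_card_le ?_ ?_
      · rw [Multiset.le_iff_subset]
        · intro π hπ
          obtain ⟨π', hπ', rfl⟩ := Multiset.mem_map.1 hπ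
          exact (mem_cf hF h4 _).2 (h1 π' hπ')
        · refine Multiset.Nodup.map_on ?_ S.nodup
          intro π hπ π' hπ' heq
          by_contra hne
          exact h3 π hπ π' hπ' hne heq
      · rw [Multiset.card_map, hSv, card_cf hF h4 hs0]
    refine ⟨hc, ?_⟩
    refine fs_pigeon S (fun π i => F π.1 i (β π s)) v ?_ ?_
    · intro π hπ π' hπ' heq
      by_contra hne
      refine h2 π hπ π' hπ' hne ?_
      simp only [hv]
      exact Finset.sum_congr rfl fun i _ => by rw [congrFun heq i]
    · refine le_trans ?_ hVe
      have := he s h4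
      rw [hc, Multiset.map_map] at this
      exact this
  have hk0 : (k, ξ x0) ∈ S := by
    rw [hS, Multiset.mem_toFinset, mem_cf hF hs0]; exact ⟨hX, rfl⟩
  have hξc : Tendsto ξ (𝓝 x0) (𝓝 (ξ x0)) := hξ.continuousAt.tendsto
  have hua : AnalyticAt ℂ (fun x => U k (ξ x)) x0 := by
    have := (hF k).an (ξ x0) ((hF k).sub hX)
    exact this.fun_comp hξ
  have hu : Tendsto (fun x => U k (ξ x)) (𝓝 x0) (𝓝 s0) := hua.continuousAt.tendsto
  have hξβ : ∀ᶠ x in 𝓝 x0, β (k, ξ x0) (U k (ξ x)) = ξ x :=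
    hξc.eventually ((hβ _ hk0).2.2.2)
  refine ⟨S.filter fun π => v π = v (k, ξ x0), fun π x => β π (U k (ξ x)), ?_, ?_, ?_⟩
  · simp [hk0]
  · filter_upwards [hu.eventually key, hu.eventually e2, hξβ] with x hk h2 hb
    rw [hk.1, Multiset.filter_map, Finset.filter_val]
    congr 1
    refine Multiset.filter_congr fun π hπ => ?_
    have e : v (k, ξ x) = v (k, β (k, ξ x0) (U k (ξ x))) := by rw [hb]
    change v (π.1, β π (U k (ξ x))) = v (k, ξ x) ↔ _
    rw [e]
    constructor
    · intro h
      by_contra hne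
      exact h2 π hπ _ hk0 hne h
    · intro h
      have := hk.2 π hπ _ hk0 h
      simp only [hv]
      exact Finset.sum_congr rfl fun i _ => by rw [congrFun this i]
  · intro π hπ
    rw [Finset.mem_filter] at hπ
    refine ⟨?_, ?_, ?_, ?_⟩
    · filter_upwards [hu.eventually e1] with x h using (h π hπ.1).1
    · have : AnalyticAt ℂ (fun x => β π (U k (ξ x))) x0 :=
        AnalyticAt.fun_comp (f := fun x => U k (ξ x)) (hβ π hπ.1).2.1 hua
      filter_upwards [this.eventually_analyticAt] with x h using h.differentiableAt
    · filter_upwards [hu.eventually e1] with x h using (h π hπ.1).2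
    · filter_upwards [hu.eventually key, hξβ] with x hk hb i
      have := congrFun (hk.2 π hπ.1 _ hk0 hπ.2) i
      simp only at this
      rw [this, hb]
end cfs

lemma const_of_deriv_zero {g : ℂ → ℂ} {x0 : ℂ} (h : ∀ᶠ x in 𝓝 x0, HasDerivAt g 0 x) :
    ∀ᶠ x in 𝓝 x0, g x = g x0 := by
  obtain ⟨r, hr, hb⟩ := Metric.eventually_nhds_iff_ball.1 h
  filter_upwards [Metric.ball_mem_nhds x0 hr] with x hx
  refine (convex_ball x0 r).is_const_of_fderivWithin_eq_zero (𝕜 := ℂ)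
    (fun y hy => (hb y hy).differentiableAt.differentiableWithinAt) ?_ hx (Metric.mem_ball_self hr)
  intro y hy
  rw [fderivWithin_of_isOpen Metric.isOpen_ball hy]
  have := (hb y hy).hasFDerivAt.fderiv
  rw [this]; ext; simp

lemma swap_sum (a c : ℕ) (P : ℕ → ℂ) (J : ℕ → ℕ → ℂ) (w : ℕ → ℂ) :
    ∑ c' ∈ Finset.Ico a c, (∑ d ∈ Finset.Ico a (c'+1), P d * J d c') * w c' =
      ∑ d ∈ Finset.Ico a c, P d * ∑ c' ∈ Finset.Ico d c, J d c' * w c' := by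
  simp only [Finset.sum_mul, Finset.mul_sum]
  rw [Finset.sum_comm' (t' := Finset.Ico a c) (s' := fun d => Finset.Ico d c)]
  · exact Finset.sum_congr rfl fun _ _ => Finset.sum_congr rfl fun _ _ => by ring
  · intro x y; simp only [Finset.mem_Ico]; omega

lemma ode_const (a b : ℕ) (r : ℕ → ℂ → ℂ) (J : ℕ → ℕ → ℂ → ℂ) (ω : ℕ → ℕ → ℂ → ℂ) (x0 : ℂ)
    (hr : ∀ c ∈ Finset.Ico a b, ∀ᶠ x in 𝓝 x0,
      HasDerivAt (r c) (∑ c' ∈ Finset.Ico a c, r c' x * ω c' c x) x)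
    (hJ : ∀ d c, d < c → ∀ᶠ x in 𝓝 x0,
      HasDerivAt (J d c) (∑ c' ∈ Finset.Ico d c, J d c' x * ω c' c x) x)
    (hJ1 : ∀ d x, J d d x = 1) :
    ∃ P : ℕ → ℂ, ∀ c ∈ Finset.Ico a b, ∀ᶠ x in 𝓝 x0,
      r c x = ∑ d ∈ Finset.Ico a (c+1), P d * J d c x := by
  suffices H : ∀ m, ∃ P : ℕ → ℂ, ∀ c ∈ Finset.Ico a b, c < m → ∀ᶠ x in 𝓝 x0,
      r c x = ∑ d ∈ Finset.Ico a (c+1), P d * J d c x by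
    obtain ⟨P, hP⟩ := H b
    exact ⟨P, fun c hc => hP c hc (Finset.mem_Ico.1 hc).2⟩
  intro m
  induction m with
  | zero => exact ⟨0, fun c _ h => absurd h (Nat.not_lt_zero _)⟩
  | succ m ih =>
    obtain ⟨P, hP⟩ := ih
    by_cases hm : m ∈ Finset.Ico a b
    · have hg : ∀ᶠ x in 𝓝 x0, HasDerivAt (fun x => r m x - ∑ d ∈ Finset.Ico a m, P d * J d m x) 0 x := by
        have h1 : ∀ᶠ x in 𝓝 x0, ∀ c ∈ Finset.Ico a m, r c x = ∑ d ∈ Finset.Ico a (c+1), P d * J d c x := by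
          rw [Finset.eventually_all]
          intro c hc
          simp only [Finset.mem_Ico] at hc hm
          exact hP c (by simp only [Finset.mem_Ico]; omega) hc.2
        have h2 : ∀ᶠ x in 𝓝 x0, ∀ d ∈ Finset.Ico a m,
            HasDerivAt (J d m) (∑ c' ∈ Finset.Ico d m, J d c' x * ω c' m x) x := by
          rw [Finset.eventually_all]
          intro d hd
          exact hJ d m (Finset.mem_Ico.1 hd).2
        filter_upwards [h1, h2, hr m hm] with x h1 h2 h3
        have h4 : HasDerivAt (fun x => ∑ d ∈ Finset.Ico a m, P d * J d m x)
            (∑ d ∈ Finset.Ico a m, P d * ∑ c' ∈ Finset.Ico d m, J d c' x * ω c' m x) x :=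
          HasDerivAt.fun_sum fun d hd => (h2 d hd).const_mul _
        refine (h3.sub h4).congr_deriv ?_
        rw [← swap_sum a m P (fun d c => J d c x) (fun c => ω c m x), sub_eq_zero]
        exact Finset.sum_congr rfl fun c hc => by rw [h1 c hc]
      have hg2 := const_of_deriv_zero hg
      set κ := r m x0 - ∑ d ∈ Finset.Ico a m, P d * J d m x0
      refine ⟨Function.update P m κ, fun c hc hcm => ?_⟩
      rcases Nat.lt_succ_iff_lt_or_eq.1 hcm with h | rfl
      · filter_upwards [hP c hc h] with x hx
        rw [hx]
        refine Finset.sum_congr rfl fun d hd => ?_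
        simp only [Finset.mem_Ico] at hd
        rw [Function.update_of_ne (by omega)]
      · filter_upwards [hg2] with x hx
        simp only [Finset.mem_Ico] at hc
        rw [Finset.sum_Ico_succ_top hc.1, Function.update_self, hJ1, mul_one]
        have : ∑ d ∈ Finset.Ico a c, Function.update P c κ d * J d c x =
            ∑ d ∈ Finset.Ico a c, P d * J d c x := by
          refine Finset.sum_congr rfl fun d hd => ?_
          simp only [Finset.mem_Ico] at hd
          rw [Function.update_of_ne (by omega)]
        rw [this, ← hx]; ring
    · refine ⟨P, fun c hc hcm => hP c hc ?_⟩
      rcases Nat.lt_succ_iff_lt_or_eq.1 hcm with h | rfl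
      · exact h
      · exact absurd hc hm

lemma exists_eta {K : Set ℂ} (hK : IsCompact K) {q : ℂ → ℂ} (hq : AnalyticOnNhd ℂ q K)
    (hq0 : ∀ z ∈ K, ¬ ∀ᶠ y in 𝓝 z, q y = 0) (Φ : ℂ → ℂ) (Z : Finset ℂ) :
    ∃ (η : Polynomial ℂ) (ψ : ℂ → ℂ), AnalyticOnNhd ℂ ψ K ∧ (∀ z ∈ Z, η.eval z = Φ z) ∧
      ∀ z ∈ K, η.derivative.eval z = ψ z * q z := by
  classical
  obtain ⟨P, hP, hPr, e, he, he0, hqe⟩ := fz hK hq hq0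
  set W := Z ∪ P.roots.toFinset with hW
  set M := P.natDegree with hM
  obtain ⟨η, hη⟩ := Ideal.exists_forall_sub_mem_ideal (R := Polynomial ℂ) (ι := W)
    (I := fun w => Ideal.span {(Polynomial.X - Polynomial.C (w:ℂ)) ^ (M+1)}) (by
      intro w w' hww
      rw [Function.onFun, Ideal.isCoprime_span_singleton_iff]
      exact (Polynomial.isCoprime_X_sub_C_of_isUnit_sub
        (sub_ne_zero.2 (fun h => hww (Subtype.ext h))).isUnit).pow)
    (fun w => Polynomial.C (Φ w))
  have hη' : ∀ w ∈ W, (Polynomial.X - Polynomial.C w) ^ (M+1) ∣ η - Polynomial.C (Φ w) :=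
    fun w hw => Ideal.mem_span_singleton.1 (hη ⟨w, hw⟩)
  have hdvd : P ∣ η.derivative := by
    by_cases h0 : η.derivative = 0
    · rw [h0]; exact dvd_zero _
    refine Polynomial.Splits.dvd_of_roots_le_roots (IsAlgClosed.splits P) hP.ne_zero ?_
    rw [Multiset.le_iff_count]
    intro w
    by_cases hw : w ∈ P.roots
    · rw [Polynomial.count_roots η.derivative]
      have h1 : P.roots.count w ≤ M := (Multiset.count_le_card _ _).trans (Polynomial.card_roots' P)
      refine h1.trans ((Polynomial.le_rootMultiplicity_iff h0).2 ?_)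
      obtain ⟨r, hr⟩ := hη' w (by simp only [hW, Finset.mem_union, Multiset.mem_toFinset]; exact Or.inr hw)
      have h2 : η.derivative = Polynomial.derivative (η - Polynomial.C (Φ w)) := by simp
      rw [h2, hr]
      refine Dvd.intro (Polynomial.C ((M:ℂ)+1) * r + (Polynomial.X - Polynomial.C w) * r.derivative) ?_
      simp [Polynomial.derivative_pow]; ring
    · rw [Multiset.count_eq_zero_of_notMem hw]; exact Nat.zero_le _
  obtain ⟨R, hR⟩ := hdvd
  refine ⟨η, fun z => R.eval z / e z, ?_, ?_, ?_⟩
  · intro z hz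
    exact (AnalyticOnNhd.eval_polynomial R z (mem_univ z)).div (he z hz) (he0 z hz)
  · intro z hz
    obtain ⟨r, hr⟩ := hη' z (by simp only [hW, Finset.mem_union]; exact Or.inl hz)
    have := congrArg (Polynomial.eval z) hr
    simp at this
    exact sub_eq_zero.1 this
  · intro z hz
    rw [hR, hqe, Polynomial.eval_mul]
    field_simp [he0 z hz]

structure CD (ι : Type) [Fintype ι] [DecidableEq ι] (n : ℕ) where
  X : ι → Set ℂ
  K : ι → Set ℂ
  U : ι → ℂ → ℂ
  fib : ι → ℂ → Multiset ℂ
  ρ : ℝ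
  ρ1 : ℝ
  T : ℝ
  F : ι → Fin n → ℂ → ℂ
  ξ : ι → ℂ → ℂ
  lam : Fin n → ℂ
  hρ : 0 < ρ
  hT : 0 < T
  hF : ∀ k, FibS (X k) (K k) (U k) ρ (fib k)
  hFa : ∀ k i, AnalyticOnNhd ℂ (F k i) (K k)
  hU : ∀ k z, U k z = ∑ i, lam i * F k i z
  hξ : ∀ k x, AnalyticAt ℂ (ξ k) x
  hξX : ∀ k x, x ∈ Metric.ball (0:ℂ) (2*T) → ξ k x ∈ X k
  hρ1 : ρ1 < ρ
  hub : ∀ k x, x ∈ Metric.ball (0:ℂ) (2*T) → ‖U k (ξ k x)‖ ≤ ρ1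
  hnc : ∀ k s, ¬ ∀ᶠ x in 𝓝 (0:ℂ), U k (ξ k x) = s
  hdU : ∀ k, ∀ z ∈ K k, ¬ ∀ᶠ y in 𝓝 z, deriv (U k) y = 0

section avgs
variable {ι : Type} [Fintype ι] [DecidableEq ι] {n : ℕ}

def ext0 (k0 : ι) (G : ℂ → ℂ) (π : ι × ℂ) : ℂ := if π.1 = k0 then G π.2 else 0

def avg (C : Finset (ι × ℂ)) (B : ι × ℂ → ℂ → ℂ) (k0 : ι) (G : ℂ → ℂ) (x : ℂ) : ℂ :=
  (∑ π ∈ C, ext0 k0 G (π.1, B π x)) / C.card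

lemma avg_sum (C : Finset (ι × ℂ)) (B : ι × ℂ → ℂ → ℂ) (k0 : ι) (S : Finset ℕ) (H : ℕ → ℂ → ℂ)
    (m : ℕ → ℂ) (x : ℂ) :
    avg C B k0 (fun z => ∑ c ∈ S, H c z * m c) x = ∑ c ∈ S, avg C B k0 (H c) x * m c := by
  simp only [avg]
  rw [show ∑ c ∈ S, (∑ π ∈ C, ext0 k0 (H c) (π.1, B π x)) / (C.card:ℂ) * m c =
    (∑ c ∈ S, ∑ π ∈ C, ext0 k0 (H c) (π.1, B π x) * m c) / (C.card : ℂ) by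
      rw [Finset.sum_div]
      exact Finset.sum_congr rfl fun c _ => by rw [← Finset.sum_mul]; ring, Finset.sum_comm]
  congr 1
  refine Finset.sum_congr rfl fun π _ => ?_
  by_cases h : π.1 = k0 <;> simp [ext0, h]

lemma CD.sub (D : CD ι n) (k : ι) {x : ℂ} (hx : x ∈ Metric.ball (0:ℂ) (2*D.T)) : D.ξ k x ∈ D.K k :=
  (D.hF k).sub (D.hξX k x hx)

lemma CD.inb (D : CD ι n) (k : ι) {x : ℂ} (hx : x ∈ Metric.ball (0:ℂ) (2*D.T)) :
    D.U k (D.ξ k x) ∈ Metric.ball (0:ℂ) D.ρ := by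
  rw [mem_ball_zero_iff]; exact (D.hub k x hx).trans_lt D.hρ1

lemma CD.uan (D : CD ι n) (k : ι) {x : ℂ} (hx : x ∈ Metric.ball (0:ℂ) (2*D.T)) :
    AnalyticAt ℂ (fun x => D.U k (D.ξ k x)) x :=
  ((D.hF k).an _ (D.sub k hx)).fun_comp (D.hξ k x)

lemma CD.fan (D : CD ι n) (k : ι) (i : Fin n) {x : ℂ} (hx : x ∈ Metric.ball (0:ℂ) (2*D.T)) :
    AnalyticAt ℂ (fun x => D.F k i (D.ξ k x)) x :=
  (D.hFa k i _ (D.sub k hx)).fun_comp (D.hξ k x)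

lemma avg_deriv (D : CD ι n) (k k0 : ι) (x0 : ℂ)
    (C : Finset (ι × ℂ)) (B : ι × ℂ → ℂ → ℂ)
    (hB : ∀ π ∈ C, (∀ᶠ x in 𝓝 x0, B π x ∈ D.X π.1) ∧ (∀ᶠ x in 𝓝 x0, DifferentiableAt ℂ (B π) x) ∧
        (∀ᶠ x in 𝓝 x0, D.U π.1 (B π x) = D.U k (D.ξ k x)) ∧
        ∀ᶠ x in 𝓝 x0, ∀ i, D.F π.1 i (B π x) = D.F k i (D.ξ k x))
    (G : ℂ → ℂ) (p : Fin n → ℂ → ℂ) (q : ℂ → ℂ)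
    (hG : ∀ z ∈ D.X k0, HasDerivAt G (∑ i, p i z * deriv (D.F k0 i) z + q z * deriv (D.U k0) z) z) :
    ∀ᶠ x in 𝓝 x0, HasDerivAt (avg C B k0 G)
      (∑ i, avg C B k0 (p i) x * deriv (fun x => D.F k i (D.ξ k x)) x +
        avg C B k0 q x * deriv (fun x => D.U k (D.ξ k x)) x) x := by
  have h : ∀ᶠ x in 𝓝 x0, ∀ π ∈ C, B π x ∈ D.X π.1 ∧ DifferentiableAt ℂ (B π) x ∧
      (∀ᶠ x in 𝓝 x, D.U π.1 (B π x) = D.U k (D.ξ k x)) ∧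
      ∀ i, ∀ᶠ x in 𝓝 x, D.F π.1 i (B π x) = D.F k i (D.ξ k x) := by
    rw [Finset.eventually_all]
    intro π hπ
    obtain ⟨h1, h2, h3, h4⟩ := hB π hπ
    filter_upwards [h1, h2, h3.eventually_nhds, h4.eventually_nhds] with x g1 g2 g3 g4
    exact ⟨g1, g2, g3, fun i => g4.mono fun y hy => hy i⟩
  filter_upwards [h] with x hx
  have hsum : HasDerivAt (fun x => ∑ π ∈ C, ext0 k0 G (π.1, B π x))
      (∑ π ∈ C, ((∑ i, ext0 k0 (p i) (π.1, B π x) * deriv (fun x => D.F k i (D.ξ k x)) x) +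
        ext0 k0 q (π.1, B π x) * deriv (fun x => D.U k (D.ξ k x)) x)) x := by
    refine HasDerivAt.fun_sum fun π hπ => ?_
    obtain ⟨h1, h2, h3, h4⟩ := hx π hπ
    by_cases hk : π.1 = k0
    · simp only [ext0, hk, if_true]
      rw [hk] at h1 h3 h4
      have hd1 : deriv (fun x => D.U k (D.ξ k x)) x = deriv (D.U k0) (B π x) * deriv (B π) x := by
        rw [← Filter.EventuallyEq.deriv_eq h3]
        exact (((D.hF k0).an _ ((D.hF k0).sub h1)).differentiableAt.hasDerivAt.comp x h2.hasDerivAt).deriv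
      have hd2 : ∀ i, deriv (fun x => D.F k i (D.ξ k x)) x = deriv (D.F k0 i) (B π x) * deriv (B π) x := by
        intro i
        rw [← Filter.EventuallyEq.deriv_eq (h4 i)]
        exact ((D.hFa k0 i _ ((D.hF k0).sub h1)).differentiableAt.hasDerivAt.comp x h2.hasDerivAt).deriv
      refine ((hG _ h1).comp x h2.hasDerivAt).congr_deriv ?_
      simp only [hd1, hd2, add_mul, Finset.sum_mul, mul_assoc]
    · simp only [ext0, hk, if_false, zero_mul, Finset.sum_const_zero, add_zero]
      exact hasDerivAt_const _ _
  refine (hsum.div_const (C.card : ℂ)).congr_deriv ?_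
  simp only [avg]
  rw [Finset.sum_add_distrib, add_div, Finset.sum_comm, Finset.sum_div]
  congr 1
  · refine Finset.sum_congr rfl fun i _ => ?_
    rw [← Finset.sum_mul]; ring
  · rw [← Finset.sum_mul]; ring

def CD.v (D : CD ι n) (μ : Fin n → ℂ) (π : ι × ℂ) : ℂ := ∑ i, μ i * D.F π.1 i π.2
def CD.δ (D : CD ι n) (μ : Fin n → ℂ) (e : ℕ) (s : ℂ) : ℂ := (hMat (cf D.fib s) (D.v μ) e).det
def CD.Θ (D : CD ι n) (μ : Fin n → ℂ) (e : ℕ) (k0 : ι) (G : ℂ → ℂ) (k : ι) (x : ℂ) : ℂ :=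
  ∑ j : Fin e, bVec (cf D.fib (D.U k (D.ξ k x))) (D.v μ) (ext0 k0 G) e j * D.v μ (k, D.ξ k x) ^ (j:ℕ)

def CD.he (D : CD ι n) (e : ℕ) : Prop := ∀ s ∈ Metric.ball (0:ℂ) D.ρ,
        ((cf D.fib s).map fun π i => D.F π.1 i π.2).toFinset.card ≤ e

lemma CD.cardv (D : CD ι n) {e : ℕ} (he : D.he e) (μ : Fin n → ℂ) {s : ℂ}
    (hs : s ∈ Metric.ball (0:ℂ) D.ρ) : ((cf D.fib s).map (D.v μ)).toFinset.card ≤ e := by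
  have : ((cf D.fib s).map (D.v μ)).toFinset =
      ((cf D.fib s).map fun π i => D.F π.1 i π.2).toFinset.image fun y => ∑ i, μ i * y i := by
    ext ν; simp [CD.v]
  rw [this]
  exact Finset.card_image_le.trans (he s hs)

lemma CD.class (D : CD ι n) {e : ℕ} (he : D.he e) (μ : Fin n → ℂ) (k0 : ι) (G : ℂ → ℂ) (k : ι) {x : ℂ}
    (hx : x ∈ Metric.ball (0:ℂ) (2*D.T)) :
    (((cf D.fib (D.U k (D.ξ k x))).filter fun π => D.v μ π = D.v μ (k, D.ξ k x)).card : ℂ) *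
      D.Θ μ e k0 G k x = D.δ μ e (D.U k (D.ξ k x)) *
      (((cf D.fib (D.U k (D.ξ k x))).filter fun π => D.v μ π = D.v μ (k, D.ξ k x)).map (ext0 k0 G)).sum :=
  bVec_class _ _ _ _ (D.cardv he μ (D.inb k hx)) _

lemma CD.local_main (D : CD ι n) {e : ℕ} (he : D.he e) (μ : Fin n → ℂ) (k k0 : ι) {x0 : ℂ}
    (hx0 : x0 ∈ Metric.ball (0:ℂ) (2*D.T)) (hdet : D.δ μ e (D.U k (D.ξ k x0)) ≠ 0)
    (hder : ∀ π ∈ cf D.fib (D.U k (D.ξ k x0)), deriv (D.U π.1) π.2 ≠ 0)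
    {a b : ℕ} (hab : a < b) (Xm : Fin n → ℕ → ℕ → ℂ) (J : ℕ → ℕ → ℂ → ℂ)
    (hJ : ∀ d c, d < c → ∀ x ∈ Metric.ball (0:ℂ) (2*D.T), HasDerivAt (J d c)
      (∑ c' ∈ Finset.Ico d c, J d c' x * ∑ i, deriv (fun x => D.F k i (D.ξ k x)) x * Xm i c' c) x)
    (hJ1 : ∀ d x, J d d x = 1)
    (H : ℕ → ℂ → ℂ) (hHa : ∀ z, H a z = 1)
    (hH : ∀ c ∈ Finset.Ico a b, ∀ z ∈ D.X k0, HasDerivAt (H c)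
      (∑ c' ∈ Finset.Ico a c, H c' z * ∑ i, deriv (D.F k0 i) z * Xm i c' c) z)
    (G ψ π : ℂ → ℂ)
    (hG : ∀ z ∈ D.X k0, HasDerivAt G
      (∑ c ∈ Finset.Ico a b, H c z * ∑ i, deriv (D.F k0 i) z * Xm i c b
        - ψ z * π (D.U k0 z) * deriv (D.U k0) z) z) :
    ∃ (P : ℕ → ℂ) (Am Ap : ℂ → ℂ), (k = k0 → P a ≠ 0) ∧ ∀ᶠ x in 𝓝 x0,
      D.Θ μ e k0 G k x = D.δ μ e (D.U k (D.ξ k x)) * Am x ∧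
      D.Θ μ e k0 ψ k x = D.δ μ e (D.U k (D.ξ k x)) * Ap x ∧
      HasDerivAt (fun x => ∑ d ∈ Finset.Ico a b, P d * J d b x - Am x)
        (Ap x * π (D.U k (D.ξ k x)) * deriv (fun x => D.U k (D.ξ k x)) x) x := by
  obtain ⟨C, B, hkC, hcl, hB⟩ := loc_struct D.hF D.F D.hFa μ e he k (D.ξ k) x0 (D.hξ k x0)
    (D.hξX k x0 hx0) (D.inb k hx0) hdet hder
  have hCpos : (C.card : ℂ) ≠ 0 := by
    exact_mod_cast (Finset.card_pos.2 ⟨_, hkC⟩).ne'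
  have hball : ∀ᶠ x in 𝓝 x0, x ∈ Metric.ball (0:ℂ) (2*D.T) := Metric.isOpen_ball.mem_nhds hx0
  have hTh : ∀ G : ℂ → ℂ, ∀ᶠ x in 𝓝 x0,
      D.Θ μ e k0 G k x = D.δ μ e (D.U k (D.ξ k x)) * avg C B k0 G x := by
    intro G
    filter_upwards [hcl, hball] with x hx hxb
    have h1 := D.class he μ k0 G k hxb
    have h2 : ((cf D.fib (D.U k (D.ξ k x))).filter fun π => D.v μ π = D.v μ (k, D.ξ k x)) =
      C.val.map fun π => (π.1, B π x) := hx
    rw [h2, Multiset.card_map, Multiset.map_map] at h1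
    have h3 : (Multiset.map (ext0 k0 G ∘ fun π => (π.1, B π x)) C.val).sum =
      ∑ π ∈ C, ext0 k0 G (π.1, B π x) := rfl
    rw [h3] at h1
    rw [avg, ← mul_div_assoc, eq_div_iff hCpos, mul_comm]
    exact h1
  set ω : ℕ → ℕ → ℂ → ℂ := fun c' c x => ∑ i, deriv (fun x => D.F k i (D.ξ k x)) x * Xm i c' c with hω
  have hrd : ∀ c ∈ Finset.Ico a b, ∀ᶠ x in 𝓝 x0, HasDerivAt (avg C B k0 (H c))
      (∑ c' ∈ Finset.Ico a c, avg C B k0 (H c') x * ω c' c x) x := by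
    intro c hc
    have := avg_deriv D k k0 x0 C B hB (H c) (fun i z => ∑ c' ∈ Finset.Ico a c, H c' z * Xm i c' c)
      (fun _ => 0) (by
        intro z hz
        refine (hH c hc z hz).congr_deriv ?_
        simp only [Finset.mul_sum, Finset.sum_mul, zero_mul, add_zero]
        rw [Finset.sum_comm]
        exact Finset.sum_congr rfl fun _ _ => Finset.sum_congr rfl fun _ _ => by ring)
    filter_upwards [this] with x hx
    refine hx.congr_deriv ?_
    simp only [avg_sum, hω, Finset.mul_sum, Finset.sum_mul]
    rw [Finset.sum_comm]
    have : avg C B k0 (fun _ => 0) x = 0 := by simp [avg, ext0]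
    rw [this, zero_mul, add_zero]
    exact Finset.sum_congr rfl fun _ _ => Finset.sum_congr rfl fun _ _ => by ring
  obtain ⟨P, hP⟩ := ode_const a b (fun c => avg C B k0 (H c)) J ω x0 hrd
    (fun d c hdc => hball.mono fun x hx => hJ d c hdc x hx) hJ1
  refine ⟨P, avg C B k0 G, avg C B k0 ψ, ?_, ?_⟩
  · rintro rfl
    have h1 := (hP a (by simp [hab])).self_of_nhds
    simp only [Nat.Ico_succ_singleton, Finset.sum_singleton, hJ1, mul_one] at h1
    rw [← h1, avg]
    refine div_ne_zero ?_ hCpos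
    have h2 : ∑ π ∈ C, ext0 k (H a) (π.1, B π x0) = ((C.filter fun π => π.1 = k).card : ℂ) := by
      simp [ext0, hHa]
    rw [h2]
    exact_mod_cast (Finset.card_pos.2 ⟨(k, D.ξ k x0), by simp [hkC]⟩).ne'
  · have hK := avg_deriv D k k0 x0 C B hB G (fun i z => ∑ c' ∈ Finset.Ico a b, H c' z * Xm i c' b)
      (fun z => - (ψ z * π (D.U k0 z))) (by
        intro z hz
        refine (hG z hz).congr_deriv ?_
        simp only [Finset.mul_sum, Finset.sum_mul, neg_mul, ← sub_eq_add_neg]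
        rw [Finset.sum_comm]
        congr 1
        exact Finset.sum_congr rfl fun _ _ => Finset.sum_congr rfl fun _ _ => by ring)
    have hU2 : ∀ᶠ x in 𝓝 x0, ∀ π ∈ C, D.U π.1 (B π x) = D.U k (D.ξ k x) := by
      rw [Finset.eventually_all]; exact fun π hπ => (hB π hπ).2.2.1
    have hP' : ∀ᶠ x in 𝓝 x0, ∀ c ∈ Finset.Ico a b,
        avg C B k0 (H c) x = ∑ d ∈ Finset.Ico a (c+1), P d * J d c x := by
      rw [Finset.eventually_all]; exact hP
    filter_upwards [hTh G, hTh ψ, hK, hball, hU2, hP'] with x h1 h2 h3 h4 h5 h6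
    refine ⟨h1, h2, ?_⟩
    have h7 : HasDerivAt (fun x => ∑ d ∈ Finset.Ico a b, P d * J d b x)
        (∑ d ∈ Finset.Ico a b, P d * ∑ c' ∈ Finset.Ico d b, J d c' x * ω c' b x) x :=
      HasDerivAt.fun_sum fun d hd => (hJ d b (Finset.mem_Ico.1 hd).2 x h4).const_mul _
    refine (h7.sub h3).congr_deriv ?_
    rw [← swap_sum a b P (fun d c => J d c x) (fun c => ω c b x)]
    have h8 : avg C B k0 (fun z => - (ψ z * π (D.U k0 z))) x =
        - (avg C B k0 ψ x * π (D.U k (D.ξ k x))) := by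
      simp only [avg]
      rw [div_mul_eq_mul_div, ← neg_div, Finset.sum_mul, ← Finset.sum_neg_distrib]
      congr 1
      refine Finset.sum_congr rfl fun π' hπ' => ?_
      by_cases hk : π'.1 = k0
      · simp only [ext0, hk, if_true]
        have := h5 π' hπ'
        rw [hk] at this
        rw [this]
      · simp [ext0, hk]
    have h9 : ∑ c' ∈ Finset.Ico a b, (∑ d ∈ Finset.Ico a (c'+1), P d * J d c' x) * ω c' b x =
        ∑ i, avg C B k0 (fun z => ∑ c' ∈ Finset.Ico a b, H c' z * Xm i c' b) x *
          deriv (fun x => D.F k i (D.ξ k x)) x := by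
      simp only [avg_sum, hω]
      rw [show ∑ i, (∑ c ∈ Finset.Ico a b, avg C B k0 (H c) x * Xm i c b) *
          deriv (fun x => D.F k i (D.ξ k x)) x = ∑ c ∈ Finset.Ico a b, avg C B k0 (H c) x *
          ∑ i, deriv (fun x => D.F k i (D.ξ k x)) x * Xm i c b by
        simp only [Finset.mul_sum, Finset.sum_mul]
        rw [Finset.sum_comm]
        exact Finset.sum_congr rfl fun _ _ => Finset.sum_congr rfl fun _ _ => by ring]
      exact Finset.sum_congr rfl fun c hc => by rw [h6 c hc]
    rw [h8, h9]; ring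
end avgs

section glob
variable {ι : Type} [Fintype ι] [DecidableEq ι] {n : ℕ}

lemma CD.van (D : CD ι n) (μ : Fin n → ℂ) (k : ι) : AnalyticOnNhd ℂ (fun z => D.v μ (k, z)) (D.K k) := by
  intro z hz
  simp only [CD.v]
  exact Finset.analyticAt_fun_sum _ fun i _ => analyticAt_const.mul (D.hFa k i z hz)

lemma CD.udiff (D : CD ι n) (k : ι) :
    DifferentiableOn ℂ (fun x => D.U k (D.ξ k x)) (Metric.ball 0 (2*D.T)) :=
  fun _ hx => (D.uan k hx).differentiableAt.differentiableWithinAt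

lemma ext0_an (D : CD ι n) (k0 : ι) {G : ℂ → ℂ} (hG : AnalyticOnNhd ℂ G (D.K k0)) (k : ι) :
    AnalyticOnNhd ℂ (fun z => ext0 k0 G (k, z)) (D.K k) := by
  by_cases h : k = k0
  · subst h; simpa [ext0] using hG
  · simp only [ext0, h, if_false]; exact fun _ _ => analyticAt_const

lemma CD.ddiff (D : CD ι n) (μ : Fin n → ℂ) (e : ℕ) :
    DifferentiableOn ℂ (D.δ μ e) (Metric.ball 0 D.ρ) :=
  diff_det _ fun i j => diff_hMat D.hF _ (D.van μ) e i j

lemma CD.bdiff (D : CD ι n) (μ : Fin n → ℂ) (e : ℕ) (k0 : ι) {G : ℂ → ℂ}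
    (hG : AnalyticOnNhd ℂ G (D.K k0)) (j : Fin e) :
    DifferentiableOn ℂ (fun s => bVec (cf D.fib s) (D.v μ) (ext0 k0 G) e j) (Metric.ball 0 D.ρ) :=
  diff_bVec D.hF _ _ (D.van μ) (ext0_an D k0 hG) e j

lemma CD.Tdiff (D : CD ι n) (μ : Fin n → ℂ) (e : ℕ) (k0 : ι) {G : ℂ → ℂ}
    (hG : AnalyticOnNhd ℂ G (D.K k0)) (k : ι) :
    DifferentiableOn ℂ (D.Θ μ e k0 G k) (Metric.ball 0 (2*D.T)) := by
  unfold CD.Θ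
  refine DifferentiableOn.fun_sum fun j _ => DifferentiableOn.mul ?_ (DifferentiableOn.pow ?_ _)
  · exact (D.bdiff μ e k0 hG j).comp (D.udiff k) fun x hx => D.inb k hx
  · intro x hx
    exact ((D.van μ k _ (D.sub k hx)).fun_comp (D.hξ k x)).differentiableAt.differentiableWithinAt

lemma CD.crit (D : CD ι n) : ∃ Cv : Finset ℂ, ∀ s, s ∉ Cv → ∀ π : ι × ℂ, π.2 ∈ D.X π.1 →
    D.U π.1 π.2 = s → deriv (D.U π.1) π.2 ≠ 0 := by
  classical
  have : ∀ k, ∃ P : Polynomial ℂ, ∀ z ∈ D.K k, deriv (D.U k) z = 0 → P ≠ 0 ∧ P.eval z = 0 := by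
    intro k
    obtain ⟨P, hP, -, e, -, he0, h⟩ := fz (D.hF k).cpt (fun z hz => ((D.hF k).an z hz).deriv) (D.hdU k)
    refine ⟨P, fun z hz h0 => ⟨hP.ne_zero, ?_⟩⟩
    rw [h z] at h0
    exact (mul_eq_zero.1 h0).resolve_right (he0 z hz)
  choose P hP using this
  refine ⟨Finset.univ.biUnion fun k => (P k).roots.toFinset.image (D.U k), ?_⟩
  rintro s hs ⟨k, z⟩ hz hU h0
  refine hs ?_
  simp only [Finset.mem_biUnion, Finset.mem_image, Multiset.mem_toFinset]
  obtain ⟨h1, h2⟩ := hP k z ((D.hF k).sub hz) h0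
  exact ⟨k, Finset.mem_univ _, z, (Polynomial.mem_roots h1).2 h2, hU⟩

lemma CD.avoid (D : CD ι n) (k : ι) (S : Finset ℂ) :
    ∀ᶠ x in 𝓝[≠] (0:ℂ), D.U k (D.ξ k x) ∉ S := by
  have : ∀ᶠ x in 𝓝[≠] (0:ℂ), ∀ s ∈ S, D.U k (D.ξ k x) ≠ s := by
    rw [Finset.eventually_all]
    intro s _
    have h0 : (0:ℂ) ∈ Metric.ball (0:ℂ) (2*D.T) := Metric.mem_ball_self (by linarith [D.hT])
    exact ((D.uan k h0).eventually_eq_or_eventually_ne analyticAt_const).resolve_left (D.hnc k s)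
  exact this.mono fun x hx h => hx _ h rfl

lemma CD.endpt (D : CD ι n) {e : ℕ} (he : D.he e) (μ : Fin n → ℂ) (k k0 : ι) {p : ℂ}
    (hp : p ∈ Metric.ball (0:ℂ) (2*D.T))
    (hδ : ∀ᶠ x in 𝓝[≠] p, D.δ μ e (D.U k (D.ξ k x)) ≠ 0)
    {G : ℂ → ℂ} (hG : AnalyticOnNhd ℂ G (D.K k0))
    (hGZ : ∀ z ∈ D.X k0, D.U k0 z = D.U k (D.ξ k p) → G z = 0)
    {A : ℂ → ℂ} (hA : ContinuousAt A p)
    (hAT : ∀ x ∈ Metric.ball (0:ℂ) (2*D.T), D.δ μ e (D.U k (D.ξ k x)) * A x = D.Θ μ e k0 G k x) :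
    A p = 0 := by
  suffices h : ∀ ε > 0, ‖A p‖ ≤ ε by
    exact norm_le_zero_iff.1 (le_of_forall_pos_le_add fun ε hε => by simpa using h ε hε)
  intro ε hε
  have hc : IsCompact {z ∈ D.K k0 | ε ≤ ‖G z‖} := by
    have : {z ∈ D.K k0 | ε ≤ ‖G z‖} = D.K k0 ∩ (fun z => ‖G z‖) ⁻¹' (Ici ε) := rfl
    rw [this]
    exact (D.hF k0).cpt.of_isClosed_subset
      (hG.continuousOn.norm.preimage_isClosed_of_isClosed (D.hF k0).cpt.isClosed isClosed_Ici)
      inter_subset_left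
  have hc2 : IsClosed (D.U k0 '' {z ∈ D.K k0 | ε ≤ ‖G z‖}) :=
    (hc.image_of_continuousOn ((D.hF k0).an.continuousOn.mono fun z hz => hz.1)).isClosed
  have hn : D.U k (D.ξ k p) ∈ (D.U k0 '' {z ∈ D.K k0 | ε ≤ ‖G z‖})ᶜ := by
    rintro ⟨z, ⟨hz, hz2⟩, hzU⟩
    have hX : z ∈ D.X k0 := by
      by_contra hX
      have h1 := (D.hF k0).bd z ⟨hz, hX⟩
      have h2 := D.inb k hp
      rw [mem_ball_zero_iff, ← hzU] at h2
      linarith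
    rw [hGZ z hX hzU] at hz2
    simp at hz2; linarith
  have hev : ∀ᶠ x in 𝓝 p, D.U k (D.ξ k x) ∈ (D.U k0 '' {z ∈ D.K k0 | ε ≤ ‖G z‖})ᶜ :=
    (D.uan k hp).continuousAt.eventually (hc2.isOpen_compl.mem_nhds hn)
  have hball : ∀ᶠ x in 𝓝 p, x ∈ Metric.ball (0:ℂ) (2*D.T) := Metric.isOpen_ball.mem_nhds hp
  have hfin : ∀ᶠ x in 𝓝[≠] p, ‖A x‖ ≤ ε := by
    filter_upwards [hδ, hev.filter_mono nhdsWithin_le_nhds, hball.filter_mono nhdsWithin_le_nhds]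
      with x h1 h2 h3
    have h4 := D.class he μ k0 G k h3
    rw [← hAT x h3] at h4
    set M := (cf D.fib (D.U k (D.ξ k x))).filter fun π => D.v μ π = D.v μ (k, D.ξ k x) with hM
    have h5 : (Multiset.card M : ℂ) * A x = (M.map (ext0 k0 G)).sum := by
      have : D.δ μ e (D.U k (D.ξ k x)) * ((Multiset.card M : ℂ) * A x) =
        D.δ μ e (D.U k (D.ξ k x)) * (M.map (ext0 k0 G)).sum := by rw [← h4]; ring
      exact mul_left_cancel₀ h1 this
    have hMm : ∀ π ∈ M, ‖ext0 k0 G π‖ ≤ ε := by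
      intro π hπ
      have h6 := (mem_cf D.hF (D.inb k h3) π).1 (Multiset.mem_of_mem_filter hπ)
      by_cases hk : π.1 = k0
      · simp only [ext0, hk, if_true]
        rw [hk] at h6
        by_contra hlt
        exact h2 ⟨π.2, ⟨(D.hF k0).sub h6.1, (not_le.1 hlt).le⟩, h6.2⟩
      · simp [ext0, hk, hε.le]
    have h7 : ‖(M.map (ext0 k0 G)).sum‖ ≤ Multiset.card M * ε := by
      refine (norm_multiset_sum_le _).trans ?_
      rw [Multiset.map_map]
      refine (Multiset.sum_le_card_nsmul _ ε ?_).trans (by simp)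
      intro y hy
      obtain ⟨π, hπ, rfl⟩ := Multiset.mem_map.1 hy
      exact hMm π hπ
    have h8 : 0 < Multiset.card M := by
      rw [Multiset.card_pos_iff_exists_mem]
      exact ⟨(k, D.ξ k x), Multiset.mem_filter.2 ⟨(mem_cf D.hF (D.inb k h3) _).2 ⟨D.hξX k x h3, rfl⟩, rfl⟩⟩
    rw [← h5, norm_mul, Complex.norm_natCast] at h7
    exact le_of_mul_le_mul_left h7 (by exact_mod_cast h8)
  exact le_of_tendsto (hA.norm.tendsto.mono_left nhdsWithin_le_nhds) hfin

lemma CD.glob (D : CD ι n) {e : ℕ} (he : D.he e) (μ : Fin n → ℂ) (k k0 : ι)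
    {ρ2 : ℝ} (h12 : D.ρ1 < ρ2) (h2 : ρ2 < D.ρ) (π : Polynomial ℂ) (hπ : π ≠ 0) (E : ℂ → ℂ)
    (hE : AnalyticOnNhd ℂ E (Metric.closedBall 0 ρ2)) (hE0 : ∀ s ∈ Metric.closedBall (0:ℂ) ρ2, E s ≠ 0)
    (hδ : ∀ s, D.δ μ e s = π.eval s * E s)
    {a b : ℕ} (hab : a < b) (Xm : Fin n → ℕ → ℕ → ℂ) (J : ℕ → ℕ → ℂ → ℂ)
    (hJ : ∀ d c, d < c → ∀ x ∈ Metric.ball (0:ℂ) (2*D.T), HasDerivAt (J d c)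
      (∑ c' ∈ Finset.Ico d c, J d c' x * ∑ i, deriv (fun x => D.F k i (D.ξ k x)) x * Xm i c' c) x)
    (hJ1 : ∀ d x, J d d x = 1)
    (H : ℕ → ℂ → ℂ) (hHa : ∀ z, H a z = 1)
    (hH : ∀ c ∈ Finset.Ico a b, ∀ z ∈ D.X k0, HasDerivAt (H c)
      (∑ c' ∈ Finset.Ico a c, H c' z * ∑ i, deriv (D.F k0 i) z * Xm i c' c) z)
    (G ψ : ℂ → ℂ) (hGa : AnalyticOnNhd ℂ G (D.K k0)) (hψa : AnalyticOnNhd ℂ ψ (D.K k0))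
    (hG : ∀ z ∈ D.X k0, HasDerivAt G
      (∑ c ∈ Finset.Ico a b, H c z * ∑ i, deriv (D.F k0 i) z * Xm i c b
        - ψ z * π.eval (D.U k0 z) * deriv (D.U k0) z) z)
    (hGZ0 : ∀ z ∈ D.X k0, D.U k0 z = D.U k (D.ξ k 0) → G z = 0)
    (hGZT : ∀ z ∈ D.X k0, D.U k0 z = D.U k (D.ξ k D.T) → G z = 0) :
    ∃ P : ℕ → ℂ, (k = k0 → P a ≠ 0) ∧
      ∑ d ∈ Finset.Ico a b, P d * J d b D.T - ∑ d ∈ Finset.Ico a b, P d * J d b 0 =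
      ∫ x in (0:ℝ)..D.T, D.Θ μ e k0 ψ k x / E (D.U k (D.ξ k x)) *
        deriv (fun x => D.U k (D.ξ k x)) x := by
  classical
  have hT := D.hT
  have h0b : (0:ℂ) ∈ Metric.ball (0:ℂ) (2*D.T) := Metric.mem_ball_self (by linarith)
  have hTb : (D.T:ℂ) ∈ Metric.ball (0:ℂ) (2*D.T) := by
    rw [mem_ball_zero_iff, Complex.norm_real, Real.norm_of_nonneg hT.le]; linarith
  have hin2 : ∀ x ∈ Metric.ball (0:ℂ) (2*D.T), D.U k (D.ξ k x) ∈ Metric.closedBall (0:ℂ) ρ2 := by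
    intro x hx
    rw [mem_closedBall_zero_iff]; exact (D.hub k x hx).trans h12.le
  obtain ⟨Cv, hCv⟩ := D.crit
  have hav := D.avoid k (Cv ∪ π.roots.toFinset)
  have hball0 : ∀ᶠ x in 𝓝[≠] (0:ℂ), x ∈ Metric.ball (0:ℂ) (2*D.T) :=
    nhdsWithin_le_nhds (Metric.isOpen_ball.mem_nhds h0b)
  have hne0 : ∀ᶠ x in 𝓝[≠] (0:ℂ), D.δ μ e (D.U k (D.ξ k x)) ≠ 0 := by
    filter_upwards [hav, hball0] with x hx hxb h
    rw [hδ] at h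
    rcases mul_eq_zero.1 h with h | h
    · refine hx ?_
      simp only [Finset.mem_union, Multiset.mem_toFinset]
      exact Or.inr ((Polynomial.mem_roots hπ).2 h)
    · exact hE0 _ (hin2 x hxb) h
  obtain ⟨x0, ⟨hx0d, hx0b⟩, hx0c⟩ := ((hne0.and hball0).and hav).exists
  have hdu : DifferentiableOn ℂ (fun x => D.δ μ e (D.U k (D.ξ k x))) (Metric.ball 0 (2*D.T)) :=
    (D.ddiff μ e).comp (D.udiff k) fun x hx => D.inb k hx
  have hpre : IsPreconnected (Metric.ball (0:ℂ) (2*D.T)) := (convex_ball _ _).isPreconnected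
  have hneT : ∀ᶠ x in 𝓝[≠] (D.T:ℂ), D.δ μ e (D.U k (D.ξ k x)) ≠ 0 := by
    by_contra hcon
    have hfr : ∃ᶠ x in 𝓝[≠] (D.T:ℂ), D.δ μ e (D.U k (D.ξ k x)) = 0 := hcon
    exact hx0d ((hdu.analyticOnNhd Metric.isOpen_ball).eqOn_zero_of_preconnected_of_frequently_eq_zero
      hpre hTb hfr hx0b)
  obtain ⟨P, Am, Ap, hPa, hloc⟩ := D.local_main he μ k k0 hx0b hx0d
    (fun π' hπ' => by
      obtain ⟨h1, h3⟩ := (mem_cf D.hF (D.inb k hx0b) π').1 hπ'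
      exact hCv _ (fun h => hx0c (Finset.mem_union_left _ h)) π' h1 h3)
    hab Xm J hJ hJ1 H hHa hH G ψ (fun s => π.eval s) hG
  refine ⟨P, hPa, ?_⟩
  set Ψ : ℂ → ℂ := fun x => D.Θ μ e k0 ψ k x / E (D.U k (D.ξ k x)) *
        deriv (fun x => D.U k (D.ξ k x)) x with hΨ
  have hEu : DifferentiableOn ℂ (fun x => E (D.U k (D.ξ k x))) (Metric.ball 0 (2*D.T)) :=
    hE.differentiableOn.comp (D.udiff k) hin2
  have hΨd : DifferentiableOn ℂ Ψ (Metric.ball 0 (2*D.T)) := by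
    refine ((D.Tdiff μ e k0 hψa k).div hEu fun x hx => hE0 _ (hin2 x hx)).mul ?_
    exact (D.udiff k).deriv Metric.isOpen_ball
  obtain ⟨Q, hQ⟩ := hΨd.isExactOn_ball
  set M : ℂ → ℂ := fun x => ∑ d ∈ Finset.Ico a b, P d * J d b x with hM
  have hMd : DifferentiableOn ℂ M (Metric.ball 0 (2*D.T)) :=
    DifferentiableOn.fun_sum fun d hd => DifferentiableOn.const_mul (fun x hx =>
      (hJ d b (Finset.mem_Ico.1 hd).2 x hx).differentiableAt.differentiableWithinAt) _
  have hQd : DifferentiableOn ℂ Q (Metric.ball 0 (2*D.T)) := fun x hx =>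
    (hQ x hx).differentiableAt.differentiableWithinAt
  have hball : ∀ᶠ x in 𝓝 x0, x ∈ Metric.ball (0:ℂ) (2*D.T) := Metric.isOpen_ball.mem_nhds hx0b
  have hne : ∀ᶠ x in 𝓝 x0, D.δ μ e (D.U k (D.ξ k x)) ≠ 0 :=
    (hdu.differentiableAt (Metric.isOpen_ball.mem_nhds hx0b)).continuousAt.eventually_ne hx0d
  have hcon := const_of_deriv_zero (g := fun x => (M x - Am x) - Q x) (x0 := x0) (by
    filter_upwards [hloc, hball, hne] with x ⟨h3, h4, h5⟩ hxb hx
    refine (h5.sub (hQ x hxb)).congr_deriv ?_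
    simp only [hΨ]
    rw [h4, hδ]
    have := hE0 _ (hin2 x hxb)
    field_simp
    ring)
  set κ := M x0 - Am x0 - Q x0
  have hAd : DifferentiableOn ℂ (fun x => M x - Q x - κ) (Metric.ball 0 (2*D.T)) :=
    (hMd.sub hQd).sub (differentiableOn_const _)
  have hid : EqOn (fun x => D.δ μ e (D.U k (D.ξ k x)) * (M x - Q x - κ)) (D.Θ μ e k0 G k)
      (Metric.ball 0 (2*D.T)) := by
    refine AnalyticOnNhd.eqOn_of_preconnected_of_eventuallyEq
      ((hdu.mul hAd).analyticOnNhd Metric.isOpen_ball)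
      ((D.Tdiff μ e k0 hGa k).analyticOnNhd Metric.isOpen_ball) hpre hx0b ?_
    filter_upwards [hloc, hcon] with x ⟨h3, _, _⟩ h4
    rw [h3, ← h4]
    congr 1; ring
  have hend : ∀ p ∈ Metric.ball (0:ℂ) (2*D.T), (∀ᶠ x in 𝓝[≠] p, D.δ μ e (D.U k (D.ξ k x)) ≠ 0) →
      (∀ z ∈ D.X k0, D.U k0 z = D.U k (D.ξ k p) → G z = 0) → M p - Q p - κ = 0 :=
    fun p hp h1 h2 => D.endpt he μ k k0 hp h1 hGa h2
      (hAd.differentiableAt (Metric.isOpen_ball.mem_nhds hp)).continuousAt (fun x hx => hid hx)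
  have e0 := hend 0 h0b hne0 hGZ0
  have eT := hend D.T hTb hneT hGZT
  have hreal : ∀ x ∈ uIcc 0 D.T, ((x:ℝ):ℂ) ∈ Metric.ball (0:ℂ) (2*D.T) := by
    intro x hx
    rw [uIcc_of_le hT.le] at hx
    rw [mem_ball_zero_iff, Complex.norm_real, Real.norm_of_nonneg hx.1]; linarith [hx.2]
  have hint : ∫ x in (0:ℝ)..D.T, Ψ x = Q D.T - Q (0:ℝ) := by
    refine intervalIntegral.integral_eq_sub_of_hasDerivAt (f := fun x : ℝ => Q x)
      (fun x hx => (hQ x (hreal x hx)).comp_ofReal) ?_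
    refine ContinuousOn.intervalIntegrable ?_
    exact hΨd.continuousOn.comp Complex.continuous_ofReal.continuousOn hreal
  rw [hint]
  simp only [Complex.ofReal_zero]
  linear_combination eT - e0
end glob

lemma poly_approx {g : ℂ → ℂ} {r R : ℝ} (hr : 0 ≤ r) (hR : r < R)
    (hg : DifferentiableOn ℂ g (Metric.closedBall 0 R)) {ε : ℝ} (hε : 0 < ε) :
    ∃ p : Polynomial ℂ, ∀ s, ‖s‖ ≤ r → ‖g s - p.eval s‖ ≤ ε := by
  obtain ⟨r', h1, h2⟩ := exists_between hR
  have hR0 : 0 < R := hr.trans_lt hR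
  lift R to NNReal using hR0.le
  lift r' to NNReal using hr.trans h1.le
  have hp := hg.hasFPowerSeriesOnBall (by exact_mod_cast hR0)
  have hu := hp.tendstoUniformlyOn (r' := r') (by exact_mod_cast h2)
  obtain ⟨N, hN⟩ := ((Metric.tendstoUniformlyOn_iff.1 hu) ε hε).exists
  set p := cauchyPowerSeries g 0 (R:ℝ)
  refine ⟨∑ i ∈ Finset.range N, Polynomial.C (p.coeff i) * Polynomial.X ^ i, fun s hs => ?_⟩
  have := hN s (by rw [mem_ball_zero_iff]; linarith)
  rw [dist_eq_norm, zero_add] at this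
  refine le_of_eq_of_le ?_ this.le
  congr 2
  simp only [FormalMultilinearSeries.partialSum, Polynomial.eval_finsetSum]
  exact Finset.sum_congr rfl fun i _ => by
    rw [FormalMultilinearSeries.apply_eq_pow_smul_coeff, smul_eq_mul, Polynomial.eval_mul,
      Polynomial.eval_C, Polynomial.eval_pow, Polynomial.eval_X, mul_comm]

section core
variable {ι : Type} [Fintype ι] [DecidableEq ι] {n : ℕ}

lemma CD.real_mem (D : CD ι n) : ∀ x ∈ uIcc 0 D.T, ((x:ℝ):ℂ) ∈ Metric.ball (0:ℂ) (2*D.T) := by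
  intro x hx
  rw [uIcc_of_le D.hT.le] at hx
  rw [mem_ball_zero_iff, Complex.norm_real, Real.norm_of_nonneg hx.1]; linarith [hx.2, D.hT]

lemma CD.intg (D : CD ι n) {g : ℂ → ℂ} (hg : DifferentiableOn ℂ g (Metric.ball 0 (2*D.T))) :
    IntervalIntegrable (fun x : ℝ => g x) volume 0 D.T :=
  (hg.continuousOn.comp Complex.continuous_ofReal.continuousOn D.real_mem).intervalIntegrable

lemma CD.uder (D : CD ι n) (k : ι) {x : ℂ} (hx : x ∈ Metric.ball (0:ℂ) (2*D.T)) :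
    deriv (fun x => D.U k (D.ξ k x)) x = ∑ i, D.lam i * deriv (fun x => D.F k i (D.ξ k x)) x := by
  have : (fun x => D.U k (D.ξ k x)) = fun x => ∑ i, D.lam i * D.F k i (D.ξ k x) := by
    funext x; exact D.hU k _
  rw [this]
  exact (HasDerivAt.fun_sum fun i _ => ((D.fan k i hx).differentiableAt.hasDerivAt.const_mul _)).deriv

lemma CD.mom1 (D : CD ι n) (ε : ι → ℂ) (hmom : ∀ (Q : MvPolynomial (Fin n) ℂ) (i : Fin n),
      ∑ k, ε k * ∫ x in (0:ℝ)..D.T, MvPolynomial.eval (fun l => D.F k l (D.ξ k x)) Q *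
        deriv (fun x => D.F k i (D.ξ k x)) x = 0) (Q : MvPolynomial (Fin n) ℂ) :
    ∑ k, ε k * ∫ x in (0:ℝ)..D.T, MvPolynomial.eval (fun l => D.F k l (D.ξ k x)) Q *
        deriv (fun x => D.U k (D.ξ k x)) x = 0 := by
  have hQ : ∀ k, DifferentiableOn ℂ (fun x => MvPolynomial.eval (fun l => D.F k l (D.ξ k x)) Q)
      (Metric.ball 0 (2*D.T)) := by
    intro k
    simp only [MvPolynomial.eval_eq]
    refine DifferentiableOn.fun_sum fun d _ => (differentiableOn_const _).mul
      (DifferentiableOn.fun_finsetProd fun l _ => DifferentiableOn.pow ?_ _)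
    exact fun x hx => (D.fan k l hx).differentiableAt.differentiableWithinAt
  have hk : ∀ k, ∫ x in (0:ℝ)..D.T, MvPolynomial.eval (fun l => D.F k l (D.ξ k x)) Q *
        deriv (fun x => D.U k (D.ξ k x)) x = ∑ i, D.lam i *
      ∫ x in (0:ℝ)..D.T, MvPolynomial.eval (fun l => D.F k l (D.ξ k x)) Q *
        deriv (fun x => D.F k i (D.ξ k x)) x := by
    intro k
    simp only [← intervalIntegral.integral_const_mul]
    rw [← intervalIntegral.integral_finsetSum]
    · refine intervalIntegral.integral_congr fun x hx => ?_
      rw [D.uder k (D.real_mem x hx), Finset.mul_sum]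
      exact Finset.sum_congr rfl fun i _ => by ring
    · intro i _
      refine (IntervalIntegrable.const_mul ?_ _)
      refine D.intg (g := fun x => MvPolynomial.eval (fun l => D.F k l (D.ξ k x)) Q *
        deriv (fun x => D.F k i (D.ξ k x)) x) ((hQ k).mul ?_)
      exact DifferentiableOn.deriv (fun x hx => (D.fan k i hx).differentiableAt.differentiableWithinAt)
        Metric.isOpen_ball
  simp only [hk, Finset.mul_sum]
  rw [Finset.sum_comm]
  refine Finset.sum_eq_zero fun i _ => ?_
  rw [show ∑ k, ε k * (D.lam i * ∫ x in (0:ℝ)..D.T, MvPolynomial.eval (fun l => D.F k l (D.ξ k x)) Q *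
        deriv (fun x => D.F k i (D.ξ k x)) x) = D.lam i * ∑ k, ε k *
        ∫ x in (0:ℝ)..D.T, MvPolynomial.eval (fun l => D.F k l (D.ξ k x)) Q *
        deriv (fun x => D.F k i (D.ξ k x)) x by
      rw [Finset.mul_sum]; exact Finset.sum_congr rfl fun k _ => by ring, hmom, mul_zero]

lemma CD.mom2 (D : CD ι n) (ε : ι → ℂ) (hmom : ∀ (Q : MvPolynomial (Fin n) ℂ) (i : Fin n),
      ∑ k, ε k * ∫ x in (0:ℝ)..D.T, MvPolynomial.eval (fun l => D.F k l (D.ξ k x)) Q *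
        deriv (fun x => D.F k i (D.ξ k x)) x = 0) (μ : Fin n → ℂ)
    {ρ2 : ℝ} (h0 : 0 ≤ D.ρ1) (h12 : D.ρ1 < ρ2) (g : ℂ → ℂ)
    (hg : DifferentiableOn ℂ g (Metric.closedBall 0 ρ2)) (j : ℕ) :
    ∑ k, ε k * ∫ x in (0:ℝ)..D.T, (g (D.U k (D.ξ k x)) * D.v μ (k, D.ξ k x) ^ j) *
        deriv (fun x => D.U k (D.ξ k x)) x = 0 := by
  set w : ι → ℂ → ℂ := fun k x => D.v μ (k, D.ξ k x) ^ j * deriv (fun x => D.U k (D.ξ k x)) x with hw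
  have hwd : ∀ k, DifferentiableOn ℂ (w k) (Metric.ball 0 (2*D.T)) := by
    intro k
    refine DifferentiableOn.mul (DifferentiableOn.pow (fun x hx => ?_) _)
      ((D.udiff k).deriv Metric.isOpen_ball)
    exact ((D.van μ k _ (D.sub k hx)).fun_comp (D.hξ k x)).differentiableAt.differentiableWithinAt
  have hin2 : ∀ k, ∀ x ∈ Metric.ball (0:ℂ) (2*D.T), D.U k (D.ξ k x) ∈ Metric.closedBall (0:ℂ) ρ2 := by
    intro k x hx
    rw [mem_closedBall_zero_iff]; exact (D.hub k x hx).trans h12.le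
  set c := ∑ k, ‖ε k‖ * ∫ x in (0:ℝ)..D.T, ‖w k x‖ with hc
  have hpol : ∀ p : Polynomial ℂ, ∑ k, ε k * ∫ x in (0:ℝ)..D.T, p.eval (D.U k (D.ξ k x)) * w k x = 0 := by
    intro p
    have := D.mom1 ε hmom (Polynomial.aeval (∑ i, MvPolynomial.C (D.lam i) * MvPolynomial.X i) p *
      (∑ i, MvPolynomial.C (μ i) * MvPolynomial.X i) ^ j)
    rw [← this]
    refine Finset.sum_congr rfl fun k _ => ?_
    congr 1
    refine intervalIntegral.integral_congr fun x hx => ?_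
    have e1 : MvPolynomial.eval (fun l => D.F k l (D.ξ k x))
        (Polynomial.aeval (∑ i, MvPolynomial.C (D.lam i) * MvPolynomial.X i) p) =
        p.eval (D.U k (D.ξ k x)) := by
      have := Polynomial.hom_eval₂ p (algebraMap ℂ (MvPolynomial (Fin n) ℂ))
        (MvPolynomial.eval (fun l => D.F k l (D.ξ k x)))
        (∑ i, MvPolynomial.C (D.lam i) * MvPolynomial.X i)
      rw [Polynomial.aeval_def, this]
      rw [show (MvPolynomial.eval fun l => D.F k l (D.ξ k x)).comp (algebraMap ℂ (MvPolynomial (Fin n) ℂ))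
        = RingHom.id ℂ by ext; simp [MvPolynomial.algebraMap_eq]]
      rw [Polynomial.eval₂_id]
      congr 1
      rw [D.hU k]; simp
    simp only [hw, map_mul, map_pow, e1, CD.v]
    simp [mul_assoc]
  have hmain : ∀ η > 0, ‖∑ k, ε k * ∫ x in (0:ℝ)..D.T, g (D.U k (D.ξ k x)) * w k x‖ ≤ η * c := by
    intro η hη
    obtain ⟨p, hp⟩ := poly_approx h0 h12 hg hη
    rw [← sub_zero (∑ k, ε k * ∫ x in (0:ℝ)..D.T, g (D.U k (D.ξ k x)) * w k x), ← hpol p,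
      ← Finset.sum_sub_distrib, hc, Finset.mul_sum]
    refine norm_sum_le_of_le _ fun k _ => ?_
    rw [← mul_sub, ← intervalIntegral.integral_sub, norm_mul, mul_left_comm]
    · refine mul_le_mul_of_nonneg_left ?_ (norm_nonneg _)
      rw [← intervalIntegral.integral_const_mul]
      refine intervalIntegral.norm_integral_le_of_norm_le D.hT.le ?_ ?_
      · refine Eventually.of_forall fun x hx => ?_
        rw [← sub_mul, norm_mul]
        refine mul_le_mul_of_nonneg_right (hp _ ?_) (norm_nonneg _)
        refine D.hub k x (D.real_mem x ?_)
        rw [uIcc_of_le D.hT.le]; exact Ioc_subset_Icc_self hx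
      · exact ((D.intg (hwd k)).norm).const_mul _
    · exact D.intg (g := fun x => g (D.U k (D.ξ k x)) * w k x)
        ((hg.comp (D.udiff k) (hin2 k)).mul (hwd k))
    · refine D.intg (g := fun x => p.eval (D.U k (D.ξ k x)) * w k x) (DifferentiableOn.mul ?_ (hwd k))
      exact p.differentiable.comp_differentiableOn (D.udiff k)
  have hz : ‖∑ k, ε k * ∫ x in (0:ℝ)..D.T, g (D.U k (D.ξ k x)) * w k x‖ ≤ 0 := by
    have ht : Tendsto (fun η : ℝ => η * c) (𝓝[>] 0) (𝓝 0) := by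
      have : Tendsto (fun η : ℝ => η * c) (𝓝 0) (𝓝 (0 * c)) := tendsto_id.mul_const c
      rw [zero_mul] at this
      exact this.mono_left nhdsWithin_le_nhds
    exact ge_of_tendsto ht (eventually_nhdsWithin_of_forall fun η hη => hmain η hη)
  have := norm_le_zero_iff.1 hz
  simpa only [hw, mul_assoc] using this

theorem CD.core (D : CD ι n) (ε : ι → ℂ) (hmom : ∀ (Q : MvPolynomial (Fin n) ℂ) (i : Fin n),
      ∑ k, ε k * ∫ x in (0:ℝ)..D.T, MvPolynomial.eval (fun l => D.F k l (D.ξ k x)) Q *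
        deriv (fun x => D.F k i (D.ξ k x)) x = 0)
    (k0 : ι) (hε : ε k0 ≠ 0)
    {a b : ℕ} (hab : a < b) (Xm : Fin n → ℕ → ℕ → ℂ) (J : ι → ℕ → ℕ → ℂ → ℂ)
    (hJ : ∀ k d c, d < c → ∀ x ∈ Metric.ball (0:ℂ) (2*D.T), HasDerivAt (J k d c)
      (∑ c' ∈ Finset.Ico d c, J k d c' x * ∑ i, deriv (fun x => D.F k i (D.ξ k x)) x * Xm i c' c) x)
    (hJ1 : ∀ k d x, J k d d x = 1) (hJ0 : ∀ k d c, d < c → J k d c 0 = 0)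
    (H : ℕ → ℂ → ℂ) (hHa : ∀ z, H a z = 1)
    (hH : ∀ c ∈ Finset.Ico a b, ∀ z ∈ D.X k0, HasDerivAt (H c)
      (∑ c' ∈ Finset.Ico a c, H c' z * ∑ i, deriv (D.F k0 i) z * Xm i c' c) z)
    (hdec : ∀ π : Polynomial ℂ, π ≠ 0 → ∃ Φ ψ : ℂ → ℂ, AnalyticOnNhd ℂ Φ (D.K k0) ∧
      AnalyticOnNhd ℂ ψ (D.K k0) ∧ ∀ z ∈ D.X k0, HasDerivAt Φ
      (∑ c ∈ Finset.Ico a b, H c z * ∑ i, deriv (D.F k0 i) z * Xm i c b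
        - ψ z * π.eval (D.U k0 z) * deriv (D.U k0) z) z)
    (hT1 : ∀ k, k ≠ k0 → ∀ d ∈ Finset.Ico a b, J k d b D.T = 0)
    (hT2 : ∀ d, a < d → d < b → J k0 d b D.T = 0) : J k0 a b D.T = 0 := by
  classical
  obtain ⟨e, μ, he, s1, hs1, hs1d⟩ := exists_sep D.hF D.hρ D.F
  have h0b : (0:ℂ) ∈ Metric.ball (0:ℂ) (2*D.T) := Metric.mem_ball_self (by linarith [D.hT])
  have hTb : (D.T:ℂ) ∈ Metric.ball (0:ℂ) (2*D.T) := D.real_mem _ right_mem_uIcc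
  have hρ1 : 0 ≤ D.ρ1 := (norm_nonneg _).trans (D.hub k0 0 h0b)
  obtain ⟨ρ2, h12, h2⟩ := exists_between D.hρ1
  have hda : AnalyticOnNhd ℂ (D.δ μ e) (Metric.ball 0 D.ρ) := (D.ddiff μ e).analyticOnNhd Metric.isOpen_ball
  have hsub : Metric.closedBall (0:ℂ) ρ2 ⊆ Metric.ball 0 D.ρ := Metric.closedBall_subset_ball h2
  obtain ⟨π, hπ, -, E, hE, hE0, hδ⟩ := fz (isCompact_closedBall (0:ℂ) ρ2) (hda.mono hsub) (by
    intro z hz h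
    exact hs1d (hda.eqOn_zero_of_preconnected_of_eventuallyEq_zero (convex_ball _ _).isPreconnected
      (hsub hz) h hs1))
  obtain ⟨Φ, ψ0, hΦ, hψ0, hdec⟩ := hdec π hπ.ne_zero
  have hUan := (D.hF k0).an
  have hqa : AnalyticOnNhd ℂ (fun z => π.eval (D.U k0 z) * deriv (D.U k0) z) (D.K k0) := fun z hz =>
    (AnalyticAt.fun_comp (AnalyticOnNhd.eval_polynomial π _ (mem_univ _)) (hUan z hz)).mul (hUan z hz).deriv
  set Z : Finset ℂ := Finset.univ.biUnion fun k => (D.fib k0 (D.U k (D.ξ k 0))).toFinset ∪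
    (D.fib k0 (D.U k (D.ξ k D.T))).toFinset with hZ
  obtain ⟨η, ψ1, hψ1, hηZ, hη⟩ := exists_eta (D.hF k0).cpt hqa (by
    intro z hz h
    have h1 : ∀ r ∈ π.roots.toFinset, ∀ᶠ y in 𝓝[≠] z, D.U k0 y ≠ r := by
      intro r _
      refine ((hUan z hz).eventually_eq_or_eventually_ne analyticAt_const).resolve_left fun h3 => ?_
      refine D.hdU k0 z hz ?_
      have := (show D.U k0 =ᶠ[𝓝 z] fun _ => r from h3).deriv
      filter_upwards [this] with y hy
      rw [hy]; simp
    rw [← Finset.eventually_all] at h1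
    have h2 : ∀ᶠ y in 𝓝[≠] z, deriv (D.U k0) y ≠ 0 :=
      ((hUan z hz).deriv.eventually_eq_zero_or_eventually_ne_zero).resolve_left (D.hdU k0 z hz)
    obtain ⟨y, ⟨h3, h4⟩, h5⟩ := ((h1.and h2).and (h.filter_mono nhdsWithin_le_nhds)).exists
    rcases mul_eq_zero.1 h5 with h5 | h5
    · exact h3 _ (Multiset.mem_toFinset.2 ((Polynomial.mem_roots hπ.ne_zero).2 h5)) rfl
    · exact h4 h5) Φ Z
  set G : ℂ → ℂ := fun z => Φ z - η.eval z with hGd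
  set ψ : ℂ → ℂ := fun z => ψ0 z + ψ1 z with hψd
  have hGa : AnalyticOnNhd ℂ G (D.K k0) := fun z hz =>
    (hΦ z hz).sub (AnalyticOnNhd.eval_polynomial η z (mem_univ _))
  have hψa : AnalyticOnNhd ℂ ψ (D.K k0) := fun z hz => (hψ0 z hz).add (hψ1 z hz)
  have hG : ∀ z ∈ D.X k0, HasDerivAt G
      (∑ c ∈ Finset.Ico a b, H c z * ∑ i, deriv (D.F k0 i) z * Xm i c b
        - ψ z * π.eval (D.U k0 z) * deriv (D.U k0) z) z := by
    intro z hz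
    refine ((hdec z hz).sub (η.hasDerivAt z)).congr_deriv ?_
    rw [hη z ((D.hF k0).sub hz), hψd]; ring
  have hGZ : ∀ k, (∀ z ∈ D.X k0, D.U k0 z = D.U k (D.ξ k 0) → G z = 0) ∧
      (∀ z ∈ D.X k0, D.U k0 z = D.U k (D.ξ k D.T) → G z = 0) := by
    intro k
    constructor
    · intro z hz hzU
      simp only [hGd]
      rw [hηZ z ?_, sub_self]
      rw [hZ, Finset.mem_biUnion]
      refine ⟨k, Finset.mem_univ _, Finset.mem_union_left _ ?_⟩
      exact Multiset.mem_toFinset.2 (((D.hF k0).mem _ (D.inb k h0b) z).2 ⟨hz, hzU⟩)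
    · intro z hz hzU
      simp only [hGd]
      rw [hηZ z ?_, sub_self]
      rw [hZ, Finset.mem_biUnion]
      refine ⟨k, Finset.mem_univ _, Finset.mem_union_right _ ?_⟩
      exact Multiset.mem_toFinset.2 (((D.hF k0).mem _ (D.inb k hTb) z).2 ⟨hz, hzU⟩)
  have hgl := fun k => D.glob he μ k k0 h12 h2 π hπ.ne_zero E hE hE0 hδ hab Xm (J k) (hJ k) (hJ1 k) H hHa hH
    G ψ hGa hψa hG (hGZ k).1 (hGZ k).2
  choose P hPa hP using hgl
  have hsum : ∑ k, ε k * ∫ x in (0:ℝ)..D.T, D.Θ μ e k0 ψ k x / E (D.U k (D.ξ k x)) *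
        deriv (fun x => D.U k (D.ξ k x)) x = 0 := by
    have hgd : ∀ j : Fin e, DifferentiableOn ℂ
        (fun s => bVec (cf D.fib s) (D.v μ) (ext0 k0 ψ) e j / E s) (Metric.closedBall 0 ρ2) := fun j =>
      ((D.bdiff μ e k0 hψa j).mono hsub).div hE.differentiableOn hE0
    have hin2 : ∀ k, ∀ x ∈ Metric.ball (0:ℂ) (2*D.T), D.U k (D.ξ k x) ∈ Metric.closedBall (0:ℂ) ρ2 := by
      intro k x hx
      rw [mem_closedBall_zero_iff]; exact (D.hub k x hx).trans h12.le
    have h1 : ∀ k, ∫ x in (0:ℝ)..D.T, D.Θ μ e k0 ψ k x / E (D.U k (D.ξ k x)) *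
        deriv (fun x => D.U k (D.ξ k x)) x = ∑ j : Fin e, ∫ x in (0:ℝ)..D.T,
        ((fun s => bVec (cf D.fib s) (D.v μ) (ext0 k0 ψ) e j / E s) (D.U k (D.ξ k x)) *
          D.v μ (k, D.ξ k x) ^ (j:ℕ)) * deriv (fun x => D.U k (D.ξ k x)) x := by
      intro k
      rw [← intervalIntegral.integral_finsetSum]
      · refine intervalIntegral.integral_congr fun x _ => ?_
        simp only [CD.Θ, Finset.sum_div, Finset.sum_mul]
        exact Finset.sum_congr rfl fun j _ => by ring
      · intro j _
        refine D.intg (g := fun x => ((fun s => bVec (cf D.fib s) (D.v μ) (ext0 k0 ψ) e j / E s) (D.U k (D.ξ k x)) *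
          D.v μ (k, D.ξ k x) ^ (j:ℕ)) * deriv (fun x => D.U k (D.ξ k x)) x) ?_
        refine DifferentiableOn.mul (DifferentiableOn.mul ((hgd j).comp (D.udiff k) (hin2 k))
          (DifferentiableOn.pow (fun x hx => ?_) _)) ((D.udiff k).deriv Metric.isOpen_ball)
        exact ((D.van μ k _ (D.sub k hx)).fun_comp (D.hξ k x)).differentiableAt.differentiableWithinAt
    simp only [h1, Finset.mul_sum]
    rw [Finset.sum_comm]
    exact Finset.sum_eq_zero fun j _ => D.mom2 ε hmom μ hρ1 h12 _ (hgd j) j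
  have h00 : ∀ k, ∑ d ∈ Finset.Ico a b, P k d * J k d b 0 = 0 := fun k =>
    Finset.sum_eq_zero fun d hd => by rw [hJ0 k d b (Finset.mem_Ico.1 hd).2, mul_zero]
  simp only [← hP, h00, sub_zero] at hsum
  rw [Finset.sum_eq_single k0] at hsum
  · rw [Finset.sum_eq_single a] at hsum
    · exact ((mul_eq_zero.1 ((mul_eq_zero.1 hsum).resolve_left hε)).resolve_left (hPa k0 rfl))
    · intro d hd hda
      rw [Finset.mem_Ico] at hd
      rw [hT2 d (by omega) hd.2, mul_zero]
    · intro h; exact absurd (Finset.mem_Ico.2 ⟨le_rfl, hab⟩) h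
  · intro k _ hk
    rw [Finset.sum_eq_zero, mul_zero]
    intro d hd
    rw [hT1 k hk d hd, mul_zero]
  · intro h; exact absurd (Finset.mem_univ _) h
end core

lemma ne0_cob : ∀ᶠ x in Bornology.cobounded ℂ, x ≠ 0 := by
  have : ({0}ᶜ : Set ℂ) ∈ Bornology.cobounded ℂ := Bornology.isBounded_def.1 Bornology.isBounded_singleton
  filter_upwards [this] with x hx using hx

lemma pl_lim (P : Polynomial ℂ) :
    Tendsto (fun x => P.eval x / x^P.natDegree) (Bornology.cobounded ℂ) (𝓝 P.leadingCoeff) := by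
  have h1 : Tendsto (fun x:ℂ => P.reverse.eval x⁻¹) (Bornology.cobounded ℂ) (𝓝 P.leadingCoeff) := by
    have := (P.reverse.continuous.tendsto 0).comp (Filter.tendsto_inv₀_cobounded (α := ℂ))
    rwa [← Polynomial.coeff_zero_eq_eval_zero, Polynomial.coeff_zero_reverse] at this
  refine h1.congr' ?_
  filter_upwards [ne0_cob] with x hx
  let i : Invertible x := invertibleOfNonzero hx
  have h2 := Polynomial.eval₂_reverse_mul_pow (RingHom.id ℂ) x P
  simp only [Polynomial.eval₂_id, invOf_eq_inv] at h2
  rw [← h2]; field_simp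

lemma exp_bad (κ : ℝ) (hκ : κ ≠ 0) (u : ℂ) :
    {r : ℝ | Complex.exp (Complex.I * κ * r) = u}.Countable := by
  by_cases hne : ∃ r0 : ℝ, Complex.exp (Complex.I * κ * r0) = u
  · obtain ⟨r0, h0⟩ := hne
    refine (countable_range (fun n : ℤ => r0 + n * (2 * Real.pi) / κ)).mono ?_
    intro r hr
    have hr : Complex.exp (Complex.I * κ * r) = u := hr
    rw [← h0, Complex.exp_eq_exp_iff_exists_int] at hr
    obtain ⟨n, hn⟩ := hr
    refine ⟨n, ?_⟩
    have : ((κ * r : ℝ) : ℂ) = ((κ * r0 + n * (2 * Real.pi) : ℝ) : ℂ) := by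
      apply mul_left_cancel₀ Complex.I_ne_zero
      push_cast; linear_combination hn
    have := Complex.ofReal_injective this
    simp only
    field_simp
    linarith
  · convert countable_empty
    ext r
    simp only [mem_ofPred_eq, mem_empty_iff_false, iff_false]
    exact fun h => hne ⟨r, h⟩

def Wf (ω : ℝ) (P Q R : Polynomial ℂ) (x : ℂ) : ℂ :=
  P.eval x + Q.eval (Complex.exp (Complex.I * ω * x)) + R.eval (Complex.exp (-(Complex.I * ω * x)))

/-- asymptotics along a sequence -/
lemma quad_seq {ω : ℝ} (hω : 0 < ω) (P R : Polynomial ℂ) (hP : 0 < P.natDegree)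
    (s : ℝ) (hs : s ^ 2 = 1) (e0 : ℂ)
    (x : ℕ → ℂ) (hx : Tendsto x atTop (Bornology.cobounded ℂ)) (hy : ∀ j, 0 ≤ (x j).im)
    (hsx : ∀ j, 0 ≤ s * (x j).re) (C : ℝ)
    (hC : ∀ j, ‖P.eval (x j) + R.eval (Complex.exp (-(Complex.I * ω * x j)))‖ ≤ C)
    (he : ∀ j, Complex.exp (Complex.I * ((-(R.natDegree * ω * s) : ℝ) : ℂ) * (‖x j‖ : ℝ)) = e0) :
    0 < R.natDegree ∧ e0 = (s:ℂ) ^ P.natDegree * (-P.leadingCoeff / R.leadingCoeff) /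
      (‖-P.leadingCoeff / R.leadingCoeff‖ : ℝ) := by
  set ζ : ℕ → ℂ := fun j => Complex.exp (-(Complex.I * ω * x j)) with hζ
  set m := P.natDegree
  set k := R.natDegree with hk
  have hPd : 0 < P.degree := Polynomial.natDegree_pos_iff_degree_pos.1 hP
  have hPinf : Tendsto (fun j => P.eval (x j)) atTop (Bornology.cobounded ℂ) :=
    tendsto_norm_atTop_iff_cobounded.1
      (Polynomial.tendsto_norm_atTop P hPd (tendsto_norm_atTop_iff_cobounded.2 hx))
  have hratio : Tendsto (fun j => R.eval (ζ j) / P.eval (x j)) atTop (𝓝 (-1)) := by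
    have h1 : Tendsto (fun j => (P.eval (x j) + R.eval (ζ j)) / P.eval (x j)) atTop (𝓝 0) := by
      rw [tendsto_zero_iff_norm_tendsto_zero]
      have h2 : Tendsto (fun j => C / ‖P.eval (x j)‖) atTop (𝓝 0) :=
        Tendsto.const_div_atTop (tendsto_norm_atTop_iff_cobounded.2 hPinf) C
      refine squeeze_zero (fun _ => norm_nonneg _) (fun j => ?_) h2
      rw [norm_div]; gcongr; exact hC j
    have h3 := h1.sub_const 1
    rw [zero_sub] at h3
    refine h3.congr' ?_
    filter_upwards [hPinf ne0_cob] with j hj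
    have hj : P.eval (x j) ≠ 0 := hj
    field_simp; ring
  have hRinf : Tendsto (fun j => R.eval (ζ j)) atTop (Bornology.cobounded ℂ) := by
    rw [← tendsto_norm_atTop_iff_cobounded]
    refine tendsto_atTop_mono (f := fun j => ‖P.eval (x j)‖ - C) (fun j => ?_)
      (tendsto_atTop_add_const_right _ _ (tendsto_norm_atTop_iff_cobounded.2 hPinf))
    have := norm_sub_le (P.eval (x j) + R.eval (ζ j)) (R.eval (ζ j))
    rw [add_sub_cancel_right] at this
    linarith [hC j]
  have hζinf : Tendsto ζ atTop (Bornology.cobounded ℂ) := by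
    rw [Metric.cobounded_eq_cocompact] at hRinf ⊢
    exact (tendsto_comap_iff.2 hRinf).mono_right (comap_cocompact_le R.continuous)
  have hkpos : 0 < k := by
    by_contra h
    have h0 : R.natDegree = 0 := by omega
    rw [Polynomial.eq_C_of_natDegree_eq_zero h0] at hRinf
    simp only [Polynomial.eval_C] at hRinf
    exact not_tendsto_const_atTop _ _ (tendsto_norm_atTop_iff_cobounded.2 hRinf)
  refine ⟨hkpos, ?_⟩
  have hR0 : R.leadingCoeff ≠ 0 := by
    rw [Polynomial.leadingCoeff_ne_zero]; rintro rfl; simp at hk; omega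
  have hP0 : P.leadingCoeff ≠ 0 := by
    rw [Polynomial.leadingCoeff_ne_zero]; rintro rfl; simp at hPd
  set L := -P.leadingCoeff / R.leadingCoeff with hL
  have hL0 : L ≠ 0 := div_ne_zero (neg_ne_zero.2 hP0) hR0
  have hlim : Tendsto (fun j => ζ j ^ k / x j ^ m) atTop (𝓝 L) := by
    have h1 := ((((pl_lim R).comp hζinf).inv₀ hR0).mul hratio).mul ((pl_lim P).comp hx)
    have : L = R.leadingCoeff⁻¹ * (-1) * P.leadingCoeff := by rw [hL]; field_simp
    rw [this]
    refine h1.congr' ?_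
    filter_upwards [hPinf ne0_cob, hRinf ne0_cob] with j hj hj'
    have hj : P.eval (x j) ≠ 0 := hj
    have hj' : R.eval (ζ j) ≠ 0 := hj'
    simp only [Function.comp]
    field_simp
    rfl
  have hnorm : Tendsto (fun j => Real.exp (k * ω * (x j).im) / ‖x j‖ ^ m) atTop (𝓝 ‖L‖) := by
    refine hlim.norm.congr fun j => ?_
    rw [norm_div, norm_pow, norm_pow, hζ, Complex.norm_exp, ← Real.exp_nat_mul]
    congr 2
    simp; ring
  have hyinf : Tendsto (fun j => (x j).im) atTop atTop := by
    have h1 := tendsto_norm_atTop_iff_cobounded.2 hζinf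
    have h2 : Tendsto (fun j => Real.exp (ω * (x j).im)) atTop atTop := by
      refine h1.congr fun j => ?_
      rw [hζ, Complex.norm_exp]; simp
    have h3 := Real.tendsto_exp_atTop
    have h4 := Real.tendsto_log_atTop.comp h2
    simp only [Function.comp_def, Real.log_exp] at h4
    exact (tendsto_const_mul_atTop_of_pos hω).1 h4
  have hRr : Tendsto (fun j => ‖x j‖) atTop atTop := tendsto_norm_atTop_iff_cobounded.2 hx
  have hypow : Tendsto (fun j => ((x j).im ^ 2 / ‖x j‖) ^ m) atTop (𝓝 0) := by
    have hκ : (0:ℝ) < k * ω := by positivity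
    have h1 : Tendsto (fun j => ((k * ω) * (x j).im) ^ (2 * m) * Real.exp (-((k*ω) * (x j).im))) atTop (𝓝 0) :=
      (Real.tendsto_pow_mul_exp_neg_atTop_nhds_zero (2 * m)).comp (hyinf.const_mul_atTop hκ)
    have h2 := (h1.mul hnorm).mul_const (((k*ω) ^ (2*m))⁻¹)
    simp only [zero_mul] at h2
    refine h2.congr fun j => ?_
    rw [Real.exp_neg]
    have := (Real.exp_pos (k * ω * (x j).im)).ne'
    rw [mul_pow, div_pow, ← pow_mul]
    field_simp
  have hyR : Tendsto (fun j => (x j).im ^ 2 / ‖x j‖) atTop (𝓝 0) := by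
    have h1 : Tendsto (fun j => (((x j).im ^ 2 / ‖x j‖) ^ m) ^ ((m:ℝ)⁻¹)) atTop (𝓝 (0 ^ ((m:ℝ)⁻¹))) :=
      hypow.rpow_const (Or.inr (by positivity))
    rw [Real.zero_rpow (by positivity)] at h1
    refine h1.congr fun j => ?_
    exact Real.pow_rpow_inv_natCast (by positivity) hP.ne'
  have hinv : Tendsto (fun j => 1 / ‖x j‖) atTop (𝓝 0) := Tendsto.const_div_atTop hRr 1
  have hnsq : ∀ j, ‖x j‖ ^ 2 = (x j).re ^ 2 + (x j).im ^ 2 := fun j => by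
    rw [Complex.sq_norm, Complex.normSq_apply]; ring
  have hd : Tendsto (fun j => ‖x j‖ - s * (x j).re) atTop (𝓝 0) := by
    have hle : ∀ j, s * (x j).re ≤ ‖x j‖ := fun j => by
      apply abs_le_of_sq_le_sq' _ (norm_nonneg _) |>.2
      rw [mul_pow, hs, hnsq]; nlinarith [sq_nonneg (x j).im]
    refine squeeze_zero' (Eventually.of_forall fun j => sub_nonneg.2 (hle j)) ?_ hyR
    filter_upwards [hRr.eventually_gt_atTop 0] with j hj
    rw [le_div_iff₀ hj]
    have : (‖x j‖ - s * (x j).re) * (‖x j‖ + s * (x j).re) = (x j).im ^ 2 := by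
      have := hnsq j
      linear_combination this - (x j).re ^ 2 * hs
    nlinarith [hsx j, hle j, mul_nonneg (sub_nonneg.2 (hle j)) (hsx j)]
  have hyR1 : Tendsto (fun j => (x j).im / ‖x j‖) atTop (𝓝 0) := by
    have h1 := hyR.add hinv
    rw [add_zero] at h1
    refine squeeze_zero (fun j => div_nonneg (hy j) (norm_nonneg _)) (fun j => ?_) h1
    rw [← add_div]; gcongr; nlinarith [sq_nonneg ((x j).im - 1), hy j]
  have hxR : Tendsto (fun j => x j / (‖x j‖:ℂ)) atTop (𝓝 (s:ℂ)) := by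
    have h1 : Tendsto (fun j => s - s * ((‖x j‖ - s * (x j).re) * (1 / ‖x j‖))) atTop (𝓝 s) := by
      simpa using ((hd.mul hinv).const_mul s).const_sub s
    have h2 := (Complex.continuous_ofReal.tendsto _).comp h1
    have h3 := ((Complex.continuous_ofReal.tendsto _).comp hyR1).mul_const Complex.I
    have h4 := h2.add h3
    simp only [Complex.ofReal_zero, zero_mul, add_zero] at h4
    refine h4.congr' ?_
    filter_upwards [hRr.eventually_gt_atTop 0] with j hj
    have hj' : (‖x j‖:ℂ) ≠ 0 := by exact_mod_cast hj.ne'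
    have hs' : (s:ℂ) ^ 2 = 1 := by exact_mod_cast hs
    simp only [Function.comp]
    push_cast
    have hxx := Complex.re_add_im (x j)
    field_simp
    linear_combination (x j).re * hs' + hxx
  have hnL : ‖L‖ ≠ 0 := norm_ne_zero_iff.2 hL0
  have hph1 : Tendsto (fun j => Complex.exp (Complex.I * ((-(k * ω) : ℝ) : ℂ) * (x j).re)) atTop
      (𝓝 (L * (s:ℂ)^m / (‖L‖:ℝ))) := by
    have h1 := (hlim.mul (hxR.pow m)).div ((Complex.continuous_ofReal.tendsto _).comp hnorm)
      (by exact_mod_cast hnL)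
    refine h1.congr' ?_
    filter_upwards [hRr.eventually_gt_atTop 0] with j hj
    have hj' : (‖x j‖:ℂ) ≠ 0 := by exact_mod_cast hj.ne'
    have hx0 : x j ≠ 0 := norm_pos_iff.1 hj
    simp only [Function.comp, hζ, Pi.div_apply]
    push_cast
    have hexp := (Complex.exp_ne_zero (k * ω * (x j).im))
    rw [div_pow, ← Complex.exp_nat_mul]
    field_simp
    rw [← Complex.exp_add]
    congr 1
    conv_lhs => rw [← Complex.re_add_im (x j)]
    linear_combination (-(k:ℂ) * ω * (x j).im) * Complex.I_sq
  have hph2 : Tendsto (fun j => Complex.exp (Complex.I * ((-(k * ω) : ℝ) : ℂ) * (x j).re)) atTop (𝓝 e0) := by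
    have h1 : Tendsto (fun j => Complex.exp (Complex.I * (k * ω * s : ℝ) * ((‖x j‖ - s * (x j).re : ℝ):ℂ)) * e0) atTop (𝓝 e0) := by
      have hc : Continuous fun t : ℝ => Complex.exp (Complex.I * (k * ω * s : ℝ) * (t:ℂ)) * e0 := by fun_prop
      have := (hc.tendsto 0).comp hd
      simpa [Function.comp_def] using this
    refine h1.congr fun j => ?_
    rw [← he j, ← Complex.exp_add]
    congr 1
    have hs' : (s:ℂ) ^ 2 = 1 := by exact_mod_cast hs
    push_cast
    linear_combination (-Complex.I * k * ω * (x j).re) * hs'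
  rw [tendsto_nhds_unique hph2 hph1]; ring

lemma Wf_quad {ω : ℝ} (hω : 0 < ω) (P Q R : Polynomial ℂ) (hP : 0 < P.natDegree)
    (s : ℤ) (hs : s ^ 2 = 1) : ∃ B : Set ℝ, B.Countable ∧ ∀ r0 ∉ B, ∀ ρ : ℝ, ∀ᶠ N : ℕ in atTop,
      ∀ x : ℂ, ‖x‖ = r0 + N * (2 * Real.pi / ω) → 0 ≤ x.im → 0 ≤ (s:ℝ) * x.re → ρ < ‖Wf ω P Q R x‖ := by
  have hs' : ((s:ℝ)) ^ 2 = 1 := by exact_mod_cast hs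
  have hs0 : (s:ℝ) ≠ 0 := by rintro h; rw [h] at hs'; norm_num at hs'
  set u : ℂ := ((s:ℝ):ℂ) ^ P.natDegree * (-P.leadingCoeff / R.leadingCoeff) /
      (‖-P.leadingCoeff / R.leadingCoeff‖ : ℝ)
  refine ⟨{r : ℝ | 0 < R.natDegree ∧ Complex.exp (Complex.I * ((-(R.natDegree * ω * s) : ℝ) : ℂ) * r) = u}, ?_, ?_⟩
  · by_cases hk : 0 < R.natDegree
    · refine (exp_bad (-(R.natDegree * ω * s)) ?_ u).mono fun r hr => hr.2
      exact neg_ne_zero.2 (mul_ne_zero (mul_ne_zero (by positivity) hω.ne') hs0)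
    · convert countable_empty
      ext r
      simp only [mem_ofPred_eq, mem_empty_iff_false, iff_false]
      exact fun h => hk h.1
  · intro r0 hr0 ρ
    by_contra hcon
    rw [Filter.not_eventually, Filter.frequently_congr (q := fun N : ℕ => ∃ x : ℂ, ‖x‖ = r0 + N * (2 * Real.pi / ω) ∧
      0 ≤ x.im ∧ 0 ≤ (s:ℝ) * x.re ∧ ‖Wf ω P Q R x‖ ≤ ρ) (Eventually.of_forall fun N => by push Not; rfl)] at hcon
    obtain ⟨φ, hφ, hx⟩ := extraction_of_frequently_atTop hcon
    choose x h1 h2 h3 h4 using hx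
    have hxi : Tendsto x atTop (Bornology.cobounded ℂ) := by
      rw [← tendsto_norm_atTop_iff_cobounded]
      simp only [h1]
      refine tendsto_atTop_add_const_left _ _ (Tendsto.atTop_mul_const (by positivity) ?_)
      exact tendsto_natCast_atTop_atTop.comp hφ.tendsto_atTop
    obtain ⟨CQ, hCQ⟩ := (isCompact_closedBall (0:ℂ) 1).exists_bound_of_continuousOn Q.continuous.continuousOn
    have := quad_seq hω P R hP s hs' (Complex.exp (Complex.I * ((-(R.natDegree * ω * s) : ℝ) : ℂ) * r0))
      x hxi h2 h3 (ρ + CQ) ?_ ?_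
    · exact hr0 this
    · intro j
      have hq := hCQ (Complex.exp (Complex.I * ω * x j)) (by
        rw [mem_closedBall_zero_iff, Complex.norm_exp]
        simp
        exact mul_nonneg hω.le (h2 j))
      have h5 := h4 j
      rw [Wf] at h5
      have := norm_sub_le (Polynomial.eval (x j) P + Polynomial.eval (Complex.exp (Complex.I * ω * x j)) Q + Polynomial.eval (Complex.exp (-(Complex.I * ω * x j))) R) (Polynomial.eval (Complex.exp (Complex.I * ω * x j)) Q)
      rw [show ∀ a b c : ℂ, a + b + c - b = a + c by intros; ring] at this
      linarith
    · intro j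
      rw [h1, Complex.exp_eq_exp_iff_exists_int]
      refine ⟨-(R.natDegree * s * φ j), ?_⟩
      have : (ω:ℂ) ≠ 0 := by exact_mod_cast hω.ne'
      push_cast
      field_simp
      ring

lemma Wf_circ {ω : ℝ} (hω : 0 < ω) (P Q R : Polynomial ℂ) (hP : 0 < P.natDegree) (ρ R0 : ℝ) :
    ∃ R' > R0, ∀ x : ℂ, ‖x‖ = R' → ρ < ‖Wf ω P Q R x‖ := by
  have hN : 0 < (P.comp (-Polynomial.X)).natDegree := by
    rw [Polynomial.natDegree_comp]; simpa using hP
  obtain ⟨B1, hB1, h1⟩ := Wf_quad hω P Q R hP 1 (by norm_num)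
  obtain ⟨B2, hB2, h2⟩ := Wf_quad hω P Q R hP (-1) (by norm_num)
  obtain ⟨B3, hB3, h3⟩ := Wf_quad hω (P.comp (-Polynomial.X)) R Q hN 1 (by norm_num)
  obtain ⟨B4, hB4, h4⟩ := Wf_quad hω (P.comp (-Polynomial.X)) R Q hN (-1) (by norm_num)
  obtain ⟨r0, hr0⟩ := (Set.Countable.dense_compl ℝ (((hB1.union hB2).union hB3).union hB4)).nonempty
  simp only [mem_compl_iff, mem_union, not_or] at hr0
  have hinf : Tendsto (fun N : ℕ => r0 + N * (2 * Real.pi / ω)) atTop atTop :=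
    tendsto_atTop_add_const_left _ _ (Tendsto.atTop_mul_const (by positivity) tendsto_natCast_atTop_atTop)
  obtain ⟨N, ⟨⟨⟨h1, h2⟩, h3⟩, h4⟩, h5⟩ := ((((h1 r0 hr0.1.1.1 ρ).and (h2 r0 hr0.1.1.2 ρ)).and
    (h3 r0 hr0.1.2 ρ)).and (h4 r0 hr0.2 ρ)).and (hinf.eventually_gt_atTop R0) |>.exists
  refine ⟨_, h5, fun x hx => ?_⟩
  have hneg : Wf ω (P.comp (-Polynomial.X)) R Q (-x) = Wf ω P Q R x := by
    simp [Wf]; ring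
  rcases le_total 0 x.im with hi | hi <;> rcases le_total 0 x.re with hr | hr
  · exact h1 x hx hi (by simpa using hr)
  · exact h2 x hx hi (by simpa using hr)
  · rw [← hneg]; exact h4 (-x) (by simpa using hx) (by simpa using hi) (by simpa using hr)
  · rw [← hneg]; exact h3 (-x) (by simpa using hx) (by simpa using hi) (by simpa using hr)

section packD
variable {n : ℕ}

lemma unb_nc {V : Set ℂ} (hV : IsOpen V) (hVc : IsPreconnected V) {U : ℂ → ℂ} (hU : AnalyticOnNhd ℂ U V)
    (hub : ∀ M : ℝ, ∃ z ∈ V, M < ‖U z‖) {z : ℂ} (hz : z ∈ V) :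
    (∀ s, ¬ ∀ᶠ y in 𝓝 z, U y = s) ∧ ¬ ∀ᶠ y in 𝓝 z, deriv U y = 0 := by
  have h1 : ∀ s, ¬ ∀ᶠ y in 𝓝 z, U y = s := by
    intro s h
    obtain ⟨y, hy, hM⟩ := hub ‖s‖
    have := hU.eqOn_of_preconnected_of_eventuallyEq (g := fun _ => s) (fun _ _ => analyticAt_const) hVc hz h hy
    simp only at this
    rw [this] at hM
    exact lt_irrefl _ hM
  refine ⟨h1, fun h => h1 (U z) (const_of_deriv_zero ?_)⟩
  filter_upwards [h, hV.mem_nhds hz] with y hy hyV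
  rw [← hy]
  exact (hU y hyV).differentiableAt.hasDerivAt

structure JSys (f : Fin n → ℂ → ℂ) (Xm : Fin n → ℕ → ℕ → ℂ) (J : ℕ → ℕ → ℂ → ℂ) : Prop where
  d : ∀ d c, d < c → ∀ x, HasDerivAt (J d c)
      (∑ c' ∈ Finset.Ico d c, J d c' x * ∑ i, deriv (f i) x * Xm i c' c) x
  one : ∀ d x, J d d x = 1
  zero : ∀ d c, d < c → J d c 0 = 0

structure CompP (T : ℝ) (f : Fin n → ℂ → ℂ) (ξ : ℂ → ℂ) (F : Fin n → ℂ → ℂ) (lam : Fin n → ℂ) (ρ : ℝ)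
    (X K : Set ℂ) (fib : ℂ → Multiset ℂ) : Prop where
  fs : FibS X K (fun z => ∑ i, lam i * F i z) ρ fib
  an : ∀ i, AnalyticOnNhd ℂ (F i) K
  mem : ∀ x ∈ Metric.ball (0:ℂ) (2*T), ξ x ∈ X
  nc : ∀ s, ¬ ∀ᶠ x in 𝓝 (0:ℂ), ∑ i, lam i * F i (ξ x) = s
  dU : ∀ z ∈ K, ¬ ∀ᶠ y in 𝓝 z, deriv (fun z => ∑ i, lam i * F i z) y = 0
  hH : ∀ (Xm : Fin n → ℕ → ℕ → ℂ) (J : ℕ → ℕ → ℂ → ℂ) (a b : ℕ), a < b → JSys f Xm J →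
    (∀ c, a < c → c < b → J a c T = 0) → ∃ H : ℕ → ℂ → ℂ, (∀ z, H a z = 1) ∧
    (∀ c ∈ Finset.Ico a b, ∀ z ∈ X, HasDerivAt (H c)
      (∑ c' ∈ Finset.Ico a c, H c' z * ∑ i, deriv (F i) z * Xm i c' c) z) ∧
    (∀ π : Polynomial ℂ, π ≠ 0 → ∃ Φ ψ : ℂ → ℂ, AnalyticOnNhd ℂ Φ K ∧
      AnalyticOnNhd ℂ ψ K ∧ ∀ z ∈ X, HasDerivAt Φ
      (∑ c ∈ Finset.Ico a b, H c z * ∑ i, deriv (F i) z * Xm i c b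
        - ψ z * π.eval (∑ i, lam i * F i z) * deriv (fun z => ∑ i, lam i * F i z) z) z)

def GoodD (T : ℝ) (f : Fin n → ℂ → ℂ) : Prop :=
  ∃ (ξ : ℂ → ℂ) (F : Fin n → ℂ → ℂ) (S : Finset (Fin n → ℂ)), (∀ x, AnalyticAt ℂ ξ x) ∧
    (∀ i x, F i (ξ x) = f i x) ∧ (∀ d ∈ S, d ≠ 0) ∧
    ∀ lam : Fin n → ℂ, (∀ d ∈ S, ∑ i, lam i * d i ≠ 0) → ∀ ρ : ℝ, 0 < ρ →
      ∃ X K fib, CompP T f ξ F lam ρ X K fib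

def linP (lam : Fin n → ℂ) (P : Fin n → Polynomial ℂ) : Polynomial ℂ := ∑ i, Polynomial.C (lam i) * P i

lemma linP_eval (lam : Fin n → ℂ) (P : Fin n → Polynomial ℂ) (z : ℂ) :
    (linP lam P).eval z = ∑ i, lam i * (P i).eval z := by
  simp [linP, Polynomial.eval_finsetSum]

lemma linP_deg (lam : Fin n → ℂ) (P : Fin n → Polynomial ℂ) (i0 : Fin n) (h0 : 0 < (P i0).natDegree)
    (h : ∑ i, lam i * (P i).coeff (P i0).natDegree ≠ 0) : 0 < (linP lam P).natDegree := by
  refine h0.trans_le (Polynomial.le_natDegree_of_ne_zero ?_)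
  simpa [linP, Polynomial.finsetSum_coeff] using h

lemma Wf_lin (ω : ℝ) (lam : Fin n → ℂ) (P Q R : Fin n → Polynomial ℂ) (z : ℂ) :
    ∑ i, lam i * Wf ω (P i) (Q i) (R i) z = Wf ω (linP lam P) (linP lam Q) (linP lam R) z := by
  simp [Wf, linP_eval, mul_add, Finset.sum_add_distrib]

lemma Wf_diff (ω : ℝ) (P Q R : Polynomial ℂ) : Differentiable ℂ (Wf ω P Q R) := by
  unfold Wf
  have h1 := P.differentiable
  have h2 : Differentiable ℂ fun x : ℂ => Q.eval (Complex.exp (Complex.I * ω * x)) :=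
    Q.differentiable.comp (by fun_prop)
  have h3 : Differentiable ℂ fun x : ℂ => R.eval (Complex.exp (-(Complex.I * ω * x))) :=
    R.differentiable.comp (by fun_prop)
  exact (h1.add h2).add h3

lemma coeffv_ne (P : Fin n → Polynomial ℂ) (i0 : Fin n) (h0 : 0 < (P i0).natDegree) :
    (fun i => (P i).coeff (P i0).natDegree) ≠ 0 := by
  intro h
  have := congrFun h i0
  simp only [Pi.zero_apply, Polynomial.coeff_natDegree, Polynomial.leadingCoeff_eq_zero] at this
  simp [this] at h0

lemma goodB {T ω : ℝ} (hω : 0 < ω) (P Q R : Fin n → Polynomial ℂ) (i0 : Fin n)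
    (h0 : 0 < (P i0).natDegree) : GoodD T (fun i => Wf ω (P i) (Q i) (R i)) := by
  refine ⟨id, fun i => Wf ω (P i) (Q i) (R i), {fun i => (P i).coeff (P i0).natDegree}, fun x => analyticAt_id,
    fun _ _ => rfl, ?_, ?_⟩
  · simp only [Finset.mem_singleton, forall_eq]; exact coeffv_ne P i0 h0
  intro lam hlam ρ hρ
  simp only [Finset.mem_singleton, forall_eq] at hlam
  have hd := linP_deg lam P i0 h0 hlam
  set U := fun z => ∑ i, lam i * Wf ω (P i) (Q i) (R i) z with hU
  have hUe : U = Wf ω (linP lam P) (linP lam Q) (linP lam R) := funext fun z => Wf_lin ω lam P Q R z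
  have hUd : Differentiable ℂ U := by rw [hUe]; exact Wf_diff _ _ _ _
  have hUa : ∀ S, AnalyticOnNhd ℂ U S := fun S z _ => hUd.analyticAt z
  have hub : ∀ M : ℝ, ∃ z ∈ (univ : Set ℂ), M < ‖U z‖ := by
    intro M
    obtain ⟨R', h1, h2⟩ := Wf_circ hω (linP lam P) (linP lam Q) (linP lam R) hd M 0
    refine ⟨R', mem_univ _, ?_⟩
    rw [hUe]; exact h2 _ (by rw [Complex.norm_real, Real.norm_of_nonneg h1.le])
  have hnc := fun z => unb_nc isOpen_univ isPreconnected_univ (hUa univ) hub (mem_univ z)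
  obtain ⟨R', h1, h2⟩ := Wf_circ hω (linP lam P) (linP lam Q) (linP lam R) hd ρ (max 1 (2 * T))
  have hR' : 0 < R' := lt_of_lt_of_le one_pos ((le_max_left _ _).trans h1.le)
  obtain ⟨fib, hfib⟩ := (isCtr_ball hR').fibS hρ (hUa _) (by
    intro z hz
    rw [hUe]
    refine (h2 z ?_).le
    have h3 := hz.1; have h4 := hz.2
    simp only [mem_closedBall_zero_iff, mem_ball_zero_iff, not_lt] at h3 h4
    exact le_antisymm h3 h4) (fun z _ s => (hnc z).1 s)
  refine ⟨_, _, fib, hfib, fun i z _ => (Wf_diff _ _ _ _).analyticAt z, ?_, fun s => (hnc 0).1 s, fun z _ => (hnc z).2, ?_⟩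
  · intro x hx
    exact Metric.ball_subset_ball ((le_max_right 1 _).trans h1.le) hx
  · intro Xm J a b hab hJ _
    refine ⟨fun c => J a c, hJ.one a, ?_, ?_⟩
    · intro c hc z _
      rcases (Finset.mem_Ico.1 hc).1.eq_or_lt with h | h
      · subst h
        have : J a a = fun _ => 1 := funext (hJ.one a)
        simp only [Finset.Ico_self, Finset.sum_empty]
        rw [this]; exact hasDerivAt_const _ _
      · exact hJ.d a c h z
    · intro π _
      refine ⟨J a b, fun _ => 0, fun z _ => ?_, fun z _ => analyticAt_const, fun z _ => ?_⟩
      · exact Differentiable.analyticAt (fun x => (hJ.d a b hab x).differentiableAt) z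
      · simp only [zero_mul, sub_zero]
        exact hJ.d a b hab z
end packD

def IsLau (g : ℂ → ℂ) : Prop := ∃ (N : ℕ) (p : Polynomial ℂ), ∀ z, z ≠ 0 → g z = p.eval z / z ^ N

lemma IsLau.add {f g : ℂ → ℂ} (hf : IsLau f) (hg : IsLau g) : IsLau (fun z => f z + g z) := by
  obtain ⟨N, p, hp⟩ := hf
  obtain ⟨M, q, hq⟩ := hg
  refine ⟨N + M, p * Polynomial.X ^ M + q * Polynomial.X ^ N, fun z hz => ?_⟩
  simp only [hp z hz, hq z hz]; simp; field_simp; ring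

lemma IsLau.mul {f g : ℂ → ℂ} (hf : IsLau f) (hg : IsLau g) : IsLau (fun z => f z * g z) := by
  obtain ⟨N, p, hp⟩ := hf
  obtain ⟨M, q, hq⟩ := hg
  refine ⟨N + M, p * q, fun z hz => ?_⟩
  simp only [hp z hz, hq z hz]; simp; field_simp; ring

lemma IsLau.poly (p : Polynomial ℂ) : IsLau (fun z => p.eval z) := ⟨0, p, fun z _ => by simp⟩

lemma IsLau.const (c : ℂ) : IsLau (fun _ => c) := by simpa using IsLau.poly (Polynomial.C c)

lemma IsLau.sum {A : Type*} (S : Finset A) (f : A → ℂ → ℂ) (h : ∀ s ∈ S, IsLau (f s)) :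
    IsLau (fun z => ∑ s ∈ S, f s z) := by
  classical
  induction S using Finset.induction_on with
  | empty => simpa using IsLau.const 0
  | insert a S ha ih =>
    simp only [Finset.sum_insert ha]
    exact (h a (by simp)).add (ih fun s hs => h s (by simp [hs]))

lemma IsLau.pinv (p : Polynomial ℂ) : IsLau (fun z => p.eval z⁻¹) := by
  simp only [Polynomial.eval_eq_sum_range]
  refine IsLau.sum _ _ fun j _ => (IsLau.const _).mul ⟨j, 1, fun z _ => by simp⟩

lemma IsLau.peval (p : Polynomial ℂ) {f : ℂ → ℂ} (hf : IsLau f) : IsLau (fun z => p.eval (f z)) := by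
  simp only [Polynomial.eval_eq_sum_range]
  refine IsLau.sum _ _ fun j hj => (IsLau.const _).mul ?_
  clear hj
  induction j with
  | zero => simpa using IsLau.const 1
  | succ j ih => simp only [pow_succ]; exact ih.mul hf

lemma IsLau.an {f : ℂ → ℂ} (hf : IsLau f) {z : ℂ} (hz : z ≠ 0) : AnalyticAt ℂ f z := by
  obtain ⟨N, p, hp⟩ := hf
  refine AnalyticAt.congr (f := fun z => p.eval z / z ^ N) ?_ ?_
  · exact (p.differentiable.analyticAt z).div (by fun_prop) (pow_ne_zero _ hz)
  · filter_upwards [isOpen_ne.mem_nhds hz] with y hy using (hp y hy).symm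

lemma IsLau.deriv {f : ℂ → ℂ} (hf : IsLau f) : IsLau (deriv f) := by
  obtain ⟨N, p, hp⟩ := hf
  refine ⟨N + 1, Polynomial.X * p.derivative - Polynomial.C (N:ℂ) * p, fun z hz => ?_⟩
  have h1 : f =ᶠ[𝓝 z] fun z => p.eval z / z ^ N := by
    filter_upwards [isOpen_ne.mem_nhds hz] with y hy using hp y hy
  rw [h1.deriv_eq, ((p.hasDerivAt z).fun_div (hasDerivAt_pow N z) (pow_ne_zero _ hz)).deriv]
  cases N with
  | zero => simp; field_simp
  | succ N => simp; field_simp; ring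

lemma lau_prim (p : Polynomial ℂ) (M : ℕ) : ∃ G, IsLau G ∧ ∀ z, z ≠ 0 →
    HasDerivAt G (p.eval z / z ^ (M + 1) - p.coeff M / z) z := by
  set c : ℕ → ℂ := fun j => if j = M then 0 else p.coeff j / ((j:ℂ) - M) with hc
  refine ⟨fun z => ∑ j ∈ Finset.range (p.natDegree + 1), c j * (z ^ (j + 1) / z ^ (M + 1)), ?_, ?_⟩
  · exact IsLau.sum _ _ fun j _ => (IsLau.const _).mul ⟨M + 1, Polynomial.X ^ (j + 1), fun z _ => by simp⟩
  · intro z hz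
    have h1 : ∀ j, HasDerivAt (fun z : ℂ => c j * (z ^ (j + 1) / z ^ (M + 1)))
        (c j * (((j:ℂ) - M) * z ^ j / z ^ (M + 1))) z := by
      intro j
      refine HasDerivAt.const_mul _ ?_
      have := (hasDerivAt_pow (j + 1) z).fun_div (hasDerivAt_pow (M + 1) z) (pow_ne_zero _ hz)
      convert this using 1
      simp only [Nat.add_sub_cancel]; push_cast
      field_simp; ring
    have h2 := HasDerivAt.fun_sum (u := Finset.range (p.natDegree + 1)) fun j _ => h1 j
    refine h2.congr_deriv ?_
    symm
    rw [Polynomial.eval_eq_sum_range, Finset.sum_div]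
    have h3 : p.coeff M / z = ∑ j ∈ Finset.range (p.natDegree + 1), if j = M then p.coeff j * z ^ j / z ^ (M + 1) else 0 := by
      rw [Finset.sum_ite_eq']
      split_ifs with h
      · field_simp; ring
      · rw [Polynomial.coeff_eq_zero_of_natDegree_lt (by simpa using h)]; simp
    rw [h3, ← Finset.sum_sub_distrib]
    refine Finset.sum_congr rfl fun j _ => ?_
    simp only [hc]
    split_ifs with h
    · simp
    · have : (j:ℂ) - M ≠ 0 := sub_ne_zero.2 (by exact_mod_cast h)
      field_simp; simp

lemma IsLau.prim {f : ℂ → ℂ} (hf : IsLau f) : ∃ G r, IsLau G ∧ ∀ z, z ≠ 0 → HasDerivAt G (f z - r / z) z := by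
  obtain ⟨N, p, hp⟩ := hf
  obtain ⟨G, hG, h⟩ := lau_prim (p * Polynomial.X) N
  refine ⟨G, (p * Polynomial.X).coeff N, hG, fun z hz => (h z hz).congr_deriv ?_⟩
  rw [hp z hz]; simp; field_simp; ring

lemma lau_big (c : ℂ) (Q R : Polynomial ℂ) (hQ : 0 < Q.natDegree) (ρ : ℝ) :
    ∃ R0 : ℝ, ∀ z : ℂ, R0 ≤ ‖z‖ → ρ < ‖c + Q.eval z + R.eval z⁻¹‖ := by
  have h1 : Tendsto (fun z => ‖Q.eval z‖) (Bornology.cobounded ℂ) atTop :=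
    Polynomial.tendsto_norm_atTop Q (Polynomial.natDegree_pos_iff_degree_pos.1 hQ) tendsto_norm_cobounded_atTop
  have h2 : Tendsto (fun z : ℂ => ‖c + R.eval z⁻¹‖) (Bornology.cobounded ℂ) (𝓝 ‖c + R.eval 0‖) :=
    (((R.continuous.tendsto 0).comp (Filter.tendsto_inv₀_cobounded (α := ℂ))).const_add c).norm
  have h3 := (h1.eventually_gt_atTop (ρ + (‖c + R.eval 0‖ + 1))).and (h2.eventually (gt_mem_nhds (lt_add_one _)))
  obtain ⟨r, -, hr⟩ := (hasBasis_cobounded_norm.eventually_iff).1 h3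
  refine ⟨r, fun z hz => ?_⟩
  have h4 := hr hz
  have h5 := norm_sub_le (c + Q.eval z + R.eval z⁻¹) (c + R.eval z⁻¹)
  rw [show ∀ a b d : ℂ, a + b + d - (a + d) = b by intros; ring] at h5
  linarith [h4.1, h4.2]

section packD4
variable {n : ℕ}

/-- Laurent descent of `J`. -/
lemma lau_J {T ω : ℝ} (hT : 0 < T) (hω : 0 < ω) (hωT : ω * T = 2 * Real.pi) (f F : Fin n → ℂ → ℂ)
    (hF : ∀ i, IsLau (F i)) (hf : ∀ i x, F i (Complex.exp (Complex.I * ω * x)) = f i x)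
    (Xm : Fin n → ℕ → ℕ → ℂ) (J : ℕ → ℕ → ℂ → ℂ) (hJ : JSys f Xm J) (a b : ℕ)
    (h0 : ∀ c, a < c → c < b → J a c T = 0) (c : ℕ) (hac : a ≤ c) (hcb : c < b) :
    ∃ h, IsLau h ∧ (c = a → h = fun _ => 1) ∧ ∀ x, h (Complex.exp (Complex.I * ω * x)) = J a c x := by
  induction c using Nat.strong_induction_on with
  | _ c ih =>
  rcases hac.eq_or_lt with rfl | hlt
  · exact ⟨fun _ => 1, IsLau.const 1, fun _ => rfl, fun x => (hJ.one a x).symm⟩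
  have hex : ∀ c', ∃ h : ℂ → ℂ, c' ∈ Finset.Ico a c → IsLau h ∧ ∀ x, h (Complex.exp (Complex.I * ω * x)) = J a c' x := by
    intro c'
    by_cases hc' : c' ∈ Finset.Ico a c
    · have h1 := Finset.mem_Ico.1 hc'
      obtain ⟨h, hh, -, hh'⟩ := ih c' h1.2 h1.1 (h1.2.trans hcb)
      exact ⟨h, fun _ => ⟨hh, hh'⟩⟩
    · exact ⟨0, fun h => absurd h hc'⟩
  choose h hh using hex
  obtain ⟨G, r, hG, hGd⟩ := (IsLau.sum (Finset.Ico a c) (fun c' z => h c' z * ∑ i, deriv (F i) z * Xm i c' c)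
    (fun c' hc' => (hh c' hc').1.mul (IsLau.sum _ _ fun i _ => (hF i).deriv.mul (IsLau.const _)))).prim
  have hξ : ∀ x : ℂ, HasDerivAt (fun x : ℂ => Complex.exp (Complex.I * ω * x))
      (Complex.I * ω * Complex.exp (Complex.I * ω * x)) x := by
    intro x
    have := ((hasDerivAt_id x).const_mul (Complex.I * ω)).cexp
    simp only [id, mul_one] at this
    exact this.congr_deriv (mul_comm _ _)
  have hfd : ∀ i x, deriv (f i) x = deriv (F i) (Complex.exp (Complex.I * ω * x)) *
      (Complex.I * ω * Complex.exp (Complex.I * ω * x)) := by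
    intro i x
    rw [← (((hF i).an (Complex.exp_ne_zero (Complex.I * ω * x))).differentiableAt.hasDerivAt.comp x (hξ x)).deriv]
    congr 1
    funext y
    exact (hf i y).symm
  have hconst : ∀ x, J a c x - G (Complex.exp (Complex.I * ω * x)) - r * (Complex.I * ω * x) =
      J a c 0 - G (Complex.exp (Complex.I * ω * 0)) - r * (Complex.I * ω * 0) := by
    have hd : ∀ x, HasDerivAt (fun x => J a c x - G (Complex.exp (Complex.I * ω * x)) - r * (Complex.I * ω * x)) 0 x := by
      intro x
      have h1 := ((hJ.d a c hlt x).sub ((hGd _ (Complex.exp_ne_zero (Complex.I * ω * x))).comp x (hξ x))).sub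
        (((hasDerivAt_id x).const_mul (Complex.I * ω)).const_mul r)
      refine h1.congr_deriv ?_
      have he := Complex.exp_ne_zero (Complex.I * ω * x)
      rw [sub_mul, Finset.sum_mul, sub_sub, sub_eq_zero]
      have : ∀ c' ∈ Finset.Ico a c, J a c' x * ∑ i, deriv (f i) x * Xm i c' c =
          h c' (Complex.exp (Complex.I * ω * x)) * (∑ i, deriv (F i) (Complex.exp (Complex.I * ω * x)) * Xm i c' c)
           * (Complex.I * ω * Complex.exp (Complex.I * ω * x)) := by
        intro c' hc'
        rw [(hh c' hc').2 x, mul_assoc, Finset.sum_mul]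
        congr 1
        refine Finset.sum_congr rfl fun i _ => ?_
        rw [hfd]; ring
      have hr' : r / Complex.exp (Complex.I * ω * x) * (Complex.I * ω * Complex.exp (Complex.I * ω * x)) =
          r * (Complex.I * ω * 1) := by field_simp
      rw [Finset.sum_congr rfl this, hr', sub_add_cancel]
    intro x
    exact is_const_of_deriv_eq_zero (fun x => (hd x).differentiableAt) (fun x => (hd x).deriv) x 0
  have hT1 : Complex.exp (Complex.I * ω * T) = 1 := by
    have : Complex.I * ω * T = 2 * Real.pi * Complex.I := by
      have : (ω:ℂ) * T = 2 * Real.pi := by exact_mod_cast hωT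
      linear_combination Complex.I * this
    rw [this, Complex.exp_two_pi_mul_I]
  have hr : r = 0 := by
    have := hconst T
    rw [h0 c hlt hcb, hJ.zero a c hlt, hT1] at this
    simp only [mul_zero, Complex.exp_zero, sub_zero, zero_sub] at this
    have h2 : r * (Complex.I * ω * T) = 0 := by linear_combination -this
    have hT' : (T:ℂ) ≠ 0 := by exact_mod_cast hT.ne'
    have hω' : (ω:ℂ) ≠ 0 := by exact_mod_cast hω.ne'
    simpa [hT', hω'] using h2
  refine ⟨fun z => G z + -G 1, hG.add (IsLau.const _), fun h => absurd h hlt.ne', fun x => ?_⟩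
  have := hconst x
  rw [hr, hJ.zero a c hlt] at this
  simp only [zero_mul, sub_zero, mul_zero, Complex.exp_zero] at this
  linear_combination -this

lemma goodL {T ω : ℝ} (hT : 0 < T) (hω : 0 < ω) (hωT : ω * T = 2 * Real.pi) (P Q R : Fin n → Polynomial ℂ)
    (hP : ∀ i, (P i).natDegree = 0) (iQ iR : Fin n)
    (hQ : 0 < (Q iQ).natDegree) (hR : 0 < (R iR).natDegree) : GoodD T (fun i => Wf ω (P i) (Q i) (R i)) := by
  set F : Fin n → ℂ → ℂ := fun i z => (P i).coeff 0 + (Q i).eval z + (R i).eval z⁻¹ with hF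
  have hFl : ∀ i, IsLau (F i) := fun i => ((IsLau.const _).add (IsLau.poly _)).add (IsLau.pinv _)
  have hFf : ∀ i x, F i (Complex.exp (Complex.I * ω * x)) = Wf ω (P i) (Q i) (R i) x := by
    intro i x
    simp only [hF, Wf, ← Complex.exp_neg]
    congr 2
    conv_rhs => rw [Polynomial.eq_C_of_natDegree_eq_zero (hP i)]
    simp
  refine ⟨fun x => Complex.exp (Complex.I * ω * x), F, {fun i => (Q i).coeff (Q iQ).natDegree,
    fun i => (R i).coeff (R iR).natDegree}, fun x => by fun_prop, hFf, ?_, ?_⟩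
  · intro d hd
    rcases Finset.mem_insert.1 hd with rfl | hd
    · exact coeffv_ne Q iQ hQ
    · rw [Finset.mem_singleton.1 hd]; exact coeffv_ne R iR hR
  intro lam hlam ρ hρ
  have hdQ := linP_deg lam Q iQ hQ (hlam _ (by simp))
  have hdR := linP_deg lam R iR hR (hlam _ (by simp))
  set c0 := ∑ i, lam i * (P i).coeff 0
  set U := fun z => ∑ i, lam i * F i z with hU
  have hUe : ∀ z, U z = c0 + (linP lam Q).eval z + (linP lam R).eval z⁻¹ := by
    intro z
    simp [hU, hF, linP_eval, mul_add, Finset.sum_add_distrib, c0]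
  have hUl : IsLau U := IsLau.sum _ _ fun i _ => (IsLau.const _).mul (hFl i)
  have hbig1 := lau_big c0 (linP lam Q) (linP lam R) hdQ
  have hbig2 := lau_big c0 (linP lam R) (linP lam Q) hdR
  have hVo : IsOpen ({0}ᶜ : Set ℂ) := isOpen_compl_singleton
  have hVc : IsPreconnected ({0}ᶜ : Set ℂ) :=
    (isConnected_compl_singleton_of_one_lt_rank (by simp) (0:ℂ)).isPreconnected
  have hUa : AnalyticOnNhd ℂ U {0}ᶜ := fun z hz => hUl.an hz
  have hub : ∀ M : ℝ, ∃ z ∈ ({0}ᶜ : Set ℂ), M < ‖U z‖ := by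
    intro M
    obtain ⟨R0, hR0⟩ := hbig1 M
    refine ⟨((max R0 1 : ℝ) : ℂ), ?_, ?_⟩
    · have : max R0 1 ≠ 0 := by positivity
      simpa using this
    · rw [hUe]
      refine hR0 _ ?_
      rw [Complex.norm_real, Real.norm_of_nonneg (by positivity)]
      exact le_max_left _ _
  have hnc := fun z (hz : z ∈ ({0}ᶜ : Set ℂ)) => unb_nc hVo hVc hUa hub hz
  obtain ⟨R1, hR1⟩ := hbig1 ρ
  obtain ⟨R2, hR2⟩ := hbig2 ρ
  set E := Real.exp (ω * (2 * T)) with hE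
  have hE1 : 1 < E := Real.one_lt_exp_iff.2 (by positivity)
  set Rb := max R1 E
  set rb := (max R2 E)⁻¹ with hrb
  have hRb1 : 1 < Rb := hE1.trans_le (le_max_right _ _)
  have hRb2 : 1 < max R2 E := hE1.trans_le (le_max_right _ _)
  have hrb0 : 0 < rb := by positivity
  have hrbR : rb < Rb := (inv_lt_one_of_one_lt₀ hRb2).trans hRb1
  have hK0 : ∀ z ∈ Metric.closedBall (0:ℂ) Rb \ Metric.ball 0 rb, z ≠ 0 := by
    rintro z ⟨-, hz⟩ rfl
    exact hz (Metric.mem_ball_self hrb0)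
  have hX0 : ∀ z ∈ Metric.ball (0:ℂ) Rb \ Metric.closedBall 0 rb, z ≠ 0 := by
    rintro z ⟨-, hz⟩ rfl
    exact hz (Metric.mem_closedBall_self hrb0.le)
  obtain ⟨fib, hfib⟩ := (isCtr_ann hrb0 hrbR).fibS (U := U) hρ (fun z hz => hUa z (hK0 z hz)) (by
    rintro z ⟨hz, hz2⟩
    have hz0 := hK0 z hz
    rw [Set.mem_sdiff, not_and_not_right] at hz2
    rw [hUe]
    by_cases h : z ∈ Metric.ball (0:ℂ) Rb
    · have h3 := hz2 h
      rw [mem_closedBall_zero_iff] at h3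
      have h4 := (hR2 z⁻¹ (by
        rw [norm_inv]
        refine (le_max_left R2 E).trans ?_
        rw [le_inv_comm₀ (by positivity) (norm_pos_iff.2 hz0)]
        exact h3)).le
      rw [inv_inv, add_right_comm] at h4
      exact h4
    · rw [mem_ball_zero_iff, not_lt] at h
      exact (hR1 z ((le_max_left _ _).trans h)).le) (fun z hz s => (hnc z (hX0 z hz)).1 s)
  refine ⟨_, _, fib, hfib, fun i z hz => (hFl i).an (hK0 z hz), ?_, ?_, fun z hz => (hnc z (hK0 z hz)).2, ?_⟩
  · intro x hx
    rw [mem_ball_zero_iff] at hx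
    have him := (abs_le.1 ((Complex.abs_im_le_norm x)))
    have hn : ‖Complex.exp (Complex.I * ω * x)‖ = Real.exp (-(ω * x.im)) := by
      rw [Complex.norm_exp]; simp
    refine ⟨?_, ?_⟩
    · rw [mem_ball_zero_iff, hn]
      refine lt_of_lt_of_le (Real.exp_lt_exp.2 ?_) (le_max_right _ _)
      nlinarith
    · rw [mem_closedBall_zero_iff, hn, not_le, Real.exp_neg]
      refine inv_strictAnti₀ (Real.exp_pos _) (lt_of_lt_of_le (Real.exp_lt_exp.2 ?_) (le_max_right _ _))
      nlinarith
  · intro s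
    refine (unb_nc (U := fun x => U (Complex.exp (Complex.I * ω * x))) isOpen_univ isPreconnected_univ ?_ ?_ (mem_univ 0)).1 s
    · intro x _
      exact AnalyticAt.fun_comp (hUl.an (Complex.exp_ne_zero _)) (by fun_prop)
    · intro M
      obtain ⟨z, hz, hM⟩ := hub M
      have hω' : (ω:ℂ) ≠ 0 := by exact_mod_cast hω.ne'
      refine ⟨Complex.log z / (Complex.I * ω), mem_univ _, ?_⟩
      rwa [mul_div_cancel₀ _ (mul_ne_zero Complex.I_ne_zero hω'), Complex.exp_log hz]
  · intro Xm J a b hab hJ h0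
    have hl := fun c => lau_J hT hω hωT _ F hFl hFf Xm J hJ a b h0 c
    have hex : ∀ c, ∃ h : ℂ → ℂ, a ≤ c → c < b → IsLau h ∧ (c = a → h = fun _ => 1) ∧
        ∀ x, h (Complex.exp (Complex.I * ω * x)) = J a c x := by
      intro c
      by_cases h : a ≤ c ∧ c < b
      · obtain ⟨g, hg⟩ := hl c h.1 h.2
        exact ⟨g, fun _ _ => hg⟩
      · exact ⟨0, fun h1 h2 => absurd ⟨h1, h2⟩ h⟩
    choose H hH using hex
    have hgl : ∀ c ≤ b, IsLau (fun z => ∑ c' ∈ Finset.Ico a c, H c' z * ∑ i, deriv (F i) z * Xm i c' c) := by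
      intro c hc
      refine IsLau.sum _ _ fun c' hc' => IsLau.mul ?_ (IsLau.sum _ _ fun i _ => (hFl i).deriv.mul (IsLau.const _))
      have := Finset.mem_Ico.1 hc'
      exact (hH c' this.1 (by omega)).1
    refine ⟨H, fun z => by rw [(hH a le_rfl hab).2.1 rfl], ?_, ?_⟩
    · intro c hc z hz
      have hz0 := hX0 z hz
      obtain ⟨hc1, hc2⟩ := Finset.mem_Ico.1 hc
      rcases hc1.eq_or_lt with rfl | hlt
      · rw [(hH a le_rfl hab).2.1 rfl]; simpa using hasDerivAt_const z (1:ℂ)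
      have hω' : (ω:ℂ) ≠ 0 := by exact_mod_cast hω.ne'
      obtain ⟨x, rfl⟩ : ∃ x : ℂ, Complex.exp (Complex.I * ω * x) = z :=
        ⟨Complex.log z / (Complex.I * ω), by
          rw [mul_div_cancel₀ _ (mul_ne_zero Complex.I_ne_zero hω'), Complex.exp_log hz0]⟩
      have hξ : HasDerivAt (fun x : ℂ => Complex.exp (Complex.I * ω * x))
          (Complex.I * ω * Complex.exp (Complex.I * ω * x)) x := by
        have := ((hasDerivAt_id x).const_mul (Complex.I * ω)).cexp
        simp only [id, mul_one] at this
        exact this.congr_deriv (mul_comm _ _)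
      have h1 := ((hH c hc1 hc2).1.an hz0).differentiableAt.hasDerivAt
      have h2 := h1.comp x hξ
      have h3 : H c ∘ (fun x : ℂ => Complex.exp (Complex.I * ω * x)) = J a c := funext (hH c hc1 hc2).2.2
      rw [h3] at h2
      have h4 := h2.unique (hJ.d a c hlt x)
      refine h1.congr_deriv ?_
      apply mul_right_cancel₀ (mul_ne_zero (mul_ne_zero Complex.I_ne_zero hω') hz0)
      rw [h4, Finset.sum_mul]
      refine Finset.sum_congr rfl fun c' hc' => ?_
      have hc'' := Finset.mem_Ico.1 hc'
      rw [(hH c' hc''.1 (by omega)).2.2, mul_assoc, Finset.sum_mul]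
      congr 1
      refine Finset.sum_congr rfl fun i _ => ?_
      have hfd : deriv (Wf ω (P i) (Q i) (R i)) x = deriv (F i) (Complex.exp (Complex.I * ω * x)) *
          (Complex.I * ω * Complex.exp (Complex.I * ω * x)) := by
        rw [← (((hFl i).an hz0).differentiableAt.hasDerivAt.comp x hξ).deriv]
        congr 1
        funext y
        exact (hFf i y).symm
      rw [hfd]; ring
    · intro π hπ
      have hVl : IsLau (fun z => π.eval (U z) * deriv U z) := (IsLau.peval π hUl).mul hUl.deriv
      obtain ⟨N, p, hp⟩ := hVl
      have hp0 : p ≠ 0 := by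
        rintro rfl
        have hz0 : ∀ z ∈ ({0}ᶜ : Set ℂ), π.eval (U z) * deriv U z = 0 := fun z hz => by
          have := hp z hz; simpa using this
        have hA : AnalyticOnNhd ℂ (fun z => π.eval (U z)) {0}ᶜ := fun z hz => (IsLau.peval π hUl).an hz
        rcases hA.eq_zero_or_eq_zero_of_mul_eq_zero hUa.deriv hz0 hVc with h | h
        · obtain ⟨z, hz, hM⟩ := hub (∑ r ∈ π.roots.toFinset, ‖r‖)
          have h1 : U z ∈ π.roots.toFinset := by
            rw [Multiset.mem_toFinset, Polynomial.mem_roots hπ]; exact h z hz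
          have := Finset.single_le_sum (f := fun r : ℂ => ‖r‖) (fun _ _ => norm_nonneg _) h1
          linarith
        · refine (hnc 1 (by simp)).2 ?_
          filter_upwards [hVo.mem_nhds (show (1:ℂ) ∈ ({0}ᶜ : Set ℂ) by simp)] with y hy using h y hy
      obtain ⟨m, hm⟩ : ∃ m, p.coeff m ≠ 0 := by
        by_contra hcon
        push Not at hcon
        exact hp0 (Polynomial.ext (by simpa using hcon))
      obtain ⟨G1, r1, hG1, hd1⟩ := (hgl b le_rfl).prim
      obtain ⟨G2, hG2, hd2⟩ := lau_prim p m
      refine ⟨fun z => G1 z - r1 / p.coeff m * G2 z, fun z => r1 / p.coeff m * (z ^ N / z ^ (m + 1)), ?_, ?_, ?_⟩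
      · exact fun z hz => (hG1.an (hK0 z hz)).sub (analyticAt_const.mul (hG2.an (hK0 z hz)))
      · exact fun z hz => analyticAt_const.mul ((by fun_prop : AnalyticAt ℂ (fun z : ℂ => z ^ N) z).div (by fun_prop) (pow_ne_zero _ (hK0 z hz)))
      · intro z hz
        have hz0 := hX0 z hz
        refine ((hd1 z hz0).sub ((hd2 z hz0).const_mul (r1 / p.coeff m))).congr_deriv ?_
        have h1 := hp z hz0
        simp only at h1
        have : r1 / p.coeff m * (z ^ N / z ^ (m + 1)) * Polynomial.eval (U z) π * deriv U z =
            r1 / p.coeff m * (z ^ N / z ^ (m + 1)) * (p.eval z / z ^ N) := by rw [← h1]; ring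
        change _ = _ - r1 / p.coeff m * (z ^ N / z ^ (m + 1)) * Polynomial.eval (U z) π * deriv U z
        rw [this]
        field_simp
        ring
end packD4

section packD5
variable {n : ℕ}

lemma keyGen {ι : Type} [Fintype ι] [DecidableEq ι] {T : ℝ} (hT : 0 < T) (f : ι → Fin n → ℂ → ℂ)
    (hd : ∀ k i, Differentiable ℂ (f k i)) (hG : ∀ k, GoodD T (f k)) (ε : ι → ℂ)
    (hmom : ∀ (Q : MvPolynomial (Fin n) ℂ) (i : Fin n),
      ∑ k, ε k * ∫ x in (0:ℝ)..T, MvPolynomial.eval (fun l => f k l x) Q * deriv (f k i) x = 0)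
    (k0 : ι) (hε : ε k0 ≠ 0) (Xm : Fin n → ℕ → ℕ → ℂ) (J : ι → ℕ → ℕ → ℂ → ℂ)
    (hJ : ∀ k, JSys (f k) Xm (J k)) (h0 : ∀ k, k ≠ k0 → ∀ d c, d < c → J k d c T = 0) :
    ∀ d c, d < c → J k0 d c T = 0 := by
  choose ξ F S hξ hFf hS hC using hG
  obtain ⟨lam, hlam⟩ := sep_lin (Finset.univ.biUnion S) (by
    intro d hd
    obtain ⟨k, _, hk⟩ := Finset.mem_biUnion.1 hd
    exact hS k d hk)
  have hlam' : ∀ k, ∀ d ∈ S k, ∑ i, lam i * d i ≠ 0 := fun k d hd =>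
    hlam d (Finset.mem_biUnion.2 ⟨k, Finset.mem_univ _, hd⟩)
  have hbd : ∀ k, ∃ C : ℝ, 0 ≤ C ∧ ∀ x ∈ Metric.ball (0:ℂ) (2*T), ‖∑ i, lam i * F k i (ξ k x)‖ ≤ C := by
    intro k
    have hc : Continuous fun x => ∑ i, lam i * F k i (ξ k x) := by
      simp only [hFf]
      exact continuous_finsetSum _ fun i _ => continuous_const.mul (hd k i).continuous
    obtain ⟨C, hC⟩ := (isCompact_closedBall (0:ℂ) (2*T)).exists_bound_of_continuousOn hc.continuousOn
    exact ⟨max C 0, le_max_right _ _, fun x hx => (hC x (Metric.ball_subset_closedBall hx)).trans (le_max_left _ _)⟩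
  choose Cb hCb0 hCb using hbd
  set ρ1 := ∑ k, Cb k
  have hρ1 : 0 ≤ ρ1 := Finset.sum_nonneg fun k _ => hCb0 k
  have hρ : 0 < ρ1 + 1 := by positivity
  choose X K fib hcp using fun k => hC k lam (hlam' k) (ρ1 + 1) hρ
  let D : CD ι n :=
    { X := X, K := K, U := fun k z => ∑ i, lam i * F k i z, fib := fib, ρ := ρ1 + 1, ρ1 := ρ1, T := T,
      F := F, ξ := ξ, lam := lam, hρ := hρ, hT := hT, hF := fun k => (hcp k).fs, hFa := fun k => (hcp k).an,
      hU := fun _ _ => rfl, hξ := hξ, hξX := fun k x hx => (hcp k).mem x hx, hρ1 := by linarith,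
      hub := fun k x hx => (hCb k x hx).trans (Finset.single_le_sum (fun k _ => hCb0 k) (Finset.mem_univ k)),
      hnc := fun k => (hcp k).nc, hdU := fun k => (hcp k).dU }
  have hfun : ∀ k i, (fun x => F k i (ξ k x)) = f k i := fun k i => funext (hFf k i)
  have key : ∀ m a b, b - a = m → a < b → J k0 a b T = 0 := by
    intro m
    induction m using Nat.strong_induction_on with
    | _ m ih =>
    intro a b hm hab
    obtain ⟨H, hHa, hH, hdec⟩ := (hcp k0).hH Xm (J k0) a b hab (hJ k0)
      (fun c h1 h2 => ih (c - a) (by omega) a c rfl h1)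
    refine D.core ε ?_ k0 hε hab Xm J ?_ (fun k => (hJ k).one) (fun k => (hJ k).zero) H hHa hH hdec ?_ ?_
    · intro Q i
      have := hmom Q i
      simp only [← hFf] at this
      change ∑ k, ε k * ∫ x in (0:ℝ)..T, MvPolynomial.eval (fun l => F k l (ξ k x)) Q *
        deriv (fun x => F k i (ξ k x)) x = 0
      simp only [hfun]
      exact this
    · intro k d c hdc x _
      have := (hJ k).d d c hdc x
      simp only [← hfun] at this
      exact this
    · intro k hk d hd
      exact h0 k hk d b (Finset.mem_Ico.1 hd).2
    · intro d h1 h2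
      exact ih (b - d) (by omega) d b rfl h2
  exact fun d c h => key _ d c rfl h

def TypeO (T : ℝ) (f : Fin n → ℂ → ℂ) : Prop :=
  ∃ κ : ℂ, Complex.exp (κ * T) = 1 ∧ ∃ h : Fin n → Polynomial ℂ, ∀ i x, f i x = (h i).eval (Complex.exp (κ * x))

lemma pol_prim (q : Polynomial ℂ) : ∃ p : Polynomial ℂ, p.derivative = q := by
  refine ⟨∑ j ∈ Finset.range (q.natDegree + 1), Polynomial.C (q.coeff j / (j + 1)) * Polynomial.X ^ (j + 1), ?_⟩
  rw [Polynomial.derivative_sum]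
  conv_rhs => rw [q.as_sum_range_C_mul_X_pow]
  refine Finset.sum_congr rfl fun j _ => ?_
  rw [Polynomial.derivative_C_mul_X_pow]
  have : (j:ℂ) + 1 ≠ 0 := by exact_mod_cast Nat.succ_ne_zero j
  push_cast
  rw [div_mul_cancel₀ _ this]

lemma exp_der (κ x : ℂ) (p : Polynomial ℂ) : HasDerivAt (fun x => p.eval (Complex.exp (κ * x)))
    (p.derivative.eval (Complex.exp (κ * x)) * (κ * Complex.exp (κ * x))) x := by
  have h1 := ((hasDerivAt_id x).const_mul κ).cexp
  simp only [id, mul_one] at h1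
  exact ((p.hasDerivAt _).comp x (h1.congr_deriv (mul_comm _ _)))

lemma TypeO.moment {T : ℝ} {f : Fin n → ℂ → ℂ} (hf : TypeO T f) (Q : MvPolynomial (Fin n) ℂ) (i : Fin n) :
    ∫ x in (0:ℝ)..T, MvPolynomial.eval (fun l => f l x) Q * deriv (f i) x = 0 := by
  obtain ⟨κ, hκ, h, hh⟩ := hf
  have hfe : f i = fun x => (h i).eval (Complex.exp (κ * x)) := funext (hh i)
  have hfd : ∀ x, deriv (f i) x = (h i).derivative.eval (Complex.exp (κ * x)) * (κ * Complex.exp (κ * x)) := fun x => by rw [hfe]; exact (exp_der κ x (h i)).deriv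
  have he : ∀ x : ℂ, MvPolynomial.eval (fun l => f l x) Q = (MvPolynomial.aeval h Q).eval (Complex.exp (κ * x)) := by
    intro x
    simp only [hh]
    induction Q using MvPolynomial.induction_on with
    | C a => simp
    | add p q hp hq => simp [hp, hq]
    | mul_X p l hp => simp [hp]
  obtain ⟨B, hB⟩ := pol_prim (MvPolynomial.aeval h Q * (h i).derivative)
  rw [intervalIntegral.integral_eq_sub_of_hasDerivAt (f := fun x : ℝ => B.eval (Complex.exp (κ * x)))]
  · simp [hκ]
  · intro x _
    refine ((exp_der κ x B).comp_ofReal).congr_deriv ?_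
    rw [he, hfd, hB]; simp; ring
  · refine Continuous.intervalIntegrable ?_ _ _
    simp only [he, hfd]
    have : ∀ p : Polynomial ℂ, Continuous fun x : ℝ => p.eval (Complex.exp (κ * x)) := fun p =>
      p.continuous.comp (by fun_prop)
    exact (this _).mul ((this _).mul (by fun_prop))

lemma TypeO.J {T : ℝ} {f : Fin n → ℂ → ℂ} (hf : TypeO T f) {Xm : Fin n → ℕ → ℕ → ℂ} {J : ℕ → ℕ → ℂ → ℂ}
    (hJ : JSys f Xm J) (d c : ℕ) (hdc : d < c) : J d c T = 0 := by
  obtain ⟨κ, hκ, h, hh⟩ := hf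
  have hfd : ∀ i x, deriv (f i) x = (h i).derivative.eval (Complex.exp (κ * x)) * (κ * Complex.exp (κ * x)) := fun i x => by rw [funext (hh i)]; exact (exp_der κ x (h i)).deriv
  have key : ∀ c, d ≤ c → ∃ g : Polynomial ℂ, ∀ x, J d c x = g.eval (Complex.exp (κ * x)) := by
    intro c
    induction c using Nat.strong_induction_on with
    | _ c ih =>
    intro hdc
    rcases hdc.eq_or_lt with rfl | hlt
    · exact ⟨1, fun x => by simp [hJ.one]⟩
    have hex : ∀ c', ∃ g : Polynomial ℂ, c' ∈ Finset.Ico d c → ∀ x, J d c' x = g.eval (Complex.exp (κ * x)) := by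
      intro c'
      by_cases hc' : c' ∈ Finset.Ico d c
      · have h1 := Finset.mem_Ico.1 hc'
        obtain ⟨g, hg⟩ := ih c' h1.2 h1.1
        exact ⟨g, fun _ => hg⟩
      · exact ⟨0, fun h => absurd h hc'⟩
    choose g hg using hex
    obtain ⟨B, hB⟩ := pol_prim (∑ c' ∈ Finset.Ico d c, g c' * ∑ i, (h i).derivative * Polynomial.C (Xm i c' c))
    have hd : ∀ x, HasDerivAt (fun x => J d c x - B.eval (Complex.exp (κ * x))) 0 x := by
      intro x
      refine ((hJ.d d c hlt x).sub (exp_der κ x B)).congr_deriv ?_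
      rw [hB, sub_eq_zero, Polynomial.eval_finsetSum, Finset.sum_mul]
      refine Finset.sum_congr rfl fun c' hc' => ?_
      rw [hg c' hc', Polynomial.eval_mul, Polynomial.eval_finsetSum, mul_assoc, Finset.sum_mul]
      congr 1
      refine Finset.sum_congr rfl fun i _ => ?_
      rw [hfd]; simp; ring
    refine ⟨B + Polynomial.C (J d c 0 - B.eval (Complex.exp (κ * 0))), fun x => ?_⟩
    have := is_const_of_deriv_eq_zero (fun x => (hd x).differentiableAt) (fun x => (hd x).deriv) x 0
    simp only [Polynomial.eval_add, Polynomial.eval_C]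
    linear_combination this
  obtain ⟨g, hg⟩ := key c hdc.le
  rw [hg T, hκ, ← hJ.zero d c hdc, hg 0]; simp

lemma wf_tri {T ω : ℝ} (hT : 0 < T) (hω : 0 < ω) (hωT : ω * T = 2 * Real.pi) (P Q R : Fin n → Polynomial ℂ) :
    GoodD T (fun i => Wf ω (P i) (Q i) (R i)) ∨ TypeO T (fun i => Wf ω (P i) (Q i) (R i)) := by
  by_cases hP : ∃ i, 0 < (P i).natDegree
  · obtain ⟨i, hi⟩ := hP
    exact Or.inl (goodB hω P Q R i hi)
  push Not at hP
  have hP' : ∀ i x, (P i).eval x = (P i).coeff 0 := fun i x => by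
    conv_lhs => rw [Polynomial.eq_C_of_natDegree_eq_zero (Nat.le_zero.1 (hP i))]
    simp
  have hT1 : Complex.exp (Complex.I * ω * T) = 1 := by
    have : Complex.I * ω * T = 2 * Real.pi * Complex.I := by
      have : (ω:ℂ) * T = 2 * Real.pi := by exact_mod_cast hωT
      linear_combination Complex.I * this
    rw [this, Complex.exp_two_pi_mul_I]
  by_cases hQ : ∃ i, 0 < (Q i).natDegree
  · by_cases hR : ∃ i, 0 < (R i).natDegree
    · obtain ⟨i, hi⟩ := hQ
      obtain ⟨j, hj⟩ := hR
      exact Or.inl (goodL hT hω hωT P Q R (fun i => Nat.le_zero.1 (hP i)) i j hi hj)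
    · push Not at hR
      refine Or.inr ⟨Complex.I * ω, hT1, fun i => Polynomial.C ((P i).coeff 0) + Q i + Polynomial.C ((R i).coeff 0), fun i x => ?_⟩
      simp only [Wf]; rw [hP', Polynomial.eq_C_of_natDegree_eq_zero (Nat.le_zero.1 (hR i))]; simp
  · push Not at hQ
    refine Or.inr ⟨-(Complex.I * ω), ?_, fun i => Polynomial.C ((P i).coeff 0) + R i + Polynomial.C ((Q i).coeff 0), fun i x => ?_⟩
    · rw [neg_mul, Complex.exp_neg, hT1, inv_one]
    simp only [Wf]; rw [hP', Polynomial.eq_C_of_natDegree_eq_zero (Nat.le_zero.1 (hQ i))]; simp; ring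

theorem keyD {T : ℝ} (hT : 0 < T) (f g : Fin n → ℂ → ℂ) (hf : ∀ i, Differentiable ℂ (f i))
    (hg : ∀ i, Differentiable ℂ (g i)) (hf' : GoodD T f ∨ TypeO T f) (hg' : GoodD T g ∨ TypeO T g)
    (hmom : ∀ (Q : MvPolynomial (Fin n) ℂ) (i : Fin n),
      ∫ x in (0:ℝ)..T, MvPolynomial.eval (fun l => f l x) Q * deriv (f i) x =
      ∫ x in (0:ℝ)..T, MvPolynomial.eval (fun l => g l x) Q * deriv (g i) x)
    (Xm : Fin n → ℕ → ℕ → ℂ) (Jf Jg : ℕ → ℕ → ℂ → ℂ) (hJf : JSys f Xm Jf) (hJg : JSys g Xm Jg)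
    (h0 : ∀ d c, d < c → Jg d c T = 0) : ∀ d c, d < c → Jf d c T = 0 := by
  rcases hf' with hf' | hf'
  · rcases hg' with hg' | hg'
    · refine keyGen (ι := Bool) hT (fun k => bif k then f else g) ?_ ?_ (fun k => bif k then 1 else -1) ?_ true
        (by simp) Xm (fun k => bif k then Jf else Jg) ?_ ?_
      · rintro (_ | _); exacts [hg, hf]
      · rintro (_ | _); exacts [hg', hf']
      · intro Q i
        simp [hmom Q i]
      · rintro (_ | _); exacts [hJg, hJf]
      · rintro (_ | _) h
        · exact h0
        · exact absurd rfl h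
    · refine keyGen (ι := Unit) hT (fun _ => f) (fun _ => hf) (fun _ => hf') (fun _ => 1) ?_ ()
        one_ne_zero Xm (fun _ => Jf) (fun _ => hJf) (fun k hk => absurd rfl hk)
      intro Q i
      simp [hmom Q i, hg'.moment Q i]
  · exact hf'.J hJf
end packD5

section packE1
variable {n : ℕ}

def prC (g : ℂ → ℂ) (z : ℂ) : ℂ := Complex.wedgeIntegral 0 z g

lemma prC_der {g : ℂ → ℂ} (hg : Differentiable ℂ g) (z : ℂ) : HasDerivAt (prC g) (g z) z := by
  have h : DifferentiableOn ℂ g (Metric.ball 0 (‖z‖+1)) := hg.differentiableOn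
  exact h.isConservativeOn.hasDerivAt_wedgeIntegral h.continuousOn (by simp)

lemma prC_zero (g : ℂ → ℂ) : prC g 0 = 0 := by simp [prC, Complex.wedgeIntegral]

def Jc (f : Fin n → ℂ → ℂ) (Xm : Fin n → ℕ → ℕ → ℂ) (d : ℕ) (b : ℕ) : ℂ → ℂ :=
  if b ≤ d then (fun _ => if b = d then 1 else 0) else
    prC (fun s => ∑ c : Fin b, Jc f Xm d c s * ∑ i, deriv (f i) s * Xm i c b)
termination_by b

def Jr (a : Fin n → ℝ → ℂ) (Xm : Fin n → ℕ → ℕ → ℂ) (d : ℕ) (b : ℕ) : ℝ → ℂ :=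
  if b ≤ d then (fun _ => if b = d then 1 else 0) else
    fun x => ∫ s in (0:ℝ)..x, ∑ c : Fin b, Jr a Xm d c s * ∑ i, a i s * Xm i c b
termination_by b

lemma sumIco {d b : ℕ} (g : ℕ → ℂ) (h0 : ∀ c < d, g c = 0) :
    ∑ c : Fin b, g c = ∑ c ∈ Finset.Ico d b, g c := by
  rw [Fin.sum_univ_eq_sum_range, Finset.range_eq_Ico]
  symm
  refine Finset.sum_subset (Finset.Ico_subset_Ico_left (Nat.zero_le _)) fun c hc hc' => h0 c ?_
  simp only [Finset.mem_Ico] at hc hc'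
  omega

lemma Jc_diff {f : Fin n → ℂ → ℂ} (hf : ∀ i, Differentiable ℂ (f i)) (Xm : Fin n → ℕ → ℕ → ℂ) (d b : ℕ) :
    Differentiable ℂ (Jc f Xm d b) ∧ (d < b → ∀ x, HasDerivAt (Jc f Xm d b)
      (∑ c : Fin b, Jc f Xm d c x * ∑ i, deriv (f i) x * Xm i c b) x) := by
  induction b using Nat.strong_induction_on with
  | _ b ih =>
  have hd : ∀ i, Differentiable ℂ (deriv (f i)) := fun i => (hf i).deriv
  have h1 : Differentiable ℂ (fun s => ∑ c : Fin b, Jc f Xm d c s * ∑ i, deriv (f i) s * Xm i c b) := by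
    refine Differentiable.fun_sum fun c _ => ((ih c c.2).1).mul (Differentiable.fun_sum fun i _ => (hd i).mul_const _)
  by_cases hb : b ≤ d
  · refine ⟨?_, fun h => absurd h (by omega)⟩
    rw [Jc, if_pos hb]
    exact differentiable_const _
  · have : ∀ x, HasDerivAt (Jc f Xm d b)
      (∑ c : Fin b, Jc f Xm d c x * ∑ i, deriv (f i) x * Xm i c b) x := by
      intro x
      conv => rw [Jc, if_neg hb]
      exact prC_der h1 x
    exact ⟨fun x => (this x).differentiableAt, fun _ => this⟩

lemma Jc_sys {f : Fin n → ℂ → ℂ} (hf : ∀ i, Differentiable ℂ (f i)) (Xm : Fin n → ℕ → ℕ → ℂ) :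
    JSys f Xm (Jc f Xm) where
  d := fun d c hdc x => by
    refine ((Jc_diff hf Xm d c).2 hdc x).congr_deriv ?_
    refine sumIco (fun c' => Jc f Xm d c' x * ∑ i, deriv (f i) x * Xm i c' c) fun c' hc' => ?_
    rw [Jc, if_pos hc'.le]; simp [hc'.ne]
  one := fun d x => by rw [Jc]; simp
  zero := fun d c hdc => by rw [Jc, if_neg (by omega), prC_zero]

lemma Jc_eq_Jr {T : ℝ} {f : Fin n → ℂ → ℂ} (hf : ∀ i, Differentiable ℂ (f i)) (Xm : Fin n → ℕ → ℕ → ℂ)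
    {a : Fin n → ℝ → ℂ} (ha : ∀ i, ∀ x ∈ Icc (0:ℝ) T, deriv (f i) x = a i x) (d b : ℕ) :
    ∀ x ∈ Icc (0:ℝ) T, Jc f Xm d b x = Jr a Xm d b x := by
  induction b using Nat.strong_induction_on with
  | _ b ih =>
  intro x hx
  by_cases hb : b ≤ d
  · rw [Jc, Jr, if_pos hb, if_pos hb]
  rw [Jr, if_neg hb]
  have h1 : Continuous (fun s : ℂ => ∑ c : Fin b, Jc f Xm d c s * ∑ i, deriv (f i) s * Xm i c b) :=
    continuous_finsetSum _ fun c _ => (Jc_diff hf Xm d c).1.continuous.mul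
      (continuous_finsetSum _ fun i _ => ((hf i).deriv.continuous).mul continuous_const)
  have h2 := intervalIntegral.integral_eq_sub_of_hasDerivAt (a := 0) (b := x) (f := fun s : ℝ => Jc f Xm d b s)
    (fun s _ => ((Jc_diff hf Xm d b).2 (by omega) s).comp_ofReal)
    ((h1.comp Complex.continuous_ofReal).intervalIntegrable _ _)
  have h3 : Jc f Xm d b ((0:ℝ):ℂ) = 0 := by
    rw [Jc, if_neg hb]; simp [prC_zero]
  rw [h3, sub_zero] at h2
  rw [← h2]
  refine intervalIntegral.integral_congr fun s hs => ?_
  rw [uIcc_of_le hx.1] at hs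
  have hs' : s ∈ Icc (0:ℝ) T := ⟨hs.1, hs.2.trans hx.2⟩
  exact Finset.sum_congr rfl fun c _ => by
    rw [ih c c.2 s hs']; simp only [ha _ s hs']

def WA (T : ℝ) (f : ℝ → ℂ) : Prop :=
  ∃ P Q R : Polynomial ℂ, ∀ x ∈ Icc (0:ℝ) T, f x = Wf (2 * Real.pi / T) P Q R x

lemma Wf_prim {ω : ℝ} (hω : 0 < ω) (P Q R : Polynomial ℂ) : ∃ P' Q' R' : Polynomial ℂ,
    (∀ x, HasDerivAt (Wf ω P' Q' R') (Wf ω P Q R x) x) ∧ Wf ω P' Q' R' 0 = 0 := by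
  obtain ⟨A, hA⟩ := pol_prim (P + Polynomial.C (Q.coeff 0 + R.coeff 0))
  obtain ⟨B, hB⟩ := pol_prim (Polynomial.C ((Complex.I * ω)⁻¹) * Q.divX)
  obtain ⟨D, hD⟩ := pol_prim (Polynomial.C ((-(Complex.I * ω))⁻¹) * R.divX)
  refine ⟨A - Polynomial.C (A.eval 0 + B.eval 1 + D.eval 1), B, D, fun x => ?_, ?_⟩
  · have h0 : Complex.I * ω ≠ 0 := mul_ne_zero Complex.I_ne_zero (by exact_mod_cast hω.ne')
    have h1 := (A - Polynomial.C (A.eval 0 + B.eval 1 + D.eval 1)).hasDerivAt x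
    have h2 := exp_der (Complex.I * ω) x B
    have h3 := exp_der (-(Complex.I * ω)) x D
    simp only [neg_mul] at h3
    have hQ : ∀ z, Q.eval z = Q.divX.eval z * z + Q.coeff 0 := fun z => by
      conv_lhs => rw [← Q.divX_mul_X_add]
      simp
    have hR : ∀ z, R.eval z = R.divX.eval z * z + R.coeff 0 := fun z => by
      conv_lhs => rw [← R.divX_mul_X_add]
      simp
    refine ((h1.add h2).add h3).congr_deriv ?_
    rw [Wf, hB, hD, hQ, hR]
    simp only [Polynomial.derivative_sub, Polynomial.derivative_C, hA, Polynomial.eval_add, Polynomial.eval_sub,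
      Polynomial.eval_mul, Polynomial.eval_C, Polynomial.eval_zero]
    have h4 : (ω:ℂ) ≠ 0 := by exact_mod_cast hω.ne'
    field_simp
    ring
  · simp [Wf]; ring

lemma WA.ent {T : ℝ} (hT : 0 < T) {a : Fin n → ℝ → ℂ} (ha : ∀ i, WA T (a i)) :
    ∃ f : Fin n → ℂ → ℂ, (∀ i, Differentiable ℂ (f i)) ∧ (GoodD T f ∨ TypeO T f) ∧
      (∀ i, ∀ x ∈ Icc (0:ℝ) T, deriv (f i) x = a i x) ∧ ∀ i, ∀ x ∈ Icc (0:ℝ) T, f i x = primitive (a i) x := by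
  choose P Q R h using ha
  have hω : 0 < 2 * Real.pi / T := by positivity
  choose P' Q' R' hd h0 using fun i => Wf_prim hω (P i) (Q i) (R i)
  have hde : ∀ i, ∀ x ∈ Icc (0:ℝ) T, deriv (Wf (2 * Real.pi / T) (P' i) (Q' i) (R' i)) x = a i x :=
    fun i x hx => by rw [(hd i x).deriv, h i x hx]
  refine ⟨fun i => Wf (2 * Real.pi / T) (P' i) (Q' i) (R' i), fun i => Wf_diff _ _ _ _,
    wf_tri hT hω (by field_simp) _ _ _, hde, fun i x hx => ?_⟩
  have h2 := intervalIntegral.integral_eq_sub_of_hasDerivAt (a := 0) (b := x)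
    (f := fun s : ℝ => Wf (2 * Real.pi / T) (P' i) (Q' i) (R' i) s) (fun s _ => (hd i s).comp_ofReal)
    (((Wf_diff _ _ _ _).continuous.comp Complex.continuous_ofReal).intervalIntegrable _ _)
  simp only [Complex.ofReal_zero, h0, sub_zero] at h2
  rw [primitive]; refine h2.symm.trans ?_
  refine intervalIntegral.integral_congr fun s hs => ?_
  rw [uIcc_of_le hx.1] at hs
  exact (h i s ⟨hs.1, hs.2.trans hx.2⟩).symm

lemma mom_eq {T : ℝ} (hT : 0 < T) {a : Fin n → ℝ → ℂ} {f : Fin n → ℂ → ℂ} (hf : ∀ i, Differentiable ℂ (f i))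
    (hd : ∀ i, ∀ x ∈ Icc (0:ℝ) T, deriv (f i) x = a i x) (hp : ∀ i, ∀ x ∈ Icc (0:ℝ) T, f i x = primitive (a i) x)
    (Q : MvPolynomial (Fin n) ℂ) (i : Fin n) :
    ∫ x in (0:ℝ)..T, MvPolynomial.eval (fun l => f l x) Q * deriv (f i) x =
      ∑ e ∈ Q.support, Q.coeff e * moment T a (e.support.toList.map fun l => (l, e l)) i := by
  simp only [MvPolynomial.eval_eq, Finset.sum_mul]
  have hc : ∀ i, Continuous fun x : ℝ => f i x := fun i => (hf i).continuous.comp Complex.continuous_ofReal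
  have hc' : Continuous fun x : ℝ => deriv (f i) x := (hf i).deriv.continuous.comp Complex.continuous_ofReal
  rw [intervalIntegral.integral_finsetSum]
  · refine Finset.sum_congr rfl fun e _ => ?_
    simp only [mul_assoc]
    rw [intervalIntegral.integral_const_mul, moment]
    congr 1
    refine intervalIntegral.integral_congr fun s hs => ?_
    rw [uIcc_of_le hT.le] at hs
    simp only [List.map_map, Function.comp_def, Finset.prod_map_toList]
    rw [hd i s hs]
    congr 1
    exact Finset.prod_congr rfl fun l _ => by rw [hp l s hs]
  · intro e _
    exact ((continuous_const.mul (continuous_finsetProd _ fun l _ => (hc l).pow _)).mul hc').intervalIntegrable _ _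

theorem keyR {T : ℝ} (hT : 0 < T) {a b : Fin n → ℝ → ℂ} (ha : ∀ i, WA T (a i)) (hb : ∀ i, WA T (b i))
    (hm : ∀ ps : List (Fin n × ℕ), (∀ q ∈ ps, 0 < q.2) → ∀ i, moment T a ps i = moment T b ps i)
    (Xm : Fin n → ℕ → ℕ → ℂ) (h0 : ∀ d c, d < c → Jr b Xm d c T = 0) (d c : ℕ) (hdc : d < c) : Jr a Xm d c T = 0 := by
  obtain ⟨f, hf, hf', hfd, hfp⟩ := WA.ent hT ha
  obtain ⟨g, hg, hg', hgd, hgp⟩ := WA.ent hT hb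
  have hT' : T ∈ Icc (0:ℝ) T := ⟨hT.le, le_rfl⟩
  rw [← Jc_eq_Jr hf Xm hfd d c T hT']
  refine keyD hT f g hf hg hf' hg' (fun Q i => ?_) Xm _ _ (Jc_sys hf Xm) (Jc_sys hg Xm) (fun d c hdc => ?_) d c hdc
  · rw [mom_eq hT hf hfd hfp, mom_eq hT hg hgd hgp]
    refine Finset.sum_congr rfl fun e _ => ?_
    rw [hm]
    intro q hq
    simp only [List.mem_map, Finset.mem_toList, Finsupp.mem_support_iff] at hq
    obtain ⟨l, hl, rfl⟩ := hq
    exact Nat.pos_of_ne_zero hl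
  · rw [Jc_eq_Jr hg Xm hgd d c T hT', h0 d c hdc]
end packE1

section packE2
variable {n : ℕ}

lemma ftcI {T : ℝ} (hT : 0 < T) {g : ℝ → ℂ} (hg : ContinuousOn g (Icc 0 T)) (x : ℝ) (hx : x ∈ Icc 0 T) :
    HasDerivWithinAt (fun x => ∫ s in (0:ℝ)..x, g s) (g x) (Icc 0 T) x := by
  have hG : Continuous (IccExtend hT.le ((Icc 0 T).domRestrict g)) := (continuousOn_iff_continuous_domRestrict.1 hg).Icc_extend'
  have he : ∀ y ∈ Icc 0 T, IccExtend hT.le ((Icc 0 T).domRestrict g) y = g y := fun y hy => by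
    rw [IccExtend_of_mem _ _ hy]; rfl
  have h1 : ∀ y ∈ Icc 0 T, ∫ s in (0:ℝ)..y, g s = ∫ s in (0:ℝ)..y, IccExtend hT.le ((Icc 0 T).domRestrict g) s := by
    intro y hy
    refine intervalIntegral.integral_congr fun s hs => ?_
    rw [uIcc_of_le hy.1] at hs
    exact (he s ⟨hs.1, hs.2.trans hy.2⟩).symm
  have h2 := (intervalIntegral.integral_hasDerivAt_right (hG.intervalIntegrable 0 x)
    (hG.stronglyMeasurableAtFilter _ _) hG.continuousAt).hasDerivWithinAt (s := Icc 0 T)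
  rw [he x hx] at h2
  exact h2.congr (fun y hy => h1 y hy) (h1 x hx)

lemma Jr_cd {T : ℝ} (hT : 0 < T) {a : Fin n → ℝ → ℂ} (ha : ∀ i, ContinuousOn (a i) (Icc 0 T))
    (Xm : Fin n → ℕ → ℕ → ℂ) (d b : ℕ) : ContinuousOn (Jr a Xm d b) (Icc 0 T) ∧ ∀ x ∈ Icc 0 T,
      HasDerivWithinAt (Jr a Xm d b) (∑ c : Fin b, Jr a Xm d c x * ∑ i, a i x * Xm i c b) (Icc 0 T) x := by
  induction b using Nat.strong_induction_on with
  | _ b ih =>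
  have h1 : ContinuousOn (fun s => ∑ c : Fin b, Jr a Xm d c s * ∑ i, a i s * Xm i c b) (Icc 0 T) :=
    continuousOn_finsetSum _ fun c _ => (ih c c.2).1.mul
      (continuousOn_finsetSum _ fun i _ => (ha i).mul continuousOn_const)
  have : ∀ x ∈ Icc 0 T, HasDerivWithinAt (Jr a Xm d b) (∑ c : Fin b, Jr a Xm d c x * ∑ i, a i x * Xm i c b) (Icc 0 T) x := by
    intro x hx
    by_cases hb : b ≤ d
    · rw [Finset.sum_eq_zero]
      · rw [Jr, if_pos hb]
        exact hasDerivWithinAt_const _ _ _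
      · intro c _
        have := c.2
        rw [Jr, if_pos (by omega), if_neg (by omega), zero_mul]
    · conv => rw [Jr, if_neg hb]
      exact ftcI hT h1 x hx
  exact ⟨fun x hx => (this x hx).continuousWithinAt, this⟩

def Xc (i : Fin n) (c b : ℕ) : ℂ := if b = c + i + 1 then -(c:ℂ) else 0

def Kf (a : Fin n → ℝ → ℂ) (v : ℝ → ℂ) (d R : ℕ) (x : ℝ) : ℂ := ∑ b ∈ Finset.range (R+1), Jr a Xc d b x * v x ^ b

lemma Kf_der {T : ℝ} (hT : 0 < T) {a : Fin n → ℝ → ℂ} (ha : ∀ i, ContinuousOn (a i) (Icc 0 T)) (d R : ℕ)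
    {v : ℝ → ℂ} {x : ℝ} (hx : x ∈ Icc 0 T)
    (hv : HasDerivWithinAt v (∑ i, a i x * v x ^ ((i:ℕ)+2)) (Icc 0 T) x) :
    HasDerivWithinAt (Kf a v d R) (∑ c ∈ Finset.range (R+1), ∑ i : Fin n,
      if R < c + i + 1 then c * Jr a Xc d c x * a i x * v x ^ (c + i + 1) else 0) (Icc 0 T) x := by
  have h1 := HasDerivWithinAt.fun_sum (u := Finset.range (R+1)) fun b _ => ((Jr_cd hT ha Xc d b).2 x hx).mul (hv.pow b)
  refine h1.congr_deriv ?_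
  have h2 : ∀ b ∈ Finset.range (R+1), ∑ c : Fin b, Jr a Xc d c x * ∑ i, a i x * Xc i c b =
      ∑ c ∈ Finset.range (R+1), ∑ i : Fin n, if b = c + i + 1 then - (c * Jr a Xc d c x * a i x) else 0 := by
    intro b hb
    rw [Fin.sum_univ_eq_sum_range (fun c => Jr a Xc d c x * ∑ i, a i x * Xc i c b)]
    rw [Finset.sum_subset (Finset.range_subset_range.2 (Finset.mem_range.1 hb).le)]
    · refine Finset.sum_congr rfl fun c _ => ?_
      rw [Finset.mul_sum]
      refine Finset.sum_congr rfl fun i _ => ?_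
      unfold Xc
      split_ifs <;> ring
    · intro c _ hc
      rw [Finset.mem_range] at hc
      rw [Finset.sum_eq_zero, mul_zero]
      intro i _
      rw [Xc, if_neg (by omega), mul_zero]
  rw [Finset.sum_add_distrib, Finset.sum_congr rfl fun b hb => by rw [h2 b hb]]
  simp only [Finset.sum_mul, ite_mul, zero_mul]
  rw [Finset.sum_comm, ← Finset.sum_add_distrib]
  refine Finset.sum_congr rfl fun c _ => ?_
  rw [Finset.sum_comm, Finset.mul_sum, Finset.mul_sum, ← Finset.sum_add_distrib]
  refine Finset.sum_congr rfl fun i _ => ?_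
  rw [Finset.sum_ite_eq', Pi.pow_apply]; simp only [Finset.mem_range]
  have h3 : (c:ℂ) * v x ^ (c-1) * v x ^ ((i:ℕ)+2) = c * v x ^ (c + i + 1) := by
    rcases c with _ | c
    · simp
    · rw [mul_assoc, ← pow_add]; congr 2; simp; omega
  by_cases h : R < c + i + 1
  · rw [if_pos h, if_neg (by omega)]
    linear_combination Jr a Xc d c x * a i x * h3
  · rw [if_neg h, if_pos (by omega)]
    linear_combination Jr a Xc d c x * a i x * h3

lemma Kf_bd {T : ℝ} (hT : 0 < T) {a : Fin n → ℝ → ℂ} (ha : ∀ i, ContinuousOn (a i) (Icc 0 T)) (d R : ℕ) {C B η : ℝ}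
    (hC0 : 0 ≤ C) (hC : ∀ i, ∀ x ∈ Icc 0 T, ‖a i x‖ ≤ C) (hB0 : 0 ≤ B)
    (hB : ∀ c ≤ R, ∀ x ∈ Icc 0 T, ‖Jr a Xc d c x‖ ≤ B) (hη0 : 0 ≤ η) (hη : η ≤ 1)
    {v : ℝ → ℂ} (hv : ∀ x ∈ Icc 0 T, HasDerivWithinAt v (∑ i, a i x * v x ^ ((i:ℕ)+2)) (Icc 0 T) x)
    (hvη : ∀ x ∈ Icc 0 T, ‖v x‖ ≤ η) :
    ‖Kf a v d R T - Kf a v d R 0‖ ≤ ((R+1) * (n * (R * B * C * η^(R+1)))) * T := by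
  have h := norm_image_sub_le_of_norm_deriv_le_segment' (C := (R+1) * (n * (R * B * C * η^(R+1)))) (fun x hx => Kf_der hT ha d R hx (hv x hx))
    (fun x hx => ?_) T ⟨hT.le, le_rfl⟩
  · simpa using h
  have hx' : x ∈ Icc 0 T := ⟨hx.1, hx.2.le⟩
  have h1 : ∀ c ∈ Finset.range (R+1), ∀ i : Fin n, ‖if R < c + i + 1 then (c:ℂ) * Jr a Xc d c x * a i x * v x ^ (c + i + 1) else 0‖ ≤
      R * B * C * η^(R+1) := by
    intro c hc i
    have hc' : c ≤ R := by rw [Finset.mem_range] at hc; omega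
    split_ifs with hR
    · rw [norm_mul, norm_mul, norm_mul, norm_pow, Complex.norm_natCast]
      have h5 : ‖v x‖ ^ (c+i+1) ≤ η^(R+1) :=
        (pow_le_pow_left₀ (norm_nonneg _) (hvη x hx') _).trans (pow_le_pow_of_le_one hη0 hη (by omega))
      have h6 : (c:ℝ) ≤ R := by exact_mod_cast hc'
      gcongr
      exacts [hB c hc' x hx', hC i x hx']
    · rw [norm_zero]; positivity
  calc _ ≤ ∑ c ∈ Finset.range (R+1), ∑ i : Fin n, (R * B * C * η^(R+1)) :=
        (norm_sum_le _ _).trans (Finset.sum_le_sum fun c hc => (norm_sum_le _ _).trans (Finset.sum_le_sum fun i _ => h1 c hc i))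
    _ = _ := by simp

lemma Jr_zero (a : Fin n → ℝ → ℂ) (Xm : Fin n → ℕ → ℕ → ℂ) (d b : ℕ) : Jr a Xm d b 0 = if b = d then 1 else 0 := by
  rw [Jr]
  split_ifs with h1 h2
  · rfl
  · rfl
  · omega
  · simp

lemma Kf_zero (a : Fin n → ℝ → ℂ) (v : ℝ → ℂ) (d R : ℕ) (h : d ≤ R) : Kf a v d R 0 = v 0 ^ d := by
  simp only [Kf, Jr_zero, ite_mul, one_mul, zero_mul]
  rw [Finset.sum_ite_eq', if_pos (Finset.mem_range.2 (by omega))]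

lemma Jr_one (a : Fin n → ℝ → ℂ) (Xm : Fin n → ℕ → ℕ → ℂ) (d : ℕ) (x : ℝ) : Jr a Xm d d x = 1 := by
  rw [Jr]; simp

lemma Kf_T (a : Fin n → ℝ → ℂ) (v : ℝ → ℂ) (d R : ℕ) (hdR : d < R) (T : ℝ) (h : ∀ c, d < c → c < R → Jr a Xc d c T = 0) :
    Kf a v d R T = v T ^ d + Jr a Xc d R T * v T ^ R := by
  rw [Kf, Finset.sum_range_succ]
  congr 1
  rw [Finset.sum_eq_single d]
  · rw [Jr_one, one_mul]
  · intro c hc hcd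
    rw [Finset.mem_range] at hc
    rcases lt_or_gt_of_ne hcd with h1 | h1
    · rw [Jr, if_pos h1.le, if_neg hcd, zero_mul]
    · rw [h c h1 hc, zero_mul]
  · intro h'; exact absurd (Finset.mem_range.2 hdR) h'

lemma Jr_grow {T : ℝ} (hT : 0 < T) {a : Fin n → ℝ → ℂ} (ha : ∀ i, ContinuousOn (a i) (Icc 0 T)) {C : ℝ}
    (hC0 : 0 ≤ C) (hC : ∀ i, ∀ x ∈ Icc 0 T, ‖a i x‖ ≤ C) (b : ℕ) : ∀ x ∈ Icc 0 T,
    ‖Jr a Xc 1 (b+1) x‖ ≤ (1 + C * n * x) ^ b := by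
  induction b using Nat.strong_induction_on with
  | _ b ih =>
  rcases b with _ | b
  · intro x _; rw [Jr_one]; simp
  intro x hx
  refine image_norm_le_of_norm_deriv_right_le_deriv_boundary (a := 0) (b := T) (f' := fun x => ∑ c : Fin (b+1+1), Jr a Xc 1 c x * ∑ i, a i x * Xc i c (b+1+1))
    (B := fun x => (1 + C * n * x) ^ (b+1)) (B' := fun x => (b+1:ℕ) * (1 + C * n * x) ^ b * (C * n)) (Jr_cd hT ha Xc 1 _).1
    (fun y hy => ?_) ?_ (fun y => ?_) (fun y hy => ?_) hx
  · exact (((Jr_cd hT ha Xc 1 (b+1+1)).2 y ⟨hy.1, hy.2.le⟩).mono_of_mem_nhdsWithin (Icc_mem_nhdsGE_of_mem hy))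
  · rw [Jr_zero]; simp
  · have h1 : HasDerivAt (fun x : ℝ => 1 + C * n * x) (C * n) y := by
      simpa using ((hasDerivAt_id y).const_mul (C * n)).const_add 1
    exact (h1.pow (b+1)).congr_deriv (by simp)
  · have hy' : y ∈ Icc 0 T := ⟨hy.1, hy.2.le⟩
    have hb1 : 1 ≤ 1 + C * n * y := by
      have : 0 ≤ C * n * y := mul_nonneg (by positivity) hy.1
      linarith
    simp only [Finset.mul_sum]
    rw [Finset.sum_comm]
    have h2 : ∀ i : Fin n, ‖∑ c : Fin (b+1+1), Jr a Xc 1 c y * (a i y * Xc i c (b+1+1))‖ ≤ (b+1:ℕ) * (1 + C * n * y) ^ b * C := by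
      intro i
      have h3 : ∀ c : Fin (b+1+1), ‖Jr a Xc 1 c y * (a i y * Xc i c (b+1+1))‖ ≤
          if (c:ℕ) = b + 1 - i then (b+1:ℕ) * (1 + C * n * y) ^ b * C else 0 := by
        intro c
        have hXX : Xc i c (b+1+1) = if b + 1 + 1 = c + i + 1 then -((c:ℕ):ℂ) else 0 := rfl
        rw [hXX]
        by_cases hc : b + 1 + 1 = c + i + 1
        · rw [if_pos hc, if_pos (by omega)]
          obtain ⟨c, hc'⟩ := c
          rcases c with _ | c
          · simp; positivity
          · rw [norm_mul, norm_mul, norm_neg, Complex.norm_natCast]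
            have h4 := ih c (by omega) y hy'
            have h5 := h4.trans (pow_le_pow_right₀ hb1 (show c ≤ b by omega))
            have h6 : ((c+1:ℕ):ℝ) ≤ (b+1:ℕ) := by exact_mod_cast (by omega)
            calc _ ≤ (1 + C * n * y) ^ b * (C * (b+1:ℕ)) := by
                  gcongr
                  exact hC i y hy'
              _ = _ := by ring
        · rw [if_neg hc]
          simp only [mul_zero, norm_zero]
          split_ifs <;> positivity
      refine (norm_sum_le _ _).trans ((Finset.sum_le_sum fun c _ => h3 c).trans ?_)
      rw [Fin.sum_univ_eq_sum_range (fun c => if c = b + 1 - i then (b+1:ℕ) * (1 + C * n * y) ^ b * C else 0), Finset.sum_ite_eq']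
      split_ifs
      · exact le_rfl
      · positivity
    refine (norm_sum_le _ _).trans ((Finset.sum_le_sum fun i _ => h2 i).trans (le_of_eq ?_))
    simp; ring
end packE2

section packE3
variable {n : ℕ}

lemma apriori {T : ℝ} (hT : 0 < T) {a : Fin n → ℝ → ℂ} {C ε : ℝ} (hC0 : 0 ≤ C)
    (hC : ∀ i, ∀ x ∈ Icc 0 T, ‖a i x‖ ≤ C) (hε : 0 < ε) (h1 : 2 * ε ≤ 1) (h2 : 4 * n * C * T * ε < 1)
    {v : ℝ → ℂ} (hv : ∀ x ∈ Icc 0 T, HasDerivWithinAt v (∑ i, a i x * v x ^ ((i:ℕ)+2)) (Icc 0 T) x)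
    (hv0 : ‖v 0‖ ≤ ε) (x : ℝ) (hx : x ∈ Icc 0 T) : ‖v x‖ ≤ 2 * ε := by
  have h := image_norm_le_of_norm_deriv_right_lt_deriv_boundary (a := 0) (b := T) (f := v)
    (f' := fun x => ∑ i, a i x * v x ^ ((i:ℕ)+2)) (B := fun x => ε + ε / T * x) (B' := fun _ => ε / T)
    (fun x hx => (hv x hx).continuousWithinAt)
    (fun y hy => (hv y ⟨hy.1, hy.2.le⟩).mono_of_mem_nhdsWithin (Icc_mem_nhdsGE_of_mem hy)) (by simpa using hv0)
    (fun y => by simpa using ((hasDerivAt_id y).const_mul (ε/T)).const_add ε) ?_ hx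
  · refine h.trans ?_
    have : ε / T * x ≤ ε / T * T := mul_le_mul_of_nonneg_left hx.2 (by positivity)
    rw [div_mul_cancel₀ _ hT.ne'] at this
    linarith
  · intro y hy hy2
    have hb : ‖v y‖ ≤ 2 * ε := by
      rw [hy2]
      have : ε / T * y ≤ ε / T * T := mul_le_mul_of_nonneg_left hy.2.le (by positivity)
      rw [div_mul_cancel₀ _ hT.ne'] at this
      linarith
    have h3 : ∀ i : Fin n, ‖a i y * v y ^ ((i:ℕ)+2)‖ ≤ C * (2*ε)^2 := by
      intro i
      rw [norm_mul, norm_pow]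
      have : ‖v y‖ ^ ((i:ℕ)+2) ≤ (2*ε)^2 :=
        (pow_le_pow_left₀ (norm_nonneg _) hb _).trans (pow_le_pow_of_le_one (by positivity) h1 (by omega))
      gcongr
      exact hC i y ⟨hy.1, hy.2.le⟩
    refine ((norm_sum_le _ _).trans (Finset.sum_le_sum fun i _ => h3 i)).trans_lt ?_
    rw [lt_div_iff₀ hT]
    simp only [Finset.sum_const, Finset.card_univ, Fintype.card_fin, nsmul_eq_mul]
    nlinarith

lemma pow_lip {z w : ℂ} (hz : ‖z‖ ≤ 1) (hw : ‖w‖ ≤ 1) (m : ℕ) : ‖z^m - w^m‖ ≤ m * ‖z - w‖ := by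
  induction m with
  | zero => simp
  | succ m ih =>
    have : z^(m+1) - w^(m+1) = z^m * (z - w) + (z^m - w^m) * w := by ring
    rw [this]
    refine (norm_add_le _ _).trans ?_
    rw [norm_mul, norm_mul, norm_pow]
    have h1 : ‖z‖^m * ‖z - w‖ ≤ 1 * ‖z - w‖ := by gcongr; exact pow_le_one₀ (norm_nonneg _) hz
    have h2 : ‖z^m - w^m‖ * ‖w‖ ≤ (m * ‖z-w‖) * 1 := by gcongr
    push_cast
    linarith

lemma sol_exists {T : ℝ} (hT : 0 < T) {a : Fin n → ℝ → ℂ} (ha : ∀ i, ContinuousOn (a i) (Icc 0 T)) {C ε : ℝ} (hC0 : 0 ≤ C)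
    (hC : ∀ i, ∀ x ∈ Icc 0 T, ‖a i x‖ ≤ C) (hε : 0 < ε) (h1 : 2 * ε ≤ 1) (h2 : 4 * n * C * T * ε < 1)
    (v0 : ℂ) (hv0 : ‖v0‖ ≤ ε) : ∃ v : ℝ → ℂ, v 0 = v0 ∧
      ∀ x ∈ Icc 0 T, HasDerivWithinAt v (∑ i, a i x * v x ^ ((i:ℕ)+2)) (Icc 0 T) x := by
  have hb : ∀ z ∈ Metric.closedBall v0 ε, ‖z‖ ≤ 2 * ε := by
    intro z hz
    rw [mem_closedBall_iff_norm] at hz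
    have := norm_sub_norm_le z v0
    linarith
  have hpl : IsPicardLindelof (fun x z => ∑ i, a i x * z ^ ((i:ℕ)+2)) (⟨0, le_rfl, hT.le⟩ : Icc 0 T) v0 ⟨ε, hε.le⟩ 0
      ⟨n * (C * (2*ε)^2), by positivity⟩ ⟨∑ i : Fin n, C * ((i:ℕ)+2:ℕ), by positivity⟩ := by
    constructor
    · intro t ht
      refine LipschitzOnWith.of_dist_le_mul fun z hz w hw => ?_
      have hz' := (hb z hz).trans h1
      have hw' := (hb w hw).trans h1
      rw [dist_eq_norm, dist_eq_norm, ← Finset.sum_sub_distrib]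
      refine (norm_sum_le _ _).trans ?_
      show _ ≤ (∑ i : Fin n, C * ((i:ℕ)+2:ℕ)) * ‖z - w‖
      rw [Finset.sum_mul]
      refine Finset.sum_le_sum fun i _ => ?_
      rw [← mul_sub, norm_mul, mul_assoc]
      exact mul_le_mul (hC i t ht) (pow_lip hz' hw' _) (norm_nonneg _) hC0
    · intro z _
      exact continuousOn_finsetSum _ fun i _ => (ha i).mul continuousOn_const
    · intro t ht z hz
      have h3 : ∀ i : Fin n, ‖a i t * z ^ ((i:ℕ)+2)‖ ≤ C * (2*ε)^2 := by
        intro i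
        rw [norm_mul, norm_pow]
        have : ‖z‖ ^ ((i:ℕ)+2) ≤ (2*ε)^2 :=
          (pow_le_pow_left₀ (norm_nonneg _) (hb z hz) _).trans (pow_le_pow_of_le_one (by positivity) h1 (by omega))
        gcongr
        exact hC i t ht
      refine ((norm_sum_le _ _).trans (Finset.sum_le_sum fun i _ => h3 i)).trans (le_of_eq ?_)
      simp; rfl
    · show (n * (C * (2*ε)^2)) * max (T - 0) (0 - 0) ≤ ε - 0
      rw [max_eq_left (by linarith)]
      nlinarith
  exact hpl.exists_eq_forall_mem_Icc_hasDerivWithinAt₀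

theorem center_iff {T : ℝ} (hT : 0 < T) {a : Fin n → ℝ → ℂ} (ha : ∀ i, ContinuousOn (a i) (Icc 0 T)) :
    DeterminesCenter T a ↔ ∀ d c, d < c → Jr a Xc d c T = 0 := by
  obtain ⟨C, hC0, hC⟩ : ∃ C : ℝ, 0 ≤ C ∧ ∀ i, ∀ x ∈ Icc 0 T, ‖a i x‖ ≤ C := by
    choose C hC using fun i => isCompact_Icc.exists_bound_of_continuousOn (ha i)
    refine ⟨∑ i, |C i|, by positivity, fun i x hx => (hC i x hx).trans ((le_abs_self _).trans ?_)⟩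
    exact Finset.single_le_sum (f := fun i => |C i|) (fun i _ => abs_nonneg _) (Finset.mem_univ i)
  have h0T : (0:ℝ) ∈ Icc 0 T := ⟨le_rfl, hT.le⟩
  have hTT : T ∈ Icc 0 T := ⟨hT.le, le_rfl⟩
  set M : ℝ := 4 * n * C * T + 2 with hM
  have hM2 : 2 ≤ M := by rw [hM]; have : 0 ≤ 4 * n * C * T := by positivity
                         linarith
  have hsm : ∀ ε : ℝ, 0 < ε → ε ≤ 1 / M → 2 * ε ≤ 1 ∧ 4 * n * C * T * ε < 1 := by
    intro ε h1 h2
    rw [le_div_iff₀ (by linarith)] at h2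
    have h3 : 0 ≤ 4 * n * C * T := by positivity
    constructor <;> nlinarith
  constructor
  · rintro ⟨ε, hε, hc⟩ d b
    induction b using Nat.strong_induction_on with
    | _ b ih =>
    intro hdb
    obtain ⟨B, hB0, hB⟩ : ∃ B : ℝ, 0 ≤ B ∧ ∀ c ≤ b, ∀ x ∈ Icc 0 T, ‖Jr a Xc d c x‖ ≤ B := by
      choose B hB using fun c => isCompact_Icc.exists_bound_of_continuousOn (Jr_cd hT ha Xc d c).1
      refine ⟨∑ c ∈ Finset.range (b+1), |B c|, by positivity, fun c hcb x hx => (hB c x hx).trans ((le_abs_self _).trans ?_)⟩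
      exact Finset.single_le_sum (f := fun i => |B i|) (fun i _ => abs_nonneg _) (Finset.mem_range.2 (by omega))
    set D : ℝ := (b+1) * (n * (b * B * C * 2^(b+1))) * T with hD
    have hD0 : 0 ≤ D := by positivity
    have key : ∀ η : ℝ, 0 < η → η ≤ 1 / M → η < ε → ‖Jr a Xc d b T‖ ≤ D * η := by
      intro η h1 h2 h3
      obtain ⟨h4, h5⟩ := hsm η h1 h2
      have hn : ‖(η:ℂ)‖ = η := by simp [abs_of_pos h1]
      obtain ⟨v, hv0, hv⟩ := sol_exists hT ha hC0 hC h1 h4 h5 η hn.le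
      have hvb := apriori hT hC0 hC h1 h4 h5 hv (by rw [hv0, hn])
      have hvc : ContinuousOn v (Icc 0 T) := fun x hx => (hv x hx).continuousWithinAt
      have hgc : ContinuousOn (fun s => ∑ i, a i s * v s ^ ((i:ℕ)+2)) (Icc 0 T) :=
        continuousOn_finsetSum _ fun i _ => (ha i).mul (hvc.pow _)
      have hvT : v T = v 0 := by
        refine hc v (fun x hx => ?_) (by rw [hv0, hn]; exact h3)
        rw [intervalIntegral.integral_eq_sub_of_hasDerivAt_of_le hx.1 (hvc.mono (Icc_subset_Icc_right hx.2))]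
        · ring
        · intro y hy
          exact (hv y ⟨hy.1.le, hy.2.le.trans hx.2⟩).hasDerivAt (Icc_mem_nhds hy.1 (hy.2.trans_le hx.2))
        · refine ContinuousOn.intervalIntegrable ?_
          rw [uIcc_of_le hx.1]
          exact hgc.mono (Icc_subset_Icc_right hx.2)
      have hK := Kf_bd hT ha d b hC0 hC hB0 hB (by positivity) h4 hv hvb
      rw [Kf_zero _ _ _ _ hdb.le, Kf_T a v d b hdb T (fun c h6 h7 => ih c h7 h6), hvT, add_sub_cancel_left, norm_mul, norm_pow, hv0, hn] at hK
      have h8 : ((b:ℝ)+1) * (n * (b * B * C * (2*η)^(b+1))) * T = (D * η) * η ^ b := by rw [hD]; ring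
      rw [h8] at hK
      exact le_of_mul_le_mul_right hK (by positivity)
    by_contra hne
    have hpos : 0 < ‖Jr a Xc d b T‖ := norm_pos_iff.2 hne
    have hM0 : 0 < 1 / M := by positivity
    set η := min (min (1/M) (ε/2)) (‖Jr a Xc d b T‖ / (2 * (D + 1))) with hη
    have hη0 : 0 < η := by rw [hη]; positivity
    have h1 := key η hη0 ((min_le_left _ _).trans (min_le_left _ _))
      (((min_le_left _ _).trans (min_le_right _ _)).trans_lt (by linarith))
    have h2 : η ≤ ‖Jr a Xc d b T‖ / (2 * (D + 1)) := min_le_right _ _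
    rw [le_div_iff₀ (by positivity)] at h2
    nlinarith
  · intro hJ
    set L : ℝ := 1 + C * n * T with hL
    have hL1 : 1 ≤ L := by rw [hL]; have : 0 ≤ C * n * T := by positivity
                           linarith
    have hε : 0 < 1 / (M * (4 * L)) := by positivity
    refine ⟨1 / (M * (4 * L)), hε, fun v hv hv0 => ?_⟩
    set ε := 1 / (M * (4 * L)) with hεd
    have hεM : ε ≤ 1 / M := by
      rw [hεd]
      exact one_div_le_one_div_of_le (by linarith) (by nlinarith)
    have hεL : L * (2 * ε) ≤ 1 / 2 := by
      rw [hεd]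
      have : L * (2 * (1 / (M * (4 * L)))) = (1 / 2) * (1 / M) := by field_simp; norm_num
      rw [this]
      have : 1 / M ≤ 1 := by rw [div_le_one (by linarith)]; linarith
      linarith
    obtain ⟨h4, h5⟩ := hsm ε hε hεM
    by_cases hint : IntervalIntegrable (fun s => ∑ i, a i s * v s ^ ((i : ℕ) + 2)) volume 0 T
    swap
    · rw [hv T hTT, intervalIntegral.integral_undef hint, add_zero]
    have hvc : ContinuousOn v (Icc 0 T) := by
      have h6 := intervalIntegral.continuousOn_primitive_interval' hint left_mem_uIcc
      rw [uIcc_of_le hT.le] at h6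
      exact (continuousOn_const.add h6).congr hv
    have hgc : ContinuousOn (fun s => ∑ i, a i s * v s ^ ((i:ℕ)+2)) (Icc 0 T) :=
      continuousOn_finsetSum _ fun i _ => (ha i).mul (hvc.pow _)
    have hvd : ∀ x ∈ Icc 0 T, HasDerivWithinAt v (∑ i, a i x * v x ^ ((i:ℕ)+2)) (Icc 0 T) x := fun x hx =>
      ((ftcI hT hgc x hx).const_add (v 0)).congr hv (hv x hx)
    have hvb := apriori hT hC0 hC hε h4 h5 hvd hv0.le
    have hbd : ∀ R : ℕ, ‖v T - v 0‖ ≤ (4 * n * C * T) * ((R+2:ℕ)^2 * (1/2:ℝ)^(R+2)) := by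
      intro R
      have hB : ∀ c ≤ R+2, ∀ x ∈ Icc 0 T, ‖Jr a Xc 1 c x‖ ≤ L ^ (R+2) := by
        intro c hc x hx
        rcases c with _ | c
        · rw [Jr]; simp; positivity
        · refine (Jr_grow hT ha hC0 hC c x hx).trans ?_
          have : 1 + C * n * x ≤ L := by rw [hL]; gcongr; exact hx.2
          have h0 : 0 ≤ 1 + C * n * x := by have := mul_nonneg (mul_nonneg hC0 (Nat.cast_nonneg n)) hx.1
                                            linarith
          exact (pow_le_pow_left₀ h0 this c).trans (pow_le_pow_right₀ hL1 (by omega))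
      have hK := Kf_bd hT ha 1 (R+2) hC0 hC (by positivity) hB (by positivity) h4 hvd hvb
      rw [Kf_zero _ _ _ _ (by omega), Kf_T a v 1 (R+2) (by omega) T (fun c h6 h7 => hJ 1 c h6), hJ 1 _ (by omega), zero_mul, add_zero, pow_one, pow_one] at hK
      refine hK.trans ?_
      have h7 : (L * (2*ε)) ^ (R+2) ≤ (1/2:ℝ)^(R+2) := pow_le_pow_left₀ (by positivity) hεL _
      have h8 : (((R+2:ℕ):ℝ)+1) ≤ 2 * (R+2:ℕ) := by push_cast; linarith
      calc (((R+2:ℕ):ℝ)+1) * (n * ((R+2:ℕ) * L^(R+2) * C * (2*ε)^(R+2+1))) * T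
          = (((R+2:ℕ):ℝ)+1) * ((R+2:ℕ) * (n * C * T) * (L * (2*ε))^(R+2) * (2*ε)) := by rw [mul_pow L]; ring
        _ ≤ (2 * (R+2:ℕ)) * ((R+2:ℕ) * (n * C * T) * (1/2)^(R+2) * 1) := by gcongr
        _ ≤ _ := by
          have : 0 ≤ (n * C * T) * (((R+2:ℕ):ℝ)^2 * (1/2)^(R+2)) := by positivity
          linarith
    have hlim : Tendsto (fun R : ℕ => (4 * n * C * T) * ((R+2:ℕ)^2 * (1/2:ℝ)^(R+2))) atTop (𝓝 0) := by
      have h9 := (tendsto_pow_const_mul_const_pow_of_abs_lt_one 2 (r := (1/2:ℝ)) (by norm_num [abs_of_pos])).const_mul (4 * n * C * T)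
      rw [mul_zero] at h9
      exact h9.comp (tendsto_add_atTop_nat 2)
    have := ge_of_tendsto' hlim hbd
    exact sub_eq_zero.1 (norm_le_zero_iff.1 this)
end packE3

section packF1
variable {n k : ℕ}

lemma Jr_word (a : Fin n → ℝ → ℂ) (L : ℕ → Fin n) (d m : ℕ) (x : ℝ) :
    Jr a (fun i c b => if b = c + 1 ∧ L c = i then 1 else 0) d (d+m) x =
      simplexInt ((((List.range m).map fun j => L (d+j)).map a).reverse) x := by
  induction m generalizing x with
  | zero => rw [Nat.add_zero, Jr_one]; simp [simplexInt]
  | succ m ih =>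
    rw [Jr, if_neg (by omega), List.range_succ]
    simp only [List.map_append, List.map_cons, List.map_nil, List.reverse_append, List.reverse_cons, List.reverse_nil,
      List.nil_append, List.singleton_append, simplexInt]
    congr 1
    funext s
    rw [← ih, Finset.sum_eq_single ⟨d+m, by omega⟩]
    · rw [Finset.sum_eq_single (L (d+m))]
      · simp [add_assoc, mul_comm]
      · intro i _ hi; simp [hi.symm]
      · simp
    · intro c _ hc
      rw [Finset.sum_eq_zero, mul_zero]
      intro i _
      rw [if_neg, mul_zero]
      rintro ⟨h, -⟩
      exact hc (Fin.ext (by simp only; omega))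
    · simp

theorem keyW {T : ℝ} (hT : 0 < T) {a b : Fin n → ℝ → ℂ} (ha : ∀ i, WA T (a i)) (hb : ∀ i, WA T (b i))
    (hm : ∀ ps : List (Fin n × ℕ), (∀ q ∈ ps, 0 < q.2) → ∀ i, moment T a ps i = moment T b ps i)
    (h0 : ∀ l : List (Fin n), l ≠ [] → iterInt T b l = 0) (l : List (Fin n)) (hl : l ≠ []) : iterInt T a l = 0 := by
  set L : ℕ → Fin n := fun c => l.getD c (l.head hl) with hL
  have h1 := keyR hT ha hb hm (fun i c b => if b = c + 1 ∧ L c = i then 1 else 0) (fun d c hdc => ?_) 0 (0 + l.length)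
    (by simpa using List.length_pos_iff.2 hl)
  · rw [Jr_word] at h1
    rw [iterInt]
    convert h1 using 4
    refine List.ext_getElem (by simp) fun j h2 h3 => ?_
    simp [hL, h2]
  · obtain ⟨m, rfl⟩ := Nat.exists_eq_add_of_lt hdc
    rw [add_assoc, Jr_word]
    exact h0 _ (by simp)

def PT (T : ℝ) (F : (Fin k → ℂ) → ℝ → ℂ) : Prop :=
  ∃ (ι : Type) (_ : Fintype ι) (c : ι → ℝ → ℂ) (P : ι → MvPolynomial (Fin k) ℂ),
    (∀ j, ContinuousOn (c j) (Icc 0 T)) ∧ ∀ w, ∀ x ∈ Icc 0 T, F w x = ∑ j, c j x * MvPolynomial.eval w (P j)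

lemma PT.const {T : ℝ} (z : ℂ) : PT T (fun (_ : Fin k → ℂ) _ => z) :=
  ⟨Unit, inferInstance, fun _ _ => z, fun _ => 1, fun _ => continuousOn_const, fun w x _ => by simp⟩

lemma PT.add {T : ℝ} {F G : (Fin k → ℂ) → ℝ → ℂ} (hF : PT T F) (hG : PT T G) : PT T (fun w x => F w x + G w x) := by
  obtain ⟨ι, _, c, P, hc, h⟩ := hF
  obtain ⟨κ, _, c', P', hc', h'⟩ := hG
  refine ⟨ι ⊕ κ, inferInstance, Sum.elim c c', Sum.elim P P', ?_, fun w x hx => ?_⟩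
  · rintro (j | j); exacts [hc j, hc' j]
  · simp [h w x hx, h' w x hx]

lemma PT.mul {T : ℝ} {F G : (Fin k → ℂ) → ℝ → ℂ} (hF : PT T F) (hG : PT T G) : PT T (fun w x => F w x * G w x) := by
  obtain ⟨ι, _, c, P, hc, h⟩ := hF
  obtain ⟨κ, _, c', P', hc', h'⟩ := hG
  refine ⟨ι × κ, inferInstance, fun j x => c j.1 x * c' j.2 x, fun j => P j.1 * P' j.2, fun j => (hc j.1).mul (hc' j.2), fun w x hx => ?_⟩
  simp only [h w x hx, h' w x hx, Finset.sum_mul_sum, Fintype.sum_prod_type, map_mul]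
  exact Finset.sum_congr rfl fun i _ => Finset.sum_congr rfl fun j _ => by ring

lemma PT.sum {T : ℝ} {ι : Type*} (s : Finset ι) {F : ι → (Fin k → ℂ) → ℝ → ℂ} (hF : ∀ i ∈ s, PT T (F i)) :
    PT T (fun w x => ∑ i ∈ s, F i w x) := by
  classical
  induction s using Finset.induction_on with
  | empty => simpa using PT.const 0
  | insert i s hi ih =>
    simp only [Finset.sum_insert hi]
    exact (hF i (Finset.mem_insert_self _ _)).add (ih fun j hj => hF j (Finset.mem_insert_of_mem hj))

lemma PT.pow {T : ℝ} {F : (Fin k → ℂ) → ℝ → ℂ} (hF : PT T F) (m : ℕ) : PT T (fun w x => F w x ^ m) := by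
  induction m with
  | zero => simpa using PT.const 1
  | succ m ih => simpa only [pow_succ] using ih.mul hF

lemma PT.int {T : ℝ} (hT : 0 < T) {F : (Fin k → ℂ) → ℝ → ℂ} (hF : PT T F) : PT T (fun w x => ∫ s in (0:ℝ)..x, F w s) := by
  obtain ⟨ι, _, c, P, hc, h⟩ := hF
  refine ⟨ι, inferInstance, fun j x => ∫ s in (0:ℝ)..x, c j s, P, fun j x hx => (ftcI hT (hc j) x hx).continuousWithinAt, fun w x hx => ?_⟩
  have h1 : ∀ s ∈ uIcc 0 x, s ∈ Icc 0 T := fun s hs => by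
    rw [uIcc_of_le hx.1] at hs; exact ⟨hs.1, hs.2.trans hx.2⟩
  show ∫ s in (0:ℝ)..x, F w s = ∑ j, (∫ s in (0:ℝ)..x, c j s) * MvPolynomial.eval w (P j)
  rw [intervalIntegral.integral_congr (g := fun s => ∑ j, c j s * MvPolynomial.eval w (P j)) fun s hs => h w s (h1 s hs),
    intervalIntegral.integral_finsetSum]
  · exact Finset.sum_congr rfl fun j _ => intervalIntegral.integral_mul_const _ _
  · intro j _
    exact (((hc j).mono h1).mul continuousOn_const).intervalIntegrable

lemma PT.val {T : ℝ} {F : (Fin k → ℂ) → ℝ → ℂ} (hF : PT T F) (x : ℝ) (hx : x ∈ Icc 0 T) :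
    ∃ p : MvPolynomial (Fin k) ℂ, ∀ w, MvPolynomial.eval w p = F w x := by
  obtain ⟨ι, _, c, P, hc, h⟩ := hF
  exact ⟨∑ j, MvPolynomial.C (c j x) * P j, fun w => by simp [h w x hx]⟩

lemma PT.Jr {T : ℝ} (hT : 0 < T) {a : Fin n → (Fin k → ℂ) → ℝ → ℂ} (ha : ∀ i, PT T (a i)) (Xm : Fin n → ℕ → ℕ → ℂ)
    (d b : ℕ) : PT T (fun w x => Jr (fun i => a i w) Xm d b x) := by
  induction b using Nat.strong_induction_on with
  | _ b ih =>
  by_cases hb : b ≤ d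
  · have : (fun (w : Fin k → ℂ) x => _root_.Jr (fun i => a i w) Xm d b x) = fun _ _ => if b = d then 1 else 0 := by
      funext w x; rw [_root_.Jr, if_pos hb]
    rw [this]; exact PT.const _
  · have : (fun (w : Fin k → ℂ) x => _root_.Jr (fun i => a i w) Xm d b x) = fun w x => ∫ s in (0:ℝ)..x,
        ∑ c : Fin b, _root_.Jr (fun i => a i w) Xm d c s * ∑ i, a i w s * Xm i c b := by
      funext w x; rw [_root_.Jr, if_neg hb]
    rw [this]
    exact PT.int hT (PT.sum _ fun c _ => (ih c c.2).mul (PT.sum _ fun i _ => (ha i).mul (PT.const _)))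

lemma PT.moment {T : ℝ} (hT : 0 < T) {a : Fin n → (Fin k → ℂ) → ℝ → ℂ} (ha : ∀ i, PT T (a i)) (ps : List (Fin n × ℕ)) (i : Fin n) :
    ∃ p : MvPolynomial (Fin k) ℂ, ∀ w, MvPolynomial.eval w p = moment T (fun i => a i w) ps i := by
  have h1 : PT T (fun w s => (ps.map fun q => primitive (a q.1 w) s ^ q.2).prod) := by
    induction ps with
    | nil => simpa using PT.const 1
    | cons q ps ih =>
      simp only [List.map_cons, List.prod_cons]
      exact ((PT.int hT (ha q.1)).pow q.2).mul ih
  exact PT.val (PT.int hT (h1.mul (ha i))) T ⟨hT.le, le_rfl⟩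

lemma mom_hom {T : ℝ} (hT : 0 < T) {a b : Fin n → ℝ → ℂ} (dd : Fin n → ℕ) (z : ℂ)
    (h : ∀ i, ∀ x ∈ Icc 0 T, b i x = z ^ dd i * a i x) (ps : List (Fin n × ℕ)) (i : Fin n) :
    moment T b ps i = z ^ ((ps.map fun q => dd q.1 * q.2).sum + dd i) * moment T a ps i := by
  rw [moment, moment, ← intervalIntegral.integral_const_mul]
  refine intervalIntegral.integral_congr fun s hs => ?_
  rw [uIcc_of_le hT.le] at hs
  have h1 : ∀ i, primitive (b i) s = z ^ dd i * primitive (a i) s := by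
    intro i
    rw [primitive, primitive, ← intervalIntegral.integral_const_mul]
    refine intervalIntegral.integral_congr fun r hr => ?_
    rw [uIcc_of_le hs.1] at hr
    exact h i r ⟨hr.1, hr.2.trans hs.2⟩
  have h2 : (ps.map fun q => primitive (b q.1) s ^ q.2).prod =
      z ^ (ps.map fun q => dd q.1 * q.2).sum * (ps.map fun q => primitive (a q.1) s ^ q.2).prod := by
    induction ps with
    | nil => simp
    | cons q ps ih =>
      simp only [List.map_cons, List.prod_cons, List.sum_cons]
      rw [ih, h1]
      simp only [pow_add, pow_mul, mul_pow]
      ring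
  simp only [h2, h i s hs, pow_add]
  ring

lemma WA.add {T : ℝ} {f g : ℝ → ℂ} (hf : WA T f) (hg : WA T g) : WA T (fun x => f x + g x) := by
  obtain ⟨P, Q, R, h⟩ := hf
  obtain ⟨P', Q', R', h'⟩ := hg
  exact ⟨P + P', Q + Q', R + R', fun x hx => by
    show f x + g x = _
    rw [h x hx, h' x hx]; simp [Wf]; ring⟩

lemma WA.smul {T : ℝ} {f : ℝ → ℂ} (hf : WA T f) (z : ℂ) : WA T (fun x => f x * z) := by
  obtain ⟨P, Q, R, h⟩ := hf
  exact ⟨P * Polynomial.C z, Q * Polynomial.C z, R * Polynomial.C z, fun x hx => by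
    show f x * z = _
    rw [h x hx]; simp [Wf]; ring⟩

lemma WA.sum {T : ℝ} {ι : Type*} (s : Finset ι) {F : ι → ℝ → ℂ} (hF : ∀ i ∈ s, WA T (F i)) :
    WA T (fun x => ∑ i ∈ s, F i x) := by
  classical
  induction s using Finset.induction_on with
  | empty => exact ⟨0, 0, 0, fun x _ => by simp [Wf]⟩
  | insert i s hi ih =>
    simp only [Finset.sum_insert hi]
    exact (hF i (Finset.mem_insert_self _ _)).add (ih fun j hj => hF j (Finset.mem_insert_of_mem hj))

lemma WA.congr {T : ℝ} {f g : ℝ → ℂ} (hf : WA T f) (h : ∀ x ∈ Icc 0 T, g x = f x) : WA T g := by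
  obtain ⟨P, Q, R, h'⟩ := hf
  exact ⟨P, Q, R, fun x hx => by rw [h x hx, h' x hx]⟩

lemma WA.cont {T : ℝ} {f : ℝ → ℂ} (hf : WA T f) : ContinuousOn f (Icc 0 T) := by
  obtain ⟨P, Q, R, h⟩ := hf
  exact (((Wf_diff _ P Q R).continuous.comp Complex.continuous_ofReal).continuousOn).congr h

lemma WA.adm {T : ℝ} {f : ℝ → ℂ} (hf : Admissible T f) : WA T f := by
  rcases hf with ⟨p, hp⟩ | ⟨s, c, h⟩
  · exact ⟨p, 0, 0, fun x hx => by rw [hp x hx]; simp [Wf]⟩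
  · refine WA.congr (WA.sum s fun j _ => ?_) h
    have : WA T (fun x : ℝ => Complex.exp (2 * (Real.pi : ℂ) * Complex.I * (j : ℂ) * (x : ℂ) / (T : ℂ))) := by
      rcases Int.eq_nat_or_neg j with ⟨m, rfl | rfl⟩
      · refine ⟨0, Polynomial.X ^ m, 0, fun x _ => ?_⟩
        simp only [Wf, Polynomial.eval_zero, Polynomial.eval_pow, Polynomial.eval_X, ← Complex.exp_nat_mul, zero_add, add_zero]
        congr 1; push_cast; ring
      · refine ⟨0, 0, Polynomial.X ^ m, fun x _ => ?_⟩
        simp only [Wf, Polynomial.eval_zero, Polynomial.eval_pow, Polynomial.eval_X, ← Complex.exp_nat_mul, zero_add, add_zero]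
        congr 1; push_cast; ring
    exact (this.smul (c j)).congr fun x _ => mul_comm _ _
end packF1

section packF2
variable {k : ℕ}
open MvPolynomial

lemma wh_of_eval (α : Fin k → ℕ) (p : MvPolynomial (Fin k) ℂ) (D : ℕ)
    (h : ∀ w : Fin k → ℂ, eval (fun t => (2:ℂ) ^ α t * w t) p = 2 ^ D * eval w p) : IsWeightedHomogeneous α p D := by
  intro β hβ
  have h1 : ∑ b ∈ p.support, monomial b ((2:ℂ) ^ (Finsupp.weight α b) * coeff b p) = C (2 ^ D) * p := by
    refine MvPolynomial.funext fun w => ?_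
    rw [map_mul, eval_C, ← h w, map_sum]
    conv_rhs => rw [eval_eq']
    refine Finset.sum_congr rfl fun b _ => ?_
    rw [eval_monomial, Finsupp.weight_apply, Finsupp.sum_fintype _ _ (by simp), Finsupp.prod_fintype _ _ (by simp)]
    simp only [mul_pow, Finset.prod_mul_distrib, smul_eq_mul, ← pow_mul, Finset.prod_pow_eq_pow_sum]
    simp only [mul_comm (α _)]
    ring
  have h2 := congrArg (coeff β) h1
  rw [coeff_sum, coeff_C_mul, Finset.sum_eq_single β] at h2
  · rw [coeff_monomial, if_pos rfl] at h2
    have h3 := mul_right_cancel₀ hβ h2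
    have h4 : (2:ℕ) ^ (Finsupp.weight α β) = 2 ^ D := by exact_mod_cast h3
    exact Nat.pow_right_injective le_rfl h4
  · intro b _ hb
    rw [coeff_monomial, if_neg hb]
  · intro hb
    rw [notMem_support_iff.1 hb]; simp

theorem adj_int {ι : Type*} (mp : ι → MvPolynomial (Fin k) ℂ) (D : ι → ℕ) (α : Fin k → ℕ)
    (hh : ∀ i, IsWeightedHomogeneous α (mp i) (D i))
    (hz : ∀ w : Fin k → ℂ, (∀ i, 0 < D i → eval w (mp i) = 0) → w = 0) :
    Algebra.IsIntegral (Algebra.adjoin ℂ (range mp)) (MvPolynomial (Fin k) ℂ) := by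
  classical
  set S := Algebra.adjoin ℂ (range mp) with hS
  set J : Ideal (MvPolynomial (Fin k) ℂ) := Ideal.span (mp '' {i | 0 < D i}) with hJ
  have h1 : ∀ t : Fin k, ∃ M : ℕ, (X t : MvPolynomial (Fin k) ℂ) ^ M ∈ J := by
    intro t
    have : (X t : MvPolynomial (Fin k) ℂ) ∈ J.radical := by
      rw [← vanishingIdeal_zeroLocus_eq_radical (K := ℂ), mem_vanishingIdeal_iff]
      intro w hw
      have : w = 0 := hz w fun i hi => by
        have := mem_zeroLocus_iff.1 hw (mp i) (Ideal.subset_span ⟨i, hi, rfl⟩)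
        simpa using this
      simp [this]
    exact this
  choose M hM using h1
  set B : Set (MvPolynomial (Fin k) ℂ) := (fun β => monomial β (1:ℂ)) '' {β : Fin k →₀ ℕ | ∀ t, β t < M t} with hB
  have hBf : B.Finite := by
    refine Set.Finite.image _ ((Set.finite_Iic (Finsupp.equivFunOnFinite.symm M)).subset fun β hβ => ?_)
    intro t; simpa using (hβ t).le
  set V : Submodule S (MvPolynomial (Fin k) ℂ) := Submodule.span S B with hV
  have hVC : ∀ (c : ℂ) p, p ∈ V → c • p ∈ V := by
    intro c p hp
    have := V.smul_mem (algebraMap ℂ S c) hp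
    rwa [algebraMap_smul] at this
  have hmon : ∀ N : ℕ, ∀ β : Fin k →₀ ℕ, Finsupp.weight α β = N → monomial β (1:ℂ) ∈ V := by
    intro N
    induction N using Nat.strong_induction_on with
    | _ N ih =>
    have hcomp : ∀ r ∈ J, weightedHomogeneousComponent α N r ∈ V := by
      intro r hr
      refine Submodule.span_induction (p := fun r _ => ∀ q : MvPolynomial (Fin k) ℂ, weightedHomogeneousComponent α N (q * r) ∈ V) ?_ ?_ ?_ ?_ hr 1 |> fun h => by simpa using h
      · rintro _ ⟨i, hi, rfl⟩ q
        induction q using MvPolynomial.induction_on' with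
        | monomial γ c =>
          have h2 : IsWeightedHomogeneous α (monomial γ c * mp i) (Finsupp.weight α γ + D i) :=
            (isWeightedHomogeneous_monomial α γ c rfl).mul (hh i)
          by_cases h3 : Finsupp.weight α γ + D i = N
          · rw [← h3, h2.weightedHomogeneousComponent_same]
            have hi' : 0 < D i := hi
            have h4 := V.smul_mem (⟨mp i, Algebra.subset_adjoin ⟨i, rfl⟩⟩ : S) (hVC c _ (ih _ (by omega) γ rfl))
            convert h4 using 1
            rw [smul_monomial, smul_eq_mul, mul_one, mul_comm]; rfl
          · rw [h2.weightedHomogeneousComponent_ne _ (Ne.symm h3)]; exact V.zero_mem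
        | add p q hp hq => rw [add_mul, map_add]; exact V.add_mem hp hq
      · intro q; simp
      · intro x y _ _ hx hy q
        rw [mul_add, map_add]; exact V.add_mem (hx q) (hy q)
      · intro c x _ hx q
        rw [smul_eq_mul, ← mul_assoc]; exact hx _
    intro β hβ
    by_cases h5 : ∀ t, β t < M t
    · exact Submodule.subset_span ⟨β, h5, rfl⟩
    · push Not at h5
      obtain ⟨t, ht⟩ := h5
      have h6 : monomial β (1:ℂ) ∈ J := by
        have : monomial β (1:ℂ) = monomial (β - Finsupp.single t (M t)) 1 * X t ^ M t := by
          rw [X_pow_eq_monomial, monomial_mul, one_mul, tsub_add_cancel_of_le]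
          simpa using ht
        rw [this]; exact J.mul_mem_left _ (hM t)
      have := hcomp _ h6
      rwa [IsWeightedHomogeneous.weightedHomogeneousComponent_same (isWeightedHomogeneous_monomial α β 1 hβ)] at this
  have hVt : V = ⊤ := by
    refine eq_top_iff.2 fun p _ => ?_
    induction p using MvPolynomial.induction_on' with
    | monomial γ c =>
      have := hVC c _ (hmon _ γ rfl)
      rwa [smul_monomial, smul_eq_mul, mul_one] at this
    | add p q hp hq => exact V.add_mem (hp trivial) (hq trivial)
  have : Module.Finite S (MvPolynomial (Fin k) ℂ) := ⟨by
    rw [← hVt]; exact Submodule.fg_span hBf⟩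
  infer_instance

theorem pt_lift (S : Subalgebra ℂ (MvPolynomial (Fin k) ℂ)) [Algebra.IsIntegral S (MvPolynomial (Fin k) ℂ)]
    (I : Ideal (MvPolynomial (Fin k) ℂ)) (w0 : Fin k → ℂ) (h : ∀ p ∈ I, p ∈ S → eval w0 p = 0) :
    ∃ w1 : Fin k → ℂ, (∀ p ∈ I, eval w1 p = 0) ∧ ∀ p ∈ S, eval w1 p = eval w0 p := by
  set φ : S →+* ℂ := (eval w0).comp (algebraMap S (MvPolynomial (Fin k) ℂ)) with hφ
  have hs : Function.Surjective φ := fun z => ⟨algebraMap ℂ S z, by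
    show eval w0 (C z) = z
    simp⟩
  have hmax : (RingHom.ker φ).IsMaximal := RingHom.ker_isMaximal_of_surjective φ hs
  have := hmax.isPrime
  obtain ⟨Q, hQI, hQp, hQ⟩ := Ideal.exists_ideal_over_prime_of_isIntegral (RingHom.ker φ) I fun p hp =>
    (RingHom.mem_ker).2 (h p.1 hp p.2)
  have hQm : Q.IsMaximal := Ideal.isMaximal_of_isIntegral_of_isMaximal_comap (R := S) Q (by rw [hQ]; exact hmax)
  obtain ⟨w1, rfl⟩ := isMaximal_iff_eq_vanishingIdeal_singleton.1 hQm
  refine ⟨w1, fun p hp => by simpa using (mem_vanishingIdeal_singleton_iff w1 p).1 (hQI hp), fun p hp => ?_⟩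
  have h1 : (⟨p, hp⟩ - algebraMap ℂ S (eval w0 p) : S) ∈ RingHom.ker φ := by
    rw [RingHom.mem_ker]
    show eval w0 (p - C (eval w0 p)) = 0
    simp
  rw [← hQ] at h1
  have h2 := (mem_vanishingIdeal_singleton_iff w1 _).1 (Ideal.mem_comap.1 h1)
  have h3 : eval w1 (p - C (eval w0 p)) = 0 := by simpa using h2
  rw [map_sub, eval_C] at h3
  exact sub_eq_zero.1 h3

lemma pad_fin {W ι : Type*} [Inhabited ι] (x : W → ι → ℂ) (Q : List (MvPolynomial ι ℂ)) :
    ∃ N : ℕ, 1 ≤ N ∧ ∃ (e : Fin N → ι) (p : Fin N → MvPolynomial (Fin N) ℂ),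
      ∀ w, (∀ q ∈ Q, eval (x w) q = 0) ↔ ∀ j, eval (fun t => x w (e t)) (p j) = 0 := by
  classical
  set L : List ι := Q.flatMap fun q => q.vars.toList with hL
  set N := max Q.length L.length with hN
  refine ⟨N + 1, by omega, fun t => L.getD t default,
    fun j => rename (fun i => Fin.ofNat (N+1) (L.idxOf i)) (Q.getD j 0), fun w => ?_⟩
  have key : ∀ q ∈ Q, eval (fun t : Fin (N+1) => x w (L.getD t default)) (rename (fun i => Fin.ofNat (N+1) (L.idxOf i)) q) = eval (x w) q := by
    intro q hq
    rw [eval_rename]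
    refine eval₂Hom_congr' rfl (fun i hi _ => ?_) rfl
    have h1 : i ∈ L := List.mem_flatMap.2 ⟨q, hq, by simpa using hi⟩
    have h2 := List.idxOf_lt_length_iff.2 h1
    have h3 : L.idxOf i % (N+1) = L.idxOf i := Nat.mod_eq_of_lt (by omega)
    simp [Fin.ofNat, h3, h2]
  constructor
  · intro h j
    by_cases hj : (j:ℕ) < Q.length
    · have hm : Q.getD j 0 ∈ Q := by
        rw [List.getD_eq_getElem _ _ hj]; exact List.getElem_mem _
      exact (key _ hm).trans (h _ hm)
    · beta_reduce
      rw [List.getD_eq_default _ _ (by omega)]; simp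
  · intro h q hq
    obtain ⟨j, hj, rfl⟩ := List.getElem_of_mem hq
    have h1 := h ⟨j, by omega⟩
    simp only [List.getD_eq_getElem _ _ hj] at h1
    rw [← key _ hq]; exact h1
end packF2

/-- **Theorem 2.**  Suppose the coefficients `a_i(w,x)` of the equation
`dv/dx = Σ a_i(w,x) v^{i+1}` are `α`-homogeneous polynomials in `w ∈ ℂ^k` whose
coefficients are admissible functions of `x`, and the universal center set is `{0}`.
Then the center set is the common zero set of finitely many polynomials in
finitely many moments. -/
theorem center_set_cut_out_by_polynomials_in_moments
    (T : ℝ) (hT : 0 < T) (n k : ℕ) (hn : 1 ≤ n) (hk : 1 ≤ k)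
    (α : Fin k → ℕ) (hα : ∀ t, 0 < α t)
    (a : Fin n → (Fin k → ℂ) → ℝ → ℂ)
    -- each `a i` is a finite sum of monomials in `w` with admissible coefficients in `x`
    (hrep : ∀ i, ∃ (s : Finset (Fin k →₀ ℕ)) (c : (Fin k →₀ ℕ) → ℝ → ℂ),
      (∀ β ∈ s, Admissible T (c β)) ∧
      ∀ (w : Fin k → ℂ), ∀ x ∈ Icc (0:ℝ) T,
        a i w x = ∑ β ∈ s, c β x * ∏ t, w t ^ β t)
    -- each `a i (·, x)` is `α`-homogeneous:  `a i (λ^α • w) x = λ^{d_i} a i w x`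
    (hhom : ∀ i, ∃ dd : ℕ, ∀ (lam : ℂ) (w : Fin k → ℂ), ∀ x ∈ Icc (0:ℝ) T,
      a i (fun t => lam ^ α t * w t) x = lam ^ dd * a i w x)
    -- the universal center set `𝒰_A` is exactly `{0}`
    (hU : {w : Fin k → ℂ | ∀ l : List (Fin n), l ≠ [] → iterInt T (fun i => a i w) l = 0}
      = {(0 : Fin k → ℂ)}) :
    ∃ N : ℕ, 1 ≤ N ∧
      ∃ (ps : Fin N → List (Fin n × ℕ)) (idx : Fin N → Fin n)
        (p : Fin N → MvPolynomial (Fin N) ℂ),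
        (∀ j, ∀ q ∈ ps j, 0 < q.2) ∧
        {w : Fin k → ℂ | DeterminesCenter T (fun i => a i w)} =
          {w : Fin k → ℂ | ∀ j, MvPolynomial.eval
            (fun t => moment T (fun i => a i w) (ps t) (idx t)) (p j) = 0} := by
  classical
  choose s c hc hs using hrep
  choose dd hdd using hhom
  have hWA : ∀ w i, WA T (a i w) := fun w i =>
    WA.congr (WA.sum (s i) fun β hβ => (WA.adm (hc i β hβ)).smul (∏ t, w t ^ β t)) (hs i w)
  have hPT : ∀ i, PT T (a i) := fun i => by
    refine ⟨{β // β ∈ s i}, inferInstance, fun β => c i β.1, fun β => MvPolynomial.monomial β.1 1,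
      fun β => (WA.adm (hc i β.1 β.2)).cont, fun w x hx => ?_⟩
    rw [hs i w x hx, ← Finset.sum_coe_sort]
    refine Finset.sum_congr rfl fun β _ => ?_
    rw [MvPolynomial.eval_monomial, one_mul, Finsupp.prod_fintype _ _ (by simp)]
  choose mp hmp using fun (ps : List (Fin n × ℕ)) (i : Fin n) => PT.moment hT hPT ps i
  choose jp hjp using fun (d b : ℕ) => PT.val (PT.Jr hT hPT Xc d b) T ⟨hT.le, le_rfl⟩
  let ι := {ps : List (Fin n × ℕ) // ∀ q ∈ ps, 0 < q.2} × Fin n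
  have : Inhabited ι := ⟨(⟨[], by simp⟩, ⟨0, hn⟩)⟩
  let m : ι → MvPolynomial (Fin k) ℂ := fun u => mp u.1.1 u.2
  let D : ι → ℕ := fun u => (u.1.1.map fun q => dd q.1 * q.2).sum + dd u.2
  have hsc : ∀ (u : ι) (z : ℂ) (w : Fin k → ℂ), MvPolynomial.eval (fun t => z ^ α t * w t) (m u) =
      z ^ D u * MvPolynomial.eval w (m u) := by
    intro u z w
    rw [hmp, hmp]
    exact mom_hom hT dd z (fun i x hx => hdd i z w x hx) _ _
  have hint : Algebra.IsIntegral (Algebra.adjoin ℂ (range m)) (MvPolynomial (Fin k) ℂ) := by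
    refine adj_int m D α (fun u => wh_of_eval α _ _ (hsc u 2)) fun w hw => ?_
    have h0 : (0 : Fin k → ℂ) ∈ {w : Fin k → ℂ | ∀ l : List (Fin n), l ≠ [] → iterInt T (fun i => a i w) l = 0} := by
      rw [hU]; rfl
    have h1 : w ∈ {w : Fin k → ℂ | ∀ l : List (Fin n), l ≠ [] → iterInt T (fun i => a i w) l = 0} := by
      refine fun l hl => keyW hT (hWA w) (hWA 0) (fun ps hps i => ?_) h0 l hl
      have hz : (fun t => (0:ℂ) ^ α t * w t) = 0 := by
        funext t; simp [(hα t).ne']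
      have h2 := hsc (⟨ps, hps⟩, i) 0 w
      rw [hz] at h2
      rw [← hmp, ← hmp]
      refine Eq.trans ?_ h2.symm
      by_cases hD : D (⟨ps, hps⟩, i) = 0
      · rw [hD, pow_zero, one_mul]
      · rw [zero_pow hD, zero_mul]; exact hw _ (Nat.pos_of_ne_zero hD)
    rw [hU] at h1; exact h1
  let I : Ideal (MvPolynomial (Fin k) ℂ) := Ideal.span {p | ∃ d b, d < b ∧ p = jp d b}
  have hcen : ∀ w, DeterminesCenter T (fun i => a i w) ↔ ∀ p ∈ I, MvPolynomial.eval w p = 0 := by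
    intro w
    rw [center_iff hT (fun i => (hWA w i).cont)]
    constructor
    · intro h p hp
      have : I ≤ RingHom.ker (MvPolynomial.eval w) := Ideal.span_le.2 (by
        rintro _ ⟨d, b, hdb, rfl⟩
        exact (hjp d b w).trans (h d b hdb))
      exact this hp
    · intro h d b hdb
      exact (hjp d b w).symm.trans (h _ (Ideal.subset_span ⟨d, b, hdb, rfl⟩))
  let G : Set (MvPolynomial (Fin k) ℂ) := {p | p ∈ I ∧ p ∈ Algebra.adjoin ℂ (range m)}
  have hG : ∀ w, DeterminesCenter T (fun i => a i w) ↔ ∀ p ∈ G, MvPolynomial.eval w p = 0 := by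
    intro w
    refine ⟨fun h p hp => (hcen w).1 h p hp.1, fun h => ?_⟩
    obtain ⟨w1, h1, h2⟩ := pt_lift (Algebra.adjoin ℂ (range m)) I w fun p hp hp' => h p ⟨hp, hp'⟩
    rw [center_iff hT (fun i => (hWA w i).cont)]
    refine fun d b => keyR hT (hWA w) (hWA w1) (fun ps hps i => ?_) Xc
      ((center_iff hT (fun i => (hWA w1 i).cont)).1 ((hcen w1).2 h1)) d b
    rw [← hmp, ← hmp]
    exact (h2 _ (Algebra.subset_adjoin ⟨(⟨ps, hps⟩, i), rfl⟩)).symm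
  obtain ⟨F, hFG, hF⟩ := (Submodule.fg_span_iff_fg_span_finset_subset G).1
    (IsNoetherian.noetherian (Submodule.span (MvPolynomial (Fin k) ℂ) G))
  have hF2 : ∀ w, DeterminesCenter T (fun i => a i w) ↔ ∀ p ∈ F, MvPolynomial.eval w p = 0 := by
    intro w
    rw [hG]
    refine ⟨fun h p hp => h p (hFG hp), fun h p hp => ?_⟩
    have h1 : p ∈ Ideal.span (F : Set (MvPolynomial (Fin k) ℂ)) := by
      have : p ∈ Submodule.span (MvPolynomial (Fin k) ℂ) G := Submodule.subset_span hp
      rw [hF] at this; exact this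
    have h2 : Ideal.span (F : Set (MvPolynomial (Fin k) ℂ)) ≤ RingHom.ker (MvPolynomial.eval w) :=
      Ideal.span_le.2 fun q hq => h q hq
    exact h2 h1
  have hlift : ∀ p : MvPolynomial (Fin k) ℂ, ∃ P : MvPolynomial ι ℂ, p ∈ F → ∀ w,
      MvPolynomial.eval (fun u : ι => moment T (fun i => a i w) u.1.1 u.2) P = MvPolynomial.eval w p := by
    intro p
    by_cases hp : p ∈ F
    · have h1 := (hFG hp).2
      rw [Algebra.adjoin_range_eq_range_aeval] at h1
      obtain ⟨P, rfl⟩ := h1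
      refine ⟨P, fun h2 w => ?_⟩
      clear hp h2
      have : (fun u : ι => moment T (fun i => a i w) u.1.1 u.2) = fun u => MvPolynomial.eval w (m u) := by
        funext u; exact (hmp _ _ _).symm
      rw [this]
      show _ = MvPolynomial.eval w (MvPolynomial.aeval m P)
      induction P using MvPolynomial.induction_on with
      | C z => simp
      | add p q hp hq => simp only [map_add, hp, hq]
      | mul_X p i hp => simp only [map_mul, hp, MvPolynomial.eval_X, MvPolynomial.aeval_X]
    · exact ⟨0, fun h => absurd h hp⟩
  choose lft hlft using hlift
  obtain ⟨N, hN, e, p, h⟩ := pad_fin (fun (w : Fin k → ℂ) (u : ι) => moment T (fun i => a i w) u.1.1 u.2) (F.toList.map lft)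
  refine ⟨N, hN, fun t => (e t).1.1, fun t => (e t).2, p, fun j => (e j).1.2, Set.ext fun w => ?_⟩
  refine (hF2 w).trans (Iff.trans ?_ (h w))
  simp only [List.mem_map, Finset.mem_toList]
  constructor
  · rintro h1 _ ⟨q, hq, rfl⟩
    exact (hlft q hq w).trans (h1 q hq)
  · intro h1 q hq
    exact (hlft q hq w).symm.trans (h1 _ ⟨q, hq, rfl⟩)

end
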